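/- arXiv:0903.4008 — 7 statements merged into one kernel-verified Lean document; each statement's English description precedes it below -/
import Mathlib

section
/- Let q ≥ 1 and let m, n be integers with gcd(mn, q) = 1. Then Σ*_{χ (mod q)} χ(m)·conj(χ(n)) = Σ_{k | gcd(q, m−n)} φ(k)·μ(q/k), where on the left the sum runs over all primitive Dirichlet characters modulo q. -/
namespace DirichletCharacter

open scoped Classical in
/-- Every Dirichlet character modulo `N` is induced by exactly one primitive character of modulus
dividing `N`. -/
theorem sum_eq_sum_divisors_sum_isPrimitive {R M : Type*} [CommRing R] [IsDomain R]
    [AddCommMonoid M] {N : ℕ} [NeZero N] (F : ∀ k : ℕ, DirichletCharacter R k → M)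
    (hF : ∀ (k : ℕ) (hk : k ∣ N) (χ : DirichletCharacter R k),
      F N (changeLevel hk χ) = F k χ) :
    ∑ χ : DirichletCharacter R N, F N χ =
      ∑ k ∈ N.divisors, ∑ χ : DirichletCharacter R k, if χ.IsPrimitive then F k χ else 0 := by
  rw [← Finset.sum_fiberwise_of_maps_to (s := Finset.univ) (t := N.divisors)
    (g := fun χ : DirichletCharacter R N ↦ χ.conductor)
    fun χ _ ↦ Nat.mem_divisors.mpr ⟨χ.conductor_dvd_level, NeZero.ne N⟩]
  refine Finset.sum_congr rfl fun k hk ↦ ?_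
  have hkN := Nat.dvd_of_mem_divisors hk
  rw [← Finset.sum_filter]
  symm
  refine Finset.sum_nbij (changeLevel hkN) (fun χ hχ ↦ ?_)
    (changeLevel_injective hkN).injOn (fun χ hχ ↦ ?_) fun χ _ ↦ (hF k hkN χ).symm
  · simpa [conductor_changeLevel, isPrimitive_def] using hχ
  · obtain rfl : χ.conductor = k := by simpa using hχ
    exact ⟨χ.primitiveCharacter, by simpa using χ.primitiveCharacter_isPrimitive,
      χ.changeLevel_primitiveCharacter⟩

/-- Orthogonality of the Dirichlet characters modulo `d`, evaluated at integers coprime to `d`. -/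
theorem sum_apply_intCast_mul_conj {d : ℕ} [NeZero d] (m : ℤ) {n : ℤ} (hn : IsCoprime n d) :
    ∑ χ : DirichletCharacter ℂ d, χ (m : ZMod d) * (starRingEnd ℂ) (χ (n : ZMod d)) =
      if (d : ℤ) ∣ m - n then (d.totient : ℂ) else 0 := by
  have hu : IsUnit (n : ZMod d) := ZMod.coe_int_isUnit_iff_isCoprime n d |>.mpr hn.symm
  have hdvd : (d : ℤ) ∣ m - n ↔ (n : ZMod d) = m := by
    rw [ZMod.intCast_eq_intCast_iff_dvd_sub]
  simp only [hdvd]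
  rw [← sum_char_inv_mul_char_eq ℂ hu]
  refine Finset.sum_congr rfl fun χ _ ↦ ?_
  have hinv : χ (n : ZMod d)⁻¹ = (χ (n : ZMod d))⁻¹ :=
    eq_inv_of_mul_eq_one_left (by rw [← map_mul, ZMod.inv_mul_of_unit _ hu, map_one])
  rw [mul_comm, starRingEnd_apply, MulChar.star_apply', MulChar.inv_apply_eq_inv', hinv]

end DirichletCharacter

open scoped Classical in
/-- Lemma 3 (first part): for `q ≥ 1` and integers `m, n` with `gcd(mn, q) = 1`,
`∑*_{χ mod q} χ(m) conj(χ(n)) = ∑_{k | gcd(q, m−n)} φ(k) μ(q/k)`, the sum on the left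
running over the primitive Dirichlet characters modulo `q`. -/
theorem fourth_moment_orthogonality_primitive
    (q : ℕ) (hq : 1 ≤ q) (m n : ℤ) (hmn : Int.gcd (m * n) q = 1) :
    (∑ χ : DirichletCharacter ℂ q,
        if χ.IsPrimitive then χ ((m : ZMod q)) * (starRingEnd ℂ) (χ ((n : ZMod q))) else 0) =
      ∑ k ∈ (Int.gcd (m - n) (q : ℤ)).divisors,
        ((Nat.totient k : ℂ) * (ArithmeticFunction.moebius (q / k) : ℂ)) := by
  have hcop : IsCoprime (m * n) (q : ℤ) := Int.isCoprime_iff_gcd_eq_one.mpr hmn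
  have hm {d : ℕ} (hd : d ∣ q) : IsCoprime m d :=
    hcop.of_mul_left_left.of_isCoprime_of_dvd_right (Int.natCast_dvd_natCast.mpr hd)
  have hn {d : ℕ} (hd : d ∣ q) : IsCoprime n d :=
    hcop.of_mul_left_right.of_isCoprime_of_dvd_right (Int.natCast_dvd_natCast.mpr hd)
  have hsum : ∀ d > 0, d ∈ {d | d ∣ q} →
      ∑ k ∈ d.divisors, (∑ χ : DirichletCharacter ℂ k,
        if χ.IsPrimitive then χ (m : ZMod k) * (starRingEnd ℂ) (χ (n : ZMod k)) else 0) =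
      if (d : ℤ) ∣ m - n then (d.totient : ℂ) else 0 := by
    intro d hd hdq
    have : NeZero d := ⟨hd.ne'⟩
    rw [← DirichletCharacter.sum_apply_intCast_mul_conj m (hn hdq)]
    refine (DirichletCharacter.sum_eq_sum_divisors_sum_isPrimitive
      (fun k χ ↦ χ (m : ZMod k) * (starRingEnd ℂ) (χ (n : ZMod k))) fun k hk χ ↦ ?_).symm
    rw [DirichletCharacter.changeLevel_eq_cast_of_dvd' _ _ (hm hdq),
      DirichletCharacter.changeLevel_eq_cast_of_dvd' _ _ (hn hdq)]
  rw [← (ArithmeticFunction.sum_eq_iff_sum_mul_moebius_eq_on _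
    fun _ _ ↦ Nat.dvd_trans).mp hsum q hq dvd_rfl,
    Nat.sum_divisorsAntidiagonal' fun i j ↦
      (ArithmeticFunction.moebius i : ℂ) * if (j : ℤ) ∣ m - n then (j.totient : ℂ) else 0]
  have hdiv : (Int.gcd (m - n) q).divisors = q.divisors.filter fun k : ℕ ↦ (k : ℤ) ∣ m - n := by
    ext k
    simp [← Int.natCast_dvd_natCast, Int.dvd_coe_gcd_iff, Nat.ne_of_gt hq, and_comm]
  rw [hdiv, Finset.sum_filter]
  refine Finset.sum_congr rfl fun k _ ↦ ?_
  split_ifs <;> simp [mul_comm]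
end

section
/- Let q ≥ 1, let 𝔞 ∈ {0,1}, and let m, n be integers with gcd(mn, q) = 1. Then the sum of χ(m)·conj(χ(n)) over all primitive Dirichlet characters χ modulo q with χ(−1) = (−1)^𝔞 equals (1/2) Σ_{k | gcd(q, m−n)} φ(k)·μ(q/k) + ((−1)^𝔞/2) Σ_{k | gcd(q, m+n)} φ(k)·μ(q/k). -/
open scoped ArithmeticFunction.Moebius in
/-- The Möbius function of the codivisor, summed over the divisors of `q` that are multiples of
a divisor `c` of `q`, detects whether `c = q`. -/
theorem ArithmeticFunction.sum_moebius_div_of_dvd {R : Type*} [Ring R] {c q : ℕ} (hq : q ≠ 0)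
    (hc : c ∣ q) :
    ∑ k ∈ q.divisors with c ∣ k, ((μ (q / k) : ℤ) : R) = if c = q then 1 else 0 := by
  obtain ⟨e, rfl⟩ := hc
  obtain ⟨hc0, he0⟩ := mul_ne_zero_iff.mp hq
  have hcpos := Nat.pos_of_ne_zero hc0
  have hsum : ∑ k ∈ (c * e).divisors with c ∣ k, ((μ (c * e / k) : ℤ) : R) =
      ∑ d ∈ e.divisors, ((μ d : ℤ) : R) := by
    refine Finset.sum_bij' (fun k _ ↦ c * e / k) (fun d _ ↦ c * e / d) ?_ ?_ ?_ ?_ ?_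
    · intro k hk
      simp only [Finset.mem_filter, Nat.mem_divisors] at hk
      obtain ⟨⟨hkq, -⟩, j, rfl⟩ := hk
      rw [Nat.mem_divisors, Nat.mul_div_mul_left _ _ hcpos]
      exact ⟨Nat.div_dvd_of_dvd (Nat.dvd_of_mul_dvd_mul_left hcpos hkq), he0⟩
    · intro d hd
      obtain ⟨hd, -⟩ := Nat.mem_divisors.mp hd
      simp only [Finset.mem_filter, Nat.mem_divisors]
      refine ⟨⟨Nat.div_dvd_of_dvd (hd.mul_left _), hq⟩, ?_⟩
      rw [Nat.mul_div_assoc _ hd]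
      exact dvd_mul_right _ _
    · intro k hk
      simp only [Finset.mem_filter, Nat.mem_divisors] at hk
      exact Nat.div_div_self hk.1.1 hq
    · intro d hd
      exact Nat.div_div_self ((Nat.dvd_of_mem_divisors hd).mul_left _) hq
    · intros; rfl
  rw [hsum, ← Int.cast_sum, ← ArithmeticFunction.coe_mul_zeta_apply,
    ArithmeticFunction.moebius_mul_coe_zeta, ArithmeticFunction.one_apply]
  simp [eq_comm (a := c), mul_eq_left₀ hc0]

/-- Orthogonality relation for the Dirichlet characters whose conductor divides `k`. -/
theorem DirichletCharacter.sum_conductor_dvd_mul_conj {q k : ℕ} [NeZero q] (hk : k ∣ q) {m n : ℤ}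
    (hm : IsCoprime m q) (hn : IsCoprime n q) :
    ∑ χ : DirichletCharacter ℂ q with χ.conductor ∣ k,
      χ (m : ZMod q) * (starRingEnd ℂ) (χ (n : ZMod q)) =
      if (k : ℤ) ∣ m - n then (k.totient : ℂ) else 0 := by
  have : NeZero k := ⟨fun h ↦ NeZero.ne q (by simpa [h] using hk)⟩
  have hnk : IsCoprime n k := hn.of_isCoprime_of_dvd_right (by exact_mod_cast hk)
  have hu : IsUnit (n : ZMod k) := (ZMod.coe_int_isUnit_iff_isCoprime n k).mpr hnk.symm
  have hdvd : (k : ℤ) ∣ m - n ↔ (n : ZMod k) = m := by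
    rw [ZMod.intCast_eq_intCast_iff_dvd_sub]
  have himg : (Finset.univ.filter fun χ : DirichletCharacter ℂ q ↦ χ.conductor ∣ k) =
      Finset.univ.map ⟨changeLevel hk, changeLevel_injective hk⟩ := by
    ext χ
    simp only [Finset.mem_filter, Finset.mem_univ, true_and, Finset.mem_map,
      Function.Embedding.coeFn_mk]
    rw [← mem_conductorSet_iff_conductor_dvd χ hk, mem_conductorSet_iff]
    constructor
    · exact fun h ↦ ⟨h.χ₀, h.eq_changeLevel.symm⟩
    · rintro ⟨ψ, rfl⟩
      exact changeLevel_factorsThrough ψ hk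
  rw [himg, Finset.sum_map]
  simp only [hdvd, ← sum_char_inv_mul_char_eq ℂ hu, Function.Embedding.coeFn_mk,
    changeLevel_eq_cast_of_dvd' _ hk hm, changeLevel_eq_cast_of_dvd' _ hk hn]
  refine Finset.sum_congr rfl fun ψ _ ↦ ?_
  have hinv : ψ (n : ZMod k) * ψ (n : ZMod k)⁻¹ = 1 := by
    rw [← map_mul, ZMod.mul_inv_of_unit _ hu, map_one]
  rw [mul_comm, ← RCLike.star_def, MulChar.star_apply', MulChar.inv_apply_eq_inv',
    inv_eq_of_mul_eq_one_right hinv]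

/-- Orthogonality relation for the primitive Dirichlet characters modulo `q`. -/
theorem DirichletCharacter.sum_isPrimitive_mul_conj {q : ℕ} [NeZero q] {m n : ℤ}
    (hm : IsCoprime m q) (hn : IsCoprime n q)
    [DecidablePred (IsPrimitive : DirichletCharacter ℂ q → Prop)] :
    ∑ χ : DirichletCharacter ℂ q,
      (if χ.IsPrimitive then χ (m : ZMod q) * (starRingEnd ℂ) (χ (n : ZMod q)) else 0) =
      ∑ k ∈ (Int.gcd (m - n) (q : ℤ)).divisors,
        ((Nat.totient k : ℂ) * (ArithmeticFunction.moebius (q / k) : ℂ)) := by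
  have hq : q ≠ 0 := NeZero.ne q
  have hdiv : (Int.gcd (m - n) (q : ℤ)).divisors =
      q.divisors.filter fun k : ℕ ↦ (k : ℤ) ∣ m - n := by
    ext k
    simp only [Nat.mem_divisors, Finset.mem_filter, Int.dvd_gcd_iff, Int.natCast_dvd_natCast]
    have hgcd : Int.gcd (m - n) (q : ℤ) ≠ 0 := by simp [Int.gcd_eq_zero_iff, hq]
    tauto
  calc _ = ∑ χ : DirichletCharacter ℂ q, ∑ k ∈ q.divisors with χ.conductor ∣ k,
        (ArithmeticFunction.moebius (q / k) : ℂ) *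
          (χ (m : ZMod q) * (starRingEnd ℂ) (χ (n : ZMod q))) := by
        refine Finset.sum_congr rfl fun χ _ ↦ ?_
        rw [← Finset.sum_mul, ArithmeticFunction.sum_moebius_div_of_dvd hq χ.conductor_dvd_level,
          ite_mul, one_mul, zero_mul]
        simp only [isPrimitive_def]
    _ = ∑ k ∈ q.divisors, (ArithmeticFunction.moebius (q / k) : ℂ) *
        ∑ χ : DirichletCharacter ℂ q with χ.conductor ∣ k,
          χ (m : ZMod q) * (starRingEnd ℂ) (χ (n : ZMod q)) := by
        simp only [Finset.sum_filter, Finset.mul_sum, mul_ite, mul_zero]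
        exact Finset.sum_comm
    _ = _ := by
        rw [hdiv, Finset.sum_filter]
        refine Finset.sum_congr rfl fun k hk ↦ ?_
        rw [sum_conductor_dvd_mul_conj (Nat.dvd_of_mem_divisors hk) hm hn, mul_ite, mul_zero,
          mul_comm]

open scoped Classical in
/-- Lemma 3 (second part): for `q ≥ 1`, `𝔞 ∈ {0,1}` and integers `m, n` with
`gcd(mn, q) = 1`, the sum of `χ(m) conj(χ(n))` over primitive Dirichlet characters mod `q`
with `χ(−1) = (−1)^𝔞` equals
`(1/2) ∑_{k | gcd(q, m−n)} φ(k) μ(q/k) + ((−1)^𝔞/2) ∑_{k | gcd(q, m+n)} φ(k) μ(q/k)`. -/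
theorem fourth_moment_orthogonality_primitive_parity
    (q : ℕ) (hq : 1 ≤ q) (a : ℕ) (ha : a = 0 ∨ a = 1) (m n : ℤ)
    (hmn : Int.gcd (m * n) q = 1) :
    (∑ χ : DirichletCharacter ℂ q,
        if χ.IsPrimitive ∧ χ (-1) = (-1) ^ a then
          χ ((m : ZMod q)) * (starRingEnd ℂ) (χ ((n : ZMod q))) else 0) =
      (1 / 2) * ∑ k ∈ (Int.gcd (m - n) (q : ℤ)).divisors,
          ((Nat.totient k : ℂ) * (ArithmeticFunction.moebius (q / k) : ℂ)) +
      ((-1) ^ a / 2) * ∑ k ∈ (Int.gcd (m + n) (q : ℤ)).divisors,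
          ((Nat.totient k : ℂ) * (ArithmeticFunction.moebius (q / k) : ℂ)) := by
  have : NeZero q := ⟨by omega⟩
  have hcop : IsCoprime (m * n) (q : ℤ) := Int.isCoprime_iff_gcd_eq_one.mpr hmn
  have hm : IsCoprime m (q : ℤ) := hcop.of_mul_left_left
  have hn : IsCoprime n (q : ℤ) := hcop.of_mul_left_right
  have hgcd : Int.gcd (m + n) (q : ℤ) = Int.gcd (-m - n) (q : ℤ) := by
    rw [← Int.neg_gcd, neg_add']
  rw [hgcd, ← DirichletCharacter.sum_isPrimitive_mul_conj hm hn,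
    ← DirichletCharacter.sum_isPrimitive_mul_conj hm.neg_left hn, Finset.mul_sum, Finset.mul_sum,
    ← Finset.sum_add_distrib]
  refine Finset.sum_congr rfl fun χ _ ↦ ?_
  have hne : (1 : ℂ) ≠ -1 := by norm_num
  by_cases hχ : χ.IsPrimitive
  · rcases χ.even_or_odd with h | h
    · have h1 : χ (-1) = 1 := h
      rcases ha with rfl | rfl <;> simp [hχ, h1, h.eval_neg, hne] <;> ring
    · have h1 : χ (-1) = -1 := h
      rcases ha with rfl | rfl <;> simp [hχ, h1, h.eval_neg, hne.symm]
      ring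
  · simp [hχ]
end

section
/- Fix ε > 0. Let k be a positive integer and Z₁, Z₂ ≥ 2 with Z₁·Z₂ ≤ k^{19/10}. Then E := Σ 1/|log(ac/bd)|, where the sum runs over positive integers a, b, c, d with Z₁ ≤ ab < 2Z₁, Z₂ ≤ cd < 2Z₂, ac ≡ ±bd (mod k), ac ≠ bd, and gcd(abcd, k) = 1, satisfies E ≪_ε (Z₁Z₂)^{1+ε}/k. -/
open scoped Classical in
/-- The sum `E = ∑ 1/|log(ac/bd)|` over positive integers `a, b, c, d` with
`Z₁ ≤ ab < 2Z₁`, `Z₂ ≤ cd < 2Z₂`, `ac ≡ ±bd (mod k)`, `ac ≠ bd` and `gcd(abcd, k) = 1`. -/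
noncomputable def E (k : ℕ) (Z₁ Z₂ : ℝ) : ℝ :=
  ∑' p : ℕ+ × ℕ+ × ℕ+ × ℕ+,
    let a : ℕ := p.1; let b : ℕ := p.2.1; let c : ℕ := p.2.2.1; let d : ℕ := p.2.2.2
    if Z₁ ≤ ((a * b : ℕ) : ℝ) ∧ ((a * b : ℕ) : ℝ) < 2 * Z₁ ∧
        Z₂ ≤ ((c * d : ℕ) : ℝ) ∧ ((c * d : ℕ) : ℝ) < 2 * Z₂ ∧
        ((k : ℤ) ∣ ((a * c : ℕ) : ℤ) - ((b * d : ℕ) : ℤ) ∨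
          (k : ℤ) ∣ ((a * c : ℕ) : ℤ) + ((b * d : ℕ) : ℤ)) ∧
        a * c ≠ b * d ∧ Nat.gcd (a * b * c * d) k = 1
    then 1 / |Real.log (((a * c : ℕ) : ℝ) / ((b * d : ℕ) : ℝ))| else 0

/-- The divisor bound: `τ(n) ≪_ε n^ε`. -/
theorem exists_card_divisors_le_rpow {ε : ℝ} (hε : 0 < ε) :
    ∃ C : ℝ, 1 ≤ C ∧ ∀ n : ℕ, 0 < n → (n.divisors.card : ℝ) ≤ C * (n : ℝ) ^ ε := by
  obtain ⟨B, hB⟩ := exists_nat_ge ((2 : ℝ) ^ (1 / ε))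
  have hlog : 0 < ε * Real.log 2 := mul_pos hε (Real.log_pos (by norm_num))
  set c : ℝ := max 1 (1 / (ε * Real.log 2)) with hc
  have hc1 : 1 ≤ c := le_max_left _ _
  have hc2 : 1 ≤ c * (ε * Real.log 2) := by
    have : 1 / (ε * Real.log 2) ≤ c := le_max_right _ _
    rwa [div_le_iff₀ hlog] at this
  refine ⟨c ^ B, one_le_pow₀ hc1, fun n hn => ?_⟩
  have factor_le : ∀ p ∈ n.primeFactors, ((n.factorization p : ℝ) + 1) ≤
      (if p < B then c else 1) * ((p : ℝ) ^ n.factorization p) ^ ε := by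
    intro p hp
    have hp2 : (2 : ℝ) ≤ p := by exact_mod_cast (Nat.prime_of_mem_primeFactors hp).two_le
    set v := n.factorization p
    have hcomm : ((p : ℝ) ^ v) ^ ε = ((p : ℝ) ^ ε) ^ v := by
      rw [← Real.rpow_natCast, ← Real.rpow_mul (by positivity), mul_comm,
        Real.rpow_mul (by positivity), Real.rpow_natCast]
    split_ifs with h
    · have h1 : 1 + ε * Real.log 2 * v ≤ ((p : ℝ) ^ v) ^ ε := by
        calc 1 + ε * Real.log 2 * v ≤ Real.exp (ε * Real.log 2 * v) := by
              linarith [Real.add_one_le_exp (ε * Real.log 2 * v)]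
          _ = ((2 : ℝ) ^ ε) ^ v := by
              rw [Real.rpow_def_of_pos (by norm_num), ← Real.exp_nat_mul]
              ring_nf
          _ ≤ ((p : ℝ) ^ ε) ^ v := by gcongr
          _ = _ := hcomm.symm
      have hv : (0 : ℝ) ≤ v := by positivity
      calc (v : ℝ) + 1 ≤ c * (1 + ε * Real.log 2 * v) := by nlinarith
        _ ≤ _ := by gcongr
    · have hpB : (2 : ℝ) ^ (1 / ε) ≤ p := hB.trans (by exact_mod_cast not_lt.mp h)
      have h2 : (2 : ℝ) ≤ (p : ℝ) ^ ε := by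
        calc (2 : ℝ) = ((2 : ℝ) ^ (1 / ε)) ^ ε := by
              rw [← Real.rpow_mul (by norm_num), one_div_mul_cancel hε.ne', Real.rpow_one]
          _ ≤ _ := by gcongr
      rw [one_mul, hcomm]
      calc (v : ℝ) + 1 ≤ 2 ^ v := by exact_mod_cast Nat.lt_two_pow_self
        _ ≤ _ := by gcongr
  rw [Nat.card_divisors hn.ne']
  push_cast
  calc ∏ p ∈ n.primeFactors, ((n.factorization p : ℝ) + 1)
      ≤ ∏ p ∈ n.primeFactors, (if p < B then c else 1) * ((p : ℝ) ^ n.factorization p) ^ ε :=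
        Finset.prod_le_prod (fun _ _ => by positivity) factor_le
    _ = (∏ p ∈ n.primeFactors, if p < B then c else 1) *
          (∏ p ∈ n.primeFactors, (p : ℝ) ^ n.factorization p) ^ ε := by
        rw [Finset.prod_mul_distrib, Real.finsetProd_rpow _ _ (fun _ _ => by positivity)]
    _ ≤ c ^ B * (n : ℝ) ^ ε := by
        have hprod : ∏ p ∈ n.primeFactors, (p : ℝ) ^ n.factorization p = n := by
          exact_mod_cast Nat.prod_factorization_pow_eq_self hn.ne'
        rw [hprod]
        gcongr
        rw [← Finset.prod_filter, Finset.prod_const]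
        refine pow_le_pow_right₀ hc1 ?_
        calc _ ≤ (Finset.range B).card := Finset.card_le_card fun p hp => by
              simpa using (Finset.mem_filter.mp hp).2
          _ = B := Finset.card_range B

/-- For `0 < y < x`, `1 / log (x / y) ≤ 1 + y / (x - y)`. -/
theorem one_div_abs_log_div_le {x y : ℝ} (hy : 0 < y) (hxy : y < x) :
    1 / |Real.log (x / y)| ≤ 1 + y / (x - y) := by
  have hx : 0 < x := hy.trans hxy
  have hsub : 0 < x - y := sub_pos.mpr hxy
  have h1 : (x - y) / x ≤ Real.log (x / y) := by
    have := Real.one_sub_inv_le_log_of_pos (div_pos hx hy)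
    rwa [inv_div, one_sub_div hx.ne'] at this
  have h2 : 0 < (x - y) / x := by positivity
  rw [abs_of_pos (h2.trans_le h1)]
  calc 1 / Real.log (x / y) ≤ 1 / ((x - y) / x) := by gcongr
    _ = 1 + y / (x - y) := by field_simp; ring

theorem abs_log_div_comm (x y : ℝ) : |Real.log (x / y)| = |Real.log (y / x)| := by
  rw [← inv_div, Real.log_inv, abs_neg]

/-- If `φ` maps `S` injectively into the square of `[1, L]` then the sum of `1 / (l m)` over the
image is at most the square of the harmonic sum. -/
theorem sum_inv_mul_inv_le_harmonic_sq {ι : Type*} {S : Finset ι} {L : ℕ} (φ : ι → ℕ × ℕ)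
    (hφ : Set.InjOn φ S) (hmaps : ∀ p ∈ S, φ p ∈ Finset.Icc 1 L ×ˢ Finset.Icc 1 L) :
    ∑ p ∈ S, ((φ p).1 : ℝ)⁻¹ * ((φ p).2 : ℝ)⁻¹ ≤ (harmonic L : ℝ) ^ 2 := by
  classical
  have hH : (harmonic L : ℝ) = ∑ i ∈ Finset.Icc 1 L, (i : ℝ)⁻¹ := by
    rw [harmonic_eq_sum_Icc]; push_cast; rfl
  rw [hH, sq, Finset.sum_mul_sum, ← Finset.sum_product',
    ← Finset.sum_image (f := fun q : ℕ × ℕ => (q.1 : ℝ)⁻¹ * (q.2 : ℝ)⁻¹) hφ]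
  exact Finset.sum_le_sum_of_subset_of_nonneg (Finset.image_subset_iff.mpr hmaps)
    fun _ _ _ => by positivity

/-- The sum of `1 / log (x / y)` over pairs with `x > y`, `xy ≤ M` and `k ∣ x - y`. -/
theorem sum_one_div_log_le_of_dvd_sub {k M : ℕ} (hk : 0 < k) (S : Finset (ℕ × ℕ))
    (hS : ∀ p ∈ S, 0 < p.2 ∧ p.2 < p.1 ∧ p.1 * p.2 ≤ M ∧ k ∣ p.1 - p.2) :
    ∑ p ∈ S, 1 / |Real.log ((p.1 : ℝ) / p.2)| ≤ 2 * M / k * (harmonic (2 * M) : ℝ) ^ 2 := by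
  let φ : ℕ × ℕ → ℕ × ℕ := fun p => ((p.1 - p.2) / k, p.2)
  have key : ∀ x y : ℕ, (x, y) ∈ S → ∃ l, 0 < l ∧ x = y + k * l ∧ (x - y) / k = l := by
    intro x y hp
    obtain ⟨-, hlt, -, l, hl⟩ := hS _ hp
    refine ⟨l, Nat.pos_of_ne_zero ?_, ?_, ?_⟩
    · rintro rfl; simp only [mul_zero] at hl; omega
    · simp only at hl hlt; omega
    · simp only at hl; rw [hl, Nat.mul_div_cancel_left _ hk]
  calc ∑ p ∈ S, 1 / |Real.log ((p.1 : ℝ) / p.2)|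
      ≤ ∑ p ∈ S, 2 * M / k * (((φ p).1 : ℝ)⁻¹ * ((φ p).2 : ℝ)⁻¹) := by
        refine Finset.sum_le_sum fun ⟨x, y⟩ hp => ?_
        obtain ⟨hy, hlt, hM, -⟩ := hS _ hp
        obtain ⟨l, hl, hx, hdiv⟩ := key x y hp
        simp only [φ, hdiv] at *
        refine (one_div_abs_log_div_le (by exact_mod_cast hy) (by exact_mod_cast hlt)).trans ?_
        have hM' : (x : ℝ) * y ≤ M := by exact_mod_cast hM
        have hx' : (x : ℝ) = y + k * l := by exact_mod_cast hx
        have hy' : (0 : ℝ) < y := by exact_mod_cast hy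
        have hl' : (0 : ℝ) < l := by exact_mod_cast hl
        have hk' : (0 : ℝ) < k := by exact_mod_cast hk
        rw [hx'] at hM' ⊢
        have hkl : 0 < (k : ℝ) * l := by positivity
        have e1 : (1 : ℝ) + y / (y + k * l - y) = (k * l * y + y * y) / (k * l * y) := by
          field_simp; ring
        have e2 : 2 * (M : ℝ) / k * ((l : ℝ)⁻¹ * (y : ℝ)⁻¹) = 2 * M / (k * l * y) := by
          field_simp
        rw [e1, e2]
        gcongr
        nlinarith
    _ = 2 * M / k * ∑ p ∈ S, (((φ p).1 : ℝ)⁻¹ * ((φ p).2 : ℝ)⁻¹) := by rw [Finset.mul_sum]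
    _ ≤ _ := by
        gcongr
        refine sum_inv_mul_inv_le_harmonic_sq φ ?_ ?_
        · rintro ⟨x, y⟩ hp ⟨x', y'⟩ hp' h
          obtain ⟨l, -, hx, hdiv⟩ := key x y hp
          obtain ⟨l', -, hx', hdiv'⟩ := key x' y' hp'
          simp only [φ, hdiv, hdiv', Prod.mk.injEq] at h
          obtain ⟨rfl, rfl⟩ := h
          rw [hx, hx']
        · rintro ⟨x, y⟩ hp
          obtain ⟨hy, hlt, hM, -⟩ := hS _ hp
          obtain ⟨l, hl, hx, hdiv⟩ := key x y hp
          simp only [φ, hdiv, Finset.mem_product, Finset.mem_Icc] at *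
          have : l ≤ k * l := Nat.le_mul_of_pos_left l hk
          have : x ≤ x * y := Nat.le_mul_of_pos_right x hy
          omega

/-- The sum of `1 / log (x / y)` over pairs with `x > y`, `xy ≤ M` and `k ∣ x + y`. -/
theorem sum_one_div_log_le_of_dvd_add {k M : ℕ} (hk : 0 < k) (S : Finset (ℕ × ℕ))
    (hS : ∀ p ∈ S, 0 < p.2 ∧ p.2 < p.1 ∧ p.1 * p.2 ≤ M ∧ k ∣ p.1 + p.2) :
    ∑ p ∈ S, 1 / |Real.log ((p.1 : ℝ) / p.2)| ≤ 4 * M / k * (harmonic (2 * M) : ℝ) ^ 2 := by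
  let φ : ℕ × ℕ → ℕ × ℕ := fun p => ((p.1 + p.2) / k, p.2)
  let ψ : ℕ × ℕ → ℕ × ℕ := fun p => ((p.1 + p.2) / k, p.1 - p.2)
  have key : ∀ x y : ℕ, (x, y) ∈ S → ∃ l, 0 < l ∧ x + y = k * l ∧ (x + y) / k = l := by
    intro x y hp
    obtain ⟨-, hlt, -, l, hl⟩ := hS _ hp
    refine ⟨l, Nat.pos_of_ne_zero ?_, hl, ?_⟩
    · rintro rfl; simp only [mul_zero] at hl; simp only at hlt; omega
    · simp only at hl; rw [hl, Nat.mul_div_cancel_left _ hk]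
  calc ∑ p ∈ S, 1 / |Real.log ((p.1 : ℝ) / p.2)|
      ≤ ∑ p ∈ S, (2 * M / k * (((φ p).1 : ℝ)⁻¹ * ((φ p).2 : ℝ)⁻¹) +
          2 * M / k * (((ψ p).1 : ℝ)⁻¹ * ((ψ p).2 : ℝ)⁻¹)) := by
        refine Finset.sum_le_sum fun ⟨x, y⟩ hp => ?_
        obtain ⟨hy, hlt, hM, -⟩ := hS _ hp
        obtain ⟨l, hl, hx, hdiv⟩ := key x y hp
        simp only [φ, ψ, hdiv] at *
        refine (one_div_abs_log_div_le (by exact_mod_cast hy) (by exact_mod_cast hlt)).trans ?_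
        have hM' : (x : ℝ) * y ≤ M := by exact_mod_cast hM
        have hx' : (x : ℝ) + y = k * l := by exact_mod_cast hx
        have hy' : (0 : ℝ) < y := by exact_mod_cast hy
        have hl' : (0 : ℝ) < l := by exact_mod_cast hl
        have hk' : (0 : ℝ) < k := by exact_mod_cast hk
        have hxy : (y : ℝ) < x := by exact_mod_cast hlt
        have hh : (0 : ℝ) < x - y := sub_pos.mpr hxy
        rw [Nat.cast_sub hlt.le]
        have hkly : (k : ℝ) * l * y ≤ 2 * M := by rw [← hx']; nlinarith
        have e1 : 2 * (M : ℝ) / k * ((l : ℝ)⁻¹ * (y : ℝ)⁻¹) = 2 * M / (k * l * y) := by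
          field_simp
        have e2 : 2 * (M : ℝ) / k * ((l : ℝ)⁻¹ * ((x : ℝ) - y)⁻¹) =
            2 * M / (k * l) / (x - y) := by
          field_simp
        rw [e1, e2]
        gcongr
        · rwa [one_le_div (by positivity)]
        · rw [le_div_iff₀ (by positivity)]
          linarith
    _ = 2 * M / k * ∑ p ∈ S, (((φ p).1 : ℝ)⁻¹ * ((φ p).2 : ℝ)⁻¹) +
          2 * M / k * ∑ p ∈ S, (((ψ p).1 : ℝ)⁻¹ * ((ψ p).2 : ℝ)⁻¹) := by
        rw [Finset.mul_sum, Finset.mul_sum, Finset.sum_add_distrib]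
    _ ≤ 2 * M / k * (harmonic (2 * M) : ℝ) ^ 2 + 2 * M / k * (harmonic (2 * M) : ℝ) ^ 2 := by
        gcongr
        · refine sum_inv_mul_inv_le_harmonic_sq φ ?_ ?_
          · rintro ⟨x, y⟩ hp ⟨x', y'⟩ hp' h
            obtain ⟨l, -, hx, hdiv⟩ := key x y hp
            obtain ⟨l', -, hx', hdiv'⟩ := key x' y' hp'
            simp only [φ, hdiv, hdiv', Prod.mk.injEq] at h
            obtain ⟨rfl, rfl⟩ := h
            simp only [Prod.mk.injEq, and_true]
            omega
          · rintro ⟨x, y⟩ hp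
            obtain ⟨hy, hlt, hM, -⟩ := hS _ hp
            obtain ⟨l, hl, hx, hdiv⟩ := key x y hp
            simp only [φ, hdiv, Finset.mem_product, Finset.mem_Icc] at *
            have : l ≤ k * l := Nat.le_mul_of_pos_left l hk
            have : x ≤ x * y := Nat.le_mul_of_pos_right x hy
            omega
        · refine sum_inv_mul_inv_le_harmonic_sq ψ ?_ ?_
          · rintro ⟨x, y⟩ hp ⟨x', y'⟩ hp' h
            obtain ⟨-, hlt, -⟩ := hS _ hp
            obtain ⟨-, hlt', -⟩ := hS _ hp'
            obtain ⟨l, -, hx, hdiv⟩ := key x y hp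
            obtain ⟨l', -, hx', hdiv'⟩ := key x' y' hp'
            simp only [ψ, hdiv, hdiv', Prod.mk.injEq] at h hlt hlt' ⊢
            obtain ⟨rfl, h⟩ := h
            omega
          · rintro ⟨x, y⟩ hp
            obtain ⟨hy, hlt, hM, -⟩ := hS _ hp
            obtain ⟨l, hl, hx, hdiv⟩ := key x y hp
            simp only [ψ, hdiv, Finset.mem_product, Finset.mem_Icc] at *
            have : l ≤ k * l := Nat.le_mul_of_pos_left l hk
            have : x ≤ x * y := Nat.le_mul_of_pos_right x hy
            omega
    _ = _ := by ring

/-- The sum of `1 / log (x / y)` over pairs with `x > y`, `xy ≤ M` and `x ≡ ±y (mod k)`. -/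
theorem sum_one_div_log_le_of_lt {k M : ℕ} (hk : 0 < k) (S : Finset (ℕ × ℕ))
    (hS : ∀ p ∈ S, 0 < p.2 ∧ p.2 < p.1 ∧ p.1 * p.2 ≤ M ∧
      ((k : ℤ) ∣ (p.1 : ℤ) - p.2 ∨ (k : ℤ) ∣ (p.1 : ℤ) + p.2)) :
    ∑ p ∈ S, 1 / |Real.log ((p.1 : ℝ) / p.2)| ≤ 6 * M / k * (harmonic (2 * M) : ℝ) ^ 2 := by
  rw [← Finset.sum_filter_add_sum_filter_not S (fun p => k ∣ p.1 - p.2)]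
  have h1 := sum_one_div_log_le_of_dvd_sub (M := M) hk (S.filter fun p => k ∣ p.1 - p.2) (by
    intro p hp
    rw [Finset.mem_filter] at hp
    exact ⟨(hS p hp.1).1, (hS p hp.1).2.1, (hS p hp.1).2.2.1, hp.2⟩)
  have h2 := sum_one_div_log_le_of_dvd_add (M := M) hk (S.filter fun p => ¬ k ∣ p.1 - p.2) (by
    intro p hp
    rw [Finset.mem_filter] at hp
    obtain ⟨hy, hlt, hM, hd⟩ := hS p hp.1
    refine ⟨hy, hlt, hM, ?_⟩
    rw [← Nat.cast_sub hlt.le] at hd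
    exact_mod_cast hd.resolve_left (by exact_mod_cast hp.2))
  calc _ ≤ _ := add_le_add h1 h2
    _ = _ := by ring

/-- The sum of `1 / |log (x / y)|` over pairs with `x ≠ y`, `xy ≤ M` and `x ≡ ±y (mod k)`. -/
theorem sum_one_div_abs_log_le {k M : ℕ} (hk : 0 < k) (S : Finset (ℕ × ℕ))
    (hS : ∀ p ∈ S, 0 < p.1 ∧ 0 < p.2 ∧ p.1 ≠ p.2 ∧ p.1 * p.2 ≤ M ∧
      ((k : ℤ) ∣ (p.1 : ℤ) - p.2 ∨ (k : ℤ) ∣ (p.1 : ℤ) + p.2)) :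
    ∑ p ∈ S, 1 / |Real.log ((p.1 : ℝ) / p.2)| ≤ 12 * M / k * (harmonic (2 * M) : ℝ) ^ 2 := by
  rw [← Finset.sum_filter_add_sum_filter_not S (fun p => p.2 < p.1)]
  have h1 := sum_one_div_log_le_of_lt (M := M) hk (S.filter fun p => p.2 < p.1) (by
    intro p hp
    rw [Finset.mem_filter] at hp
    obtain ⟨-, hy, -, hM, hd⟩ := hS p hp.1
    exact ⟨hy, hp.2, hM, hd⟩)
  have h2 := sum_one_div_log_le_of_lt (M := M) hk
    ((S.filter fun p => ¬ p.2 < p.1).image Prod.swap) (by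
    intro p hp
    obtain ⟨q, hq, rfl⟩ := Finset.mem_image.mp hp
    rw [Finset.mem_filter] at hq
    obtain ⟨hx, hy, hne, hM, hd⟩ := hS q hq.1
    refine ⟨hx, lt_of_le_of_ne (not_lt.mp hq.2) hne, by rwa [mul_comm], ?_⟩
    exact hd.imp (fun h => by simpa using (dvd_neg.mpr h)) fun h => by rwa [add_comm])
  rw [Finset.sum_image Prod.swap_injective.injOn] at h2
  simp only [Prod.fst_swap, Prod.snd_swap] at h2
  calc _ ≤ _ := add_le_add h1 ((Finset.sum_congr rfl fun p _ => by
        rw [abs_log_div_comm]).trans_le h2)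
    _ = _ := by ring

open Finset in
/-- At most `τ(x) τ(y)` quadruples `(a, b, c, d)` satisfy `ac = x` and `bd = y`. -/
theorem card_filter_mul_eq_le (s : Finset (ℕ+ × ℕ+ × ℕ+ × ℕ+)) {x y : ℕ} (hx : x ≠ 0)
    (hy : y ≠ 0) :
    #{p ∈ s | ((p.1 * p.2.2.1 : ℕ), (p.2.1 * p.2.2.2 : ℕ)) = (x, y)} ≤
      #x.divisors * #y.divisors := by
  rw [← card_product]
  refine card_le_card_of_injOn (fun p => ((p.1 : ℕ), (p.2.1 : ℕ))) ?_ ?_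
  · rintro ⟨a, b, c, d⟩ hp
    simp only [coe_filter, Set.mem_ofPred_eq, Prod.mk.injEq] at hp
    simp only [coe_product, Set.mem_prod, mem_coe, Nat.mem_divisors]
    exact ⟨⟨⟨_, hp.2.1.symm⟩, hx⟩, ⟨_, hp.2.2.symm⟩, hy⟩
  · rintro ⟨a, b, c, d⟩ hp ⟨a', b', c', d'⟩ hp' h
    simp only [coe_filter, Set.mem_ofPred_eq, Prod.mk.injEq, PNat.coe_inj] at hp hp' h ⊢
    obtain ⟨rfl, rfl⟩ := h
    refine ⟨rfl, rfl, ?_, ?_⟩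
    · exact PNat.coe_inj.mp (Nat.eq_of_mul_eq_mul_left a.pos (hp.2.1.trans hp'.2.1.symm))
    · exact PNat.coe_inj.mp (Nat.eq_of_mul_eq_mul_left b.pos (hp.2.2.trans hp'.2.2.symm))

open Finset in
/-- The sum of `1 / |log (ac / bd)|` over quadruples with `ac ≠ bd`, `abcd ≤ M` and
`ac ≡ ±bd (mod k)`, given a bound `T` for the number of representations. -/
theorem sum_quadruples_le {k M : ℕ} (hk : 0 < k) {T : ℝ} (hT : 0 ≤ T)
    (hdiv : ∀ x y : ℕ, 0 < x → 0 < y → x * y ≤ M → (#x.divisors * #y.divisors : ℝ) ≤ T)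
    (s : Finset (ℕ+ × ℕ+ × ℕ+ × ℕ+))
    (hs : ∀ p ∈ s, ((p.1 * p.2.2.1 : ℕ) ≠ (p.2.1 * p.2.2.2 : ℕ)) ∧
      (p.1 * p.2.2.1 : ℕ) * (p.2.1 * p.2.2.2 : ℕ) ≤ M ∧
      ((k : ℤ) ∣ ((p.1 * p.2.2.1 : ℕ) : ℤ) - (p.2.1 * p.2.2.2 : ℕ) ∨
        (k : ℤ) ∣ ((p.1 * p.2.2.1 : ℕ) : ℤ) + (p.2.1 * p.2.2.2 : ℕ))) :
    ∑ p ∈ s, 1 / |Real.log (((p.1 * p.2.2.1 : ℕ) : ℝ) / (p.2.1 * p.2.2.2 : ℕ))| ≤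
      T * (12 * M / k * (harmonic (2 * M) : ℝ) ^ 2) := by
  let π : ℕ+ × ℕ+ × ℕ+ × ℕ+ → ℕ × ℕ := fun p => ((p.1 * p.2.2.1 : ℕ), (p.2.1 * p.2.2.2 : ℕ))
  have himage : ∀ q ∈ s.image π, 0 < q.1 ∧ 0 < q.2 ∧ q.1 ≠ q.2 ∧ q.1 * q.2 ≤ M ∧
      ((k : ℤ) ∣ (q.1 : ℤ) - q.2 ∨ (k : ℤ) ∣ (q.1 : ℤ) + q.2) := by
    intro q hq
    obtain ⟨p, hp, rfl⟩ := mem_image.mp hq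
    exact ⟨Nat.mul_pos p.1.pos p.2.2.1.pos, Nat.mul_pos p.2.1.pos p.2.2.2.pos, hs p hp⟩
  calc _ = ∑ q ∈ s.image π, #{p ∈ s | π p = q} • (1 / |Real.log ((q.1 : ℝ) / q.2)|) :=
        Finset.sum_comp (fun q : ℕ × ℕ => 1 / |Real.log ((q.1 : ℝ) / q.2)|) π
    _ ≤ ∑ q ∈ s.image π, T * (1 / |Real.log ((q.1 : ℝ) / q.2)|) := by
        refine sum_le_sum fun q hq => ?_
        obtain ⟨hx, hy, -, hM, -⟩ := himage q hq
        rw [nsmul_eq_mul]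
        gcongr
        refine le_trans ?_ (hdiv q.1 q.2 hx hy hM)
        exact_mod_cast card_filter_mul_eq_le s hx.ne' hy.ne'
    _ = T * ∑ q ∈ s.image π, 1 / |Real.log ((q.1 : ℝ) / q.2)| := by rw [mul_sum]
    _ ≤ _ := by
        gcongr
        exact sum_one_div_abs_log_le hk _ himage

theorem E_le_of_divisor_bound {k : ℕ} (hk : 0 < k) {Z₁ Z₂ : ℝ} (h₁ : 0 ≤ Z₁)
    {T : ℝ} (hT : 0 ≤ T)
    (hdiv : ∀ x y : ℕ, 0 < x → 0 < y → x * y ≤ ⌊4 * (Z₁ * Z₂)⌋₊ →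
      (x.divisors.card * y.divisors.card : ℝ) ≤ T) :
    E k Z₁ Z₂ ≤ T * (12 * ⌊4 * (Z₁ * Z₂)⌋₊ / k *
      (harmonic (2 * ⌊4 * (Z₁ * Z₂)⌋₊) : ℝ) ^ 2) := by
  classical
  unfold E
  refine Real.tsum_le_of_sum_le (fun p => ?_) fun u => ?_
  · dsimp only [Pi.zero_apply]
    split_ifs <;> positivity
  · dsimp only
    rw [← Finset.sum_filter]
    refine sum_quadruples_le hk hT hdiv _ fun p hp => ?_
    obtain ⟨-, -, hab, -, hcd, hmod, hne, -⟩ := Finset.mem_filter.mp hp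
    refine ⟨hne, Nat.le_floor ?_, hmod⟩
    push_cast at hab hcd ⊢
    calc (p.1 : ℝ) * p.2.2.1 * (p.2.1 * p.2.2.2) = p.1 * p.2.1 * (p.2.2.1 * p.2.2.2) := by ring
      _ ≤ 2 * Z₁ * (2 * Z₂) := by gcongr
      _ = 4 * (Z₁ * Z₂) := by ring

/-- Lemma 4 (first part): for fixed `ε > 0`, if `k ≥ 1`, `Z₁, Z₂ ≥ 2` and
`Z₁Z₂ ≤ k^{19/10}`, then `E ≪_ε (Z₁Z₂)^{1+ε}/k`. -/
theorem fourth_moment_offdiagonal_small :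
    ∀ ε : ℝ, 0 < ε → ∃ C : ℝ, 0 < C ∧ ∀ (k : ℕ), 0 < k → ∀ (Z₁ Z₂ : ℝ), 2 ≤ Z₁ → 2 ≤ Z₂ →
      Z₁ * Z₂ ≤ (k : ℝ) ^ ((19 : ℝ) / 10) →
      E k Z₁ Z₂ ≤ C * (Z₁ * Z₂) ^ (1 + ε) / k := by
  intro ε hε
  obtain ⟨D, hD1, hD⟩ := exists_card_divisors_le_rpow (half_pos hε)
  refine ⟨D ^ 2 * 48 * (1 + 4 / ε) ^ 2 * 8 ^ ε, by positivity, ?_⟩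
  intro k hk Z₁ Z₂ h₁ h₂ _
  set N : ℝ := Z₁ * Z₂ with hN
  have hN4 : 4 ≤ N := by nlinarith
  have hN0 : 0 < N := by linarith
  have hfloor : (⌊4 * N⌋₊ : ℝ) ≤ 4 * N := Nat.floor_le (by positivity)
  have hharm : (harmonic (2 * ⌊4 * N⌋₊) : ℝ) ≤ (1 + 4 / ε) * (8 * N) ^ (ε / 4) := by
    have hpow : 1 ≤ (8 * N) ^ (ε / 4) := Real.one_le_rpow (by linarith) (by positivity)
    have hpos : 0 < ⌊4 * N⌋₊ := Nat.floor_pos.mpr (by linarith)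
    calc (harmonic (2 * ⌊4 * N⌋₊) : ℝ) ≤ 1 + Real.log ((2 * ⌊4 * N⌋₊ : ℕ) : ℝ) :=
          harmonic_le_one_add_log _
      _ ≤ 1 + Real.log (8 * N) := by
          gcongr
          push_cast
          linarith
      _ ≤ 1 + (8 * N) ^ (ε / 4) / (ε / 4) := by
          gcongr
          exact Real.log_le_rpow_div (by positivity) (by positivity)
      _ ≤ (8 * N) ^ (ε / 4) + (8 * N) ^ (ε / 4) / (ε / 4) := by gcongr
      _ = _ := by field_simp
  have hharm0 : (0 : ℝ) ≤ (harmonic (2 * ⌊4 * N⌋₊) : ℝ) := by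
    rw [harmonic]
    positivity
  refine (E_le_of_divisor_bound hk (by linarith)
    (T := D ^ 2 * (8 * N) ^ (ε / 2)) (by positivity) ?_).trans ?_
  · intro x y hx hy hxy
    have hxy' : (x : ℝ) * y ≤ 8 * N := by
      have : ((x * y : ℕ) : ℝ) ≤ ⌊4 * N⌋₊ := by exact_mod_cast hxy
      push_cast at this
      linarith
    calc (x.divisors.card * y.divisors.card : ℝ)
        ≤ D * (x : ℝ) ^ (ε / 2) * (D * (y : ℝ) ^ (ε / 2)) := by
          gcongr
          exacts [hD x hx, hD y hy]
      _ = D ^ 2 * ((x : ℝ) * y) ^ (ε / 2) := by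
          rw [Real.mul_rpow (by positivity) (by positivity)]
          ring
      _ ≤ _ := by gcongr
  · calc D ^ 2 * (8 * N) ^ (ε / 2) *
          (12 * ⌊4 * N⌋₊ / k * (harmonic (2 * ⌊4 * N⌋₊) : ℝ) ^ 2)
        ≤ D ^ 2 * (8 * N) ^ (ε / 2) *
          (12 * (4 * N) / k * ((1 + 4 / ε) * (8 * N) ^ (ε / 4)) ^ 2) := by gcongr
      _ = D ^ 2 * 48 * (1 + 4 / ε) ^ 2 *
            (N * ((8 * N) ^ (ε / 2) * ((8 * N) ^ (ε / 4)) ^ 2)) / k := by ring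
      _ = _ := by
          have e : (8 * N) ^ (ε / 2) * ((8 * N) ^ (ε / 4)) ^ 2 = 8 ^ ε * N ^ ε := by
            rw [← Real.rpow_natCast, ← Real.rpow_mul (by positivity),
              ← Real.rpow_add (by positivity), ← Real.mul_rpow (by norm_num) hN0.le]
            congr 1
            push_cast
            ring
          rw [e, Real.rpow_add hN0, Real.rpow_one]
          ring
end

section
/- Let k be a positive integer and Z₁, Z₂ ≥ 2. Then the sum Σ 1/|log(ac/bd)|, taken over positive integers a, b, c, d with Z₁ ≤ ab < 2Z₁, Z₂ ≤ cd < 2Z₂, bd < ac ≤ 2bd, ac ≡ bd (mod k), ac ≠ bd, and gcd(abcd, k) = 1, is ≪ (Z₁Z₂/k)·(log Z₁Z₂)³, with an absolute implied constant. -/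
open scoped Classical in
/-- The sum `∑ 1/|log(ac/bd)|` over positive integers `a, b, c, d` with
`Z₁ ≤ ab < 2Z₁`, `Z₂ ≤ cd < 2Z₂`, `bd < ac ≤ 2bd`, `ac ≡ bd (mod k)`, `ac ≠ bd` and
`gcd(abcd, k) = 1`. -/
noncomputable def Enear (k : ℕ) (Z₁ Z₂ : ℝ) : ℝ :=
  ∑' p : ℕ+ × ℕ+ × ℕ+ × ℕ+,
    let a : ℕ := p.1; let b : ℕ := p.2.1; let c : ℕ := p.2.2.1; let d : ℕ := p.2.2.2
    if Z₁ ≤ ((a * b : ℕ) : ℝ) ∧ ((a * b : ℕ) : ℝ) < 2 * Z₁ ∧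
        Z₂ ≤ ((c * d : ℕ) : ℝ) ∧ ((c * d : ℕ) : ℝ) < 2 * Z₂ ∧
        b * d < a * c ∧ a * c ≤ 2 * (b * d) ∧
        (k : ℤ) ∣ ((a * c : ℕ) : ℤ) - ((b * d : ℕ) : ℤ) ∧
        a * c ≠ b * d ∧ Nat.gcd (a * b * c * d) k = 1
    then 1 / |Real.log (((a * c : ℕ) : ℝ) / ((b * d : ℕ) : ℝ))| else 0

/-- The integers up to `N` satisfying two divisibility conditions lie in one residue class
modulo the least common multiple. -/
lemma card_filter_dvd_dvd_add_le {N x y : ℕ} (h : ℕ) (hx : 0 < x) (hy : 0 < y)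
    (hxy : x * y ≤ 2 * N) :
    (((Finset.Icc 1 N).filter (fun n => x ∣ n ∧ y ∣ n + h)).card : ℝ) ≤
      3 * N * ((Nat.gcd x y : ℝ) / (x * y)) := by
  set M := Nat.lcm x y with hM
  have hMpos : 0 < M := Nat.lcm_pos hx hy
  have hcard : ((Finset.Icc 1 N).filter (fun n => x ∣ n ∧ y ∣ n + h)).card ≤ N / M + 1 := by
    rw [← Finset.card_range (N / M + 1)]
    refine Finset.card_le_card_of_injOn (fun n => n / M) ?_ ?_
    · intro n hn
      simp only [Finset.coe_filter, Finset.mem_Icc, Set.mem_ofPred_eq] at hn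
      simpa [Nat.lt_succ_iff] using Nat.div_le_div_right hn.1.2
    · intro n hn n' hn' hdiv
      simp only [Finset.coe_filter, Set.mem_ofPred_eq] at hn hn'
      have hmod : n ≡ n' [MOD M] := by
        rw [hM, Nat.modEq_iff_dvd, ← Int.lcm_natCast_natCast]
        refine Int.coe_lcm_dvd ?_ ?_
        · exact dvd_sub (by exact_mod_cast hn'.2.1) (by exact_mod_cast hn.2.1)
        · have : ((n' : ℤ) - n) = ((n' + h : ℕ) : ℤ) - ((n + h : ℕ) : ℤ) := by
            push_cast; ring
          rw [this]
          exact dvd_sub (by exact_mod_cast hn'.2.2) (by exact_mod_cast hn.2.2)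
      have hdiv' : n / M = n' / M := hdiv
      rw [← Nat.div_add_mod n M, ← Nat.div_add_mod n' M, hdiv', hmod]
  have hML : (Nat.gcd x y : ℝ) * M = x * y := by
    exact_mod_cast Nat.gcd_mul_lcm x y
  have hMR : (0 : ℝ) < M := by exact_mod_cast hMpos
  have hg : (0 : ℝ) < Nat.gcd x y := by exact_mod_cast Nat.gcd_pos_of_pos_left y hx
  have hfrac : (Nat.gcd x y : ℝ) / (x * y) = 1 / M := by
    rw [← hML]; field_simp
  have hM2 : (M : ℝ) ≤ 2 * N := by
    have : M ≤ x * y := Nat.le_of_dvd (Nat.mul_pos hx hy) (Nat.lcm_dvd_mul x y)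
    exact_mod_cast this.trans hxy
  calc _ ≤ ((N / M + 1 : ℕ) : ℝ) := by exact_mod_cast hcard
    _ ≤ (N : ℝ) / M + 1 := by push_cast; gcongr; exact Nat.cast_div_le
    _ ≤ (N : ℝ) / M + 2 * N / M := by gcongr; rwa [one_le_div hMR]
    _ = _ := by rw [hfrac]; ring

lemma sum_inv_filter_dvd_le (M : ℕ) {g : ℕ} (hg : 0 < g) :
    ∑ x ∈ (Finset.Icc 1 M).filter (fun x => g ∣ x), (1 : ℝ) / x ≤
      (∑ x ∈ Finset.Icc 1 M, (1 : ℝ) / x) / g := by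
  rw [Finset.sum_div]
  calc _ ≤ ∑ x ∈ (Finset.Icc 1 M).image (fun x => g * x), (1 : ℝ) / x := by
        refine Finset.sum_le_sum_of_subset_of_nonneg ?_ (fun _ _ _ => by positivity)
        intro x hx
        simp only [Finset.mem_filter, Finset.mem_Icc] at hx
        obtain ⟨⟨h1, h2⟩, t, rfl⟩ := hx
        refine Finset.mem_image.2 ⟨t, Finset.mem_Icc.2 ⟨?_, ?_⟩, rfl⟩
        · exact Nat.pos_of_mul_pos_left h1
        · exact (Nat.le_mul_of_pos_left t hg).trans h2
    _ = ∑ x ∈ Finset.Icc 1 M, (1 : ℝ) / ((g * x : ℕ) : ℝ) :=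
        Finset.sum_image fun a _ b _ hab => Nat.eq_of_mul_eq_mul_left hg hab
    _ ≤ _ := by
        refine Finset.sum_le_sum fun x _ => le_of_eq ?_
        push_cast
        rw [div_div, mul_comm]

lemma sum_Icc_inv_sq_le_two (M : ℕ) : ∑ g ∈ Finset.Icc 1 M, (1 : ℝ) / (g : ℝ) ^ 2 ≤ 2 := by
  have key : ∑ g ∈ Finset.Icc 1 (M + 1), (1 : ℝ) / (g : ℝ) ^ 2 ≤ 2 - 1 / (M + 1) := by
    induction M with
    | zero => norm_num
    | succ n ih =>
      rw [Finset.sum_Icc_succ_top (by omega)]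
      have : (1 : ℝ) / ((n + 1 + 1 : ℕ) : ℝ) ^ 2 ≤ 1 / (n + 1) - 1 / ((n + 1 : ℕ) + 1) := by
        push_cast
        rw [div_sub_div _ _ (by positivity) (by positivity),
          div_le_div_iff₀ (by positivity) (by positivity)]
        nlinarith
      linarith
  have h0 : (0 : ℝ) ≤ 1 / (M + 1) := by positivity
  have hsub : ∑ g ∈ Finset.Icc 1 M, (1 : ℝ) / (g : ℝ) ^ 2 ≤
      ∑ g ∈ Finset.Icc 1 (M + 1), (1 : ℝ) / (g : ℝ) ^ 2 :=
    Finset.sum_le_sum_of_subset_of_nonneg (Finset.Icc_subset_Icc_right (by omega))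
      (fun _ _ _ => by positivity)
  linarith

lemma sum_gcd_div_le (M : ℕ) :
    ∑ l ∈ Finset.Icc 1 M, ∑ x ∈ Finset.Icc 1 M, ∑ y ∈ Finset.Icc 1 M,
      (if Nat.gcd x y ∣ l then (Nat.gcd x y : ℝ) / (l * (x * y)) else 0) ≤
      2 * (∑ x ∈ Finset.Icc 1 M, (1 : ℝ) / x) ^ 3 := by
  set H := ∑ x ∈ Finset.Icc 1 M, (1 : ℝ) / x with hH
  have hH0 : 0 ≤ H := Finset.sum_nonneg fun _ _ => by positivity
  let u : ℕ → ℕ → ℝ := fun g x => if g ∣ x then (1 : ℝ) / x else 0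
  have hu0 : ∀ g x, 0 ≤ u g x := fun g x => by
    by_cases h : g ∣ x <;> simp [u, h]
  have hterm : ∀ l ∈ Finset.Icc 1 M, ∀ x ∈ Finset.Icc 1 M, ∀ y ∈ Finset.Icc 1 M,
      (if Nat.gcd x y ∣ l then (Nat.gcd x y : ℝ) / (l * (x * y)) else 0) ≤
        ∑ g ∈ Finset.Icc 1 M, (g : ℝ) * (u g l * (u g x * u g y)) := by
    intro l _ x hx y _
    have hnonneg : ∀ g ∈ Finset.Icc 1 M, 0 ≤ (g : ℝ) * (u g l * (u g x * u g y)) := fun g _ =>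
      mul_nonneg (by positivity) (mul_nonneg (hu0 _ _) (mul_nonneg (hu0 _ _) (hu0 _ _)))
    split_ifs with h
    · rw [Finset.mem_Icc] at hx
      have hmem : Nat.gcd x y ∈ Finset.Icc 1 M := Finset.mem_Icc.2
        ⟨Nat.gcd_pos_of_pos_left y hx.1, (Nat.gcd_le_left y hx.1).trans hx.2⟩
      refine le_trans (le_of_eq ?_) (Finset.single_le_sum hnonneg hmem)
      simp only [u, h, Nat.gcd_dvd_left, Nat.gcd_dvd_right, if_true]
      simp only [div_eq_mul_inv, mul_inv, one_mul]
    · exact Finset.sum_nonneg hnonneg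
  calc _ ≤ ∑ l ∈ Finset.Icc 1 M, ∑ x ∈ Finset.Icc 1 M, ∑ y ∈ Finset.Icc 1 M,
        ∑ g ∈ Finset.Icc 1 M, (g : ℝ) * (u g l * (u g x * u g y)) :=
        Finset.sum_le_sum fun l hl => Finset.sum_le_sum fun x hx => Finset.sum_le_sum fun y hy =>
          hterm l hl x hx y hy
    _ = ∑ g ∈ Finset.Icc 1 M, (g : ℝ) * (∑ x ∈ Finset.Icc 1 M, u g x) ^ 3 := by
        simp_rw [Finset.sum_comm (s := Finset.Icc 1 M) (t := Finset.Icc 1 M)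
          (f := fun y g => (g : ℝ) * (u g _ * (u g _ * u g y)))]
        simp_rw [← Finset.mul_sum]
        simp_rw [Finset.sum_comm (s := Finset.Icc 1 M) (t := Finset.Icc 1 M)
          (f := fun x g => (g : ℝ) * (u g _ * (u g x * _)))]
        simp_rw [← Finset.mul_sum, ← Finset.sum_mul]
        rw [Finset.sum_comm]
        simp_rw [← Finset.mul_sum, ← Finset.sum_mul]
        refine Finset.sum_congr rfl fun g _ => ?_
        ring
    _ ≤ ∑ g ∈ Finset.Icc 1 M, H ^ 3 * (1 / (g : ℝ) ^ 2) := by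
        refine Finset.sum_le_sum fun g hg => ?_
        have hg0 : 0 < g := (Finset.mem_Icc.1 hg).1
        have hgR : (0 : ℝ) < g := by exact_mod_cast hg0
        have hle : ∑ x ∈ Finset.Icc 1 M, u g x ≤ H / g := by
          rw [← Finset.sum_filter]
          exact sum_inv_filter_dvd_le M hg0
        have h0 : 0 ≤ ∑ x ∈ Finset.Icc 1 M, u g x := Finset.sum_nonneg fun _ _ => hu0 _ _
        calc (g : ℝ) * (∑ x ∈ Finset.Icc 1 M, u g x) ^ 3 ≤ g * (H / g) ^ 3 := by gcongr
          _ = H ^ 3 * (1 / (g : ℝ) ^ 2) := by field_simp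
    _ = H ^ 3 * ∑ g ∈ Finset.Icc 1 M, 1 / (g : ℝ) ^ 2 := by rw [Finset.mul_sum]
    _ ≤ H ^ 3 * 2 := by gcongr; exact sum_Icc_inv_sq_le_two M
    _ = _ := mul_comm _ _

/-- The quadruples `(l, x, y, n)` with `x ∣ n`, `y ∣ n + kl`, `xy ≤ 2N` and `gcd(x, y) ∣ l`. -/
def divisorQuadruples (k N : ℕ) : Finset (ℕ × ℕ × ℕ × ℕ) :=
  (Finset.Icc 1 (2 * N) ×ˢ Finset.Icc 1 (2 * N) ×ˢ Finset.Icc 1 (2 * N) ×ˢ Finset.Icc 1 N).filter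
    fun q => (q.2.1 ∣ q.2.2.2 ∧ q.2.2.1 ∣ q.2.2.2 + k * q.1) ∧
      q.2.1 * q.2.2.1 ≤ 2 * N ∧ Nat.gcd q.2.1 q.2.2.1 ∣ q.1

lemma sum_divisorQuadruples_inv_le (k N : ℕ) :
    ∑ q ∈ divisorQuadruples k N, (1 : ℝ) / q.1 ≤
      6 * N * (∑ x ∈ Finset.Icc 1 (2 * N), (1 : ℝ) / x) ^ 3 := by
  rw [divisorQuadruples, Finset.sum_filter, Finset.sum_product]
  simp_rw [Finset.sum_product]
  have hinner : ∀ l ∈ Finset.Icc 1 (2 * N), ∀ x ∈ Finset.Icc 1 (2 * N),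
      ∀ y ∈ Finset.Icc 1 (2 * N),
      ∑ n ∈ Finset.Icc 1 N, (if (x ∣ n ∧ y ∣ n + k * l) ∧ x * y ≤ 2 * N ∧ Nat.gcd x y ∣ l
        then (1 : ℝ) / l else 0) ≤
      3 * N * (if Nat.gcd x y ∣ l then (Nat.gcd x y : ℝ) / (l * (x * y)) else 0) := by
    intro l hl x hx y hy
    by_cases h : x * y ≤ 2 * N ∧ Nat.gcd x y ∣ l
    · simp only [h, and_true, if_true]
      rw [← Finset.sum_filter, Finset.sum_const, nsmul_eq_mul]
      have hc := card_filter_dvd_dvd_add_le (k * l) (Finset.mem_Icc.1 hx).1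
        (Finset.mem_Icc.1 hy).1 h.1
      calc _ ≤ 3 * N * ((Nat.gcd x y : ℝ) / (x * y)) * (1 / l) := by gcongr
        _ = _ := by simp only [div_eq_mul_inv, mul_inv]; ring
    · simp only [h, and_false, if_false, Finset.sum_const_zero]
      split_ifs <;> positivity
  calc _ ≤ ∑ l ∈ Finset.Icc 1 (2 * N), ∑ x ∈ Finset.Icc 1 (2 * N), ∑ y ∈ Finset.Icc 1 (2 * N),
        3 * N * (if Nat.gcd x y ∣ l then (Nat.gcd x y : ℝ) / (l * (x * y)) else 0) :=
        Finset.sum_le_sum fun l hl => Finset.sum_le_sum fun x hx => Finset.sum_le_sum fun y hy =>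
          hinner l hl x hx y hy
    _ ≤ 3 * N * (2 * (∑ x ∈ Finset.Icc 1 (2 * N), (1 : ℝ) / x) ^ 3) := by
        simp_rw [← Finset.mul_sum]
        gcongr
        exact sum_gcd_div_le (2 * N)
    _ = _ := by ring

lemma one_div_abs_log_div_le_s10 {m n h : ℕ} (hn : 0 < n) (hh : 0 < h) (hm : m = n + h) :
    1 / |Real.log ((m : ℝ) / n)| ≤ (m : ℝ) / h := by
  have hnR : (0 : ℝ) < n := by exact_mod_cast hn
  have hhR : (0 : ℝ) < h := by exact_mod_cast hh
  have hmR : (m : ℝ) = n + h := by exact_mod_cast hm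
  have hm0 : (0 : ℝ) < m := by rw [hmR]; positivity
  have hlog := Real.one_sub_inv_le_log_of_pos (div_pos hm0 hnR)
  have heq : 1 - ((m : ℝ) / n)⁻¹ = h / m := by
    rw [inv_div, eq_div_iff hm0.ne', sub_mul, div_mul_cancel₀ _ hm0.ne', hmR]; ring
  rw [heq] at hlog
  have hpos : (0 : ℝ) < h / m := div_pos hhR hm0
  rw [abs_of_pos (hpos.trans_le hlog)]
  calc 1 / Real.log ((m : ℝ) / n) ≤ 1 / ((h : ℝ) / m) := one_div_le_one_div_of_le hpos hlog
    _ = _ := one_div_div _ _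

lemma eq_and_eq_of_min_of_mul {b d b' d' : ℕ} (hb : 0 < b) (hd : 0 < d)
    (hmin : min b d = min b' d') (hmul : b * d = b' * d')
    (hle : b ≤ d ↔ b' ≤ d') : b = b' ∧ d = d' := by
  by_cases h : b ≤ d
  · have h' := hle.1 h
    rw [min_eq_left h, min_eq_left h'] at hmin
    subst hmin
    exact ⟨rfl, Nat.eq_of_mul_eq_mul_left hb hmul⟩
  · have h' := fun t => h (hle.2 t)
    rw [min_eq_right (by omega), min_eq_right (by omega)] at hmin
    subst hmin
    exact ⟨Nat.eq_of_mul_eq_mul_right hd hmul, rfl⟩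

/-- The summation condition of `Enear`. -/
def NearDiagonal (k : ℕ) (Z₁ Z₂ : ℝ) (a b c d : ℕ) : Prop :=
  Z₁ ≤ ((a * b : ℕ) : ℝ) ∧ ((a * b : ℕ) : ℝ) < 2 * Z₁ ∧
    Z₂ ≤ ((c * d : ℕ) : ℝ) ∧ ((c * d : ℕ) : ℝ) < 2 * Z₂ ∧
    b * d < a * c ∧ a * c ≤ 2 * (b * d) ∧
    (k : ℤ) ∣ ((a * c : ℕ) : ℤ) - ((b * d : ℕ) : ℤ) ∧
    a * c ≠ b * d ∧ Nat.gcd (a * b * c * d) k = 1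

lemma NearDiagonal.exists_eq_add {k a b c d : ℕ} {Z₁ Z₂ : ℝ}
    (hP : NearDiagonal k Z₁ Z₂ a b c d) : ∃ l, 0 < l ∧ a * c = b * d + k * l := by
  obtain ⟨-, -, -, -, hlt, -, hdvd, -, -⟩ := hP
  rw [← Nat.cast_sub hlt.le, Int.natCast_dvd_natCast] at hdvd
  obtain ⟨l, hl⟩ := hdvd
  refine ⟨l, Nat.pos_of_ne_zero ?_, by omega⟩
  rintro rfl
  simp at hl
  omega

lemma NearDiagonal.mul_le_floor {k a b c d : ℕ} {Z₁ Z₂ : ℝ} (hZ₁ : 2 ≤ Z₁)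
    (hP : NearDiagonal k Z₁ Z₂ a b c d) : b * d ≤ ⌊2 * √(Z₁ * Z₂)⌋₊ := by
  obtain ⟨-, h2, -, h4, hlt, -, -, -, -⟩ := hP
  refine Nat.le_floor ?_
  have hprod : ((a * b : ℕ) : ℝ) * ((c * d : ℕ) : ℝ) ≤ (2 * Z₁) * (2 * Z₂) :=
    mul_le_mul h2.le h4.le (by positivity) (by linarith)
  have hsq : ((b * d : ℕ) : ℝ) ^ 2 ≤ 4 * (Z₁ * Z₂) := by
    have : ((b * d : ℕ) : ℝ) ≤ ((a * c : ℕ) : ℝ) := by exact_mod_cast hlt.le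
    calc ((b * d : ℕ) : ℝ) ^ 2 ≤ ((b * d : ℕ) : ℝ) * ((a * c : ℕ) : ℝ) := by rw [sq]; gcongr
      _ = ((a * b : ℕ) : ℝ) * ((c * d : ℕ) : ℝ) := by push_cast; ring
      _ ≤ _ := by linarith
  calc ((b * d : ℕ) : ℝ) ≤ √(4 * (Z₁ * Z₂)) := Real.le_sqrt_of_sq_le hsq
    _ = 2 * √(Z₁ * Z₂) := by
      rw [Real.sqrt_mul (by norm_num), show (4 : ℝ) = 2 ^ 2 by norm_num,
        Real.sqrt_sq (by norm_num)]

/-- The index attached to `(a, b, c, d)`: the quadruple `((ac - bd)/k, min b d, min a c, bd)`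
together with the outcomes of the comparisons `b ≤ d` and `a ≤ c`. -/
def nearDiagonalIndex (k : ℕ) (p : ℕ+ × ℕ+ × ℕ+ × ℕ+) :
    (ℕ × ℕ × ℕ × ℕ) × Bool × Bool :=
  (((p.1 * p.2.2.1 - p.2.1 * p.2.2.2 : ℕ) / k, min (p.2.1 : ℕ) p.2.2.2,
    min (p.1 : ℕ) p.2.2.1, (p.2.1 * p.2.2.2 : ℕ)),
    decide ((p.2.1 : ℕ) ≤ p.2.2.2), decide ((p.1 : ℕ) ≤ p.2.2.1))

lemma min_dvd_mul (x y : ℕ) : min x y ∣ x * y := by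
  rcases min_choice x y with h | h <;> rw [h]
  · exact dvd_mul_right _ _
  · exact dvd_mul_left _ _

lemma min_sq_le_mul (x y : ℕ) : min x y ^ 2 ≤ x * y := by
  rw [sq]
  exact Nat.mul_le_mul (min_le_left _ _) (min_le_right _ _)

lemma NearDiagonal.index_mem {k N a b c d l : ℕ} {Z₁ Z₂ : ℝ} (hk : 0 < k)
    (ha : 0 < a) (hb : 0 < b) (hc : 0 < c) (hd : 0 < d) (hl : 0 < l)
    (hP : NearDiagonal k Z₁ Z₂ a b c d) (hN : b * d ≤ N) (h : a * c = b * d + k * l) :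
    (l, min b d, min a c, b * d) ∈ divisorQuadruples k N := by
  obtain ⟨-, -, -, -, hlt, hle, -, -, hcop⟩ := hP
  have hx2 := min_sq_le_mul b d
  have hy2 := min_sq_le_mul a c
  have hx0 : 0 < min b d := lt_min hb hd
  have hy0 : 0 < min a c := lt_min ha hc
  have hlk : l ≤ k * l := Nat.le_mul_of_pos_left l hk
  have hxdvd := min_dvd_mul b d
  have hydvd := min_dvd_mul a c
  have hbd : 0 < b * d := Nat.mul_pos hb hd
  have hgl : Nat.gcd (min b d) (min a c) ∣ l := by
    have hkl : Nat.gcd (min b d) (min a c) ∣ k * l := by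
      rw [← Nat.dvd_add_right ((Nat.gcd_dvd_left _ _).trans hxdvd), ← h]
      exact (Nat.gcd_dvd_right _ _).trans hydvd
    refine Nat.Coprime.dvd_of_dvd_mul_left (Nat.Coprime.coprime_dvd_left ?_ hcop) hkl
    exact ((Nat.gcd_dvd_left _ _).trans hxdvd).trans ⟨a * c, by ring⟩
  generalize min b d = x at *
  generalize min a c = y at *
  simp only [divisorQuadruples, Finset.mem_filter, Finset.mem_product, Finset.mem_Icc]
  refine ⟨⟨⟨hl, by omega⟩, ⟨hx0, ?_⟩, ⟨hy0, ?_⟩, hbd, hN⟩, ⟨hxdvd, h ▸ hydvd⟩, ?_, hgl⟩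
  · nlinarith
  · nlinarith
  · nlinarith [two_mul_le_add_sq x y]

lemma nearDiagonalIndex_injOn {k : ℕ} {Z₁ Z₂ : ℝ} (hk : 0 < k) :
    Set.InjOn (nearDiagonalIndex k)
      {p | NearDiagonal k Z₁ Z₂ p.1 p.2.1 p.2.2.1 p.2.2.2} := by
  rintro ⟨a, b, c, d⟩ hp ⟨a', b', c', d'⟩ hp' heq
  obtain ⟨l, -, hl⟩ := NearDiagonal.exists_eq_add hp
  obtain ⟨l', -, hl'⟩ := NearDiagonal.exists_eq_add hp'
  simp only at hl hl'
  simp only [nearDiagonalIndex, Prod.mk.injEq, decide_eq_decide, hl, hl', Nat.add_sub_cancel_left,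
    Nat.mul_div_cancel_left _ hk] at heq
  obtain ⟨⟨rfl, hx, hy, hn⟩, hbd, hac⟩ := heq
  obtain ⟨h1, h2⟩ := eq_and_eq_of_min_of_mul b.pos d.pos hx hn hbd
  obtain ⟨h3, h4⟩ := eq_and_eq_of_min_of_mul a.pos c.pos hy (by rw [hl, hl', hn]) hac
  simp only [Prod.mk.injEq]
  exact ⟨PNat.eq h3, PNat.eq h1, PNat.eq h4, PNat.eq h2⟩

lemma NearDiagonal.one_div_abs_log_le {k N : ℕ} {a b c d : ℕ} {Z₁ Z₂ : ℝ} (hk : 0 < k)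
    (hb : 0 < b) (hd : 0 < d) (hP : NearDiagonal k Z₁ Z₂ a b c d) (hN : b * d ≤ N) :
    1 / |Real.log (((a * c : ℕ) : ℝ) / ((b * d : ℕ) : ℝ))| ≤
      2 * N / k * (1 / ((a * c - b * d) / k : ℕ)) := by
  obtain ⟨l, hl, h⟩ := hP.exists_eq_add
  obtain ⟨-, -, -, -, -, hle, -, -, -⟩ := hP
  have hdiv : (a * c - b * d) / k = l := by
    rw [h, Nat.add_sub_cancel_left, Nat.mul_div_cancel_left _ hk]
  have hm : ((a * c : ℕ) : ℝ) ≤ 2 * N := by exact_mod_cast (by omega : a * c ≤ 2 * N)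
  rw [hdiv]
  calc _ ≤ ((a * c : ℕ) : ℝ) / ((k * l : ℕ) : ℝ) :=
        one_div_abs_log_div_le_s10 (Nat.mul_pos hb hd) (Nat.mul_pos hk hl) h
    _ ≤ 2 * N / ((k * l : ℕ) : ℝ) := by gcongr
    _ = _ := by push_cast; rw [div_mul_div_comm, mul_one]

lemma Enear_le_floor {k : ℕ} {Z₁ Z₂ : ℝ} (hk : 0 < k) (hZ₁ : 2 ≤ Z₁) :
    Enear k Z₁ Z₂ ≤ 48 * ((⌊2 * √(Z₁ * Z₂)⌋₊ : ℝ) ^ 2 / k) *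
      (∑ x ∈ Finset.Icc 1 (2 * ⌊2 * √(Z₁ * Z₂)⌋₊), (1 : ℝ) / x) ^ 3 := by
  classical
  set N := ⌊2 * √(Z₁ * Z₂)⌋₊ with hN
  refine Real.tsum_le_of_sum_le (fun p => ?_) fun u => ?_
  · dsimp only [Pi.zero_apply]
    split_ifs <;> positivity
  · dsimp only
    set S := u.filter fun p : ℕ+ × ℕ+ × ℕ+ × ℕ+ =>
      NearDiagonal k Z₁ Z₂ p.1 p.2.1 p.2.2.1 p.2.2.2 with hS
    have hmem : ∀ p ∈ S, NearDiagonal k Z₁ Z₂ p.1 p.2.1 p.2.2.1 p.2.2.2 := fun p hp =>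
      (Finset.mem_filter.1 hp).2
    calc _ = ∑ p ∈ S,
          1 / |Real.log (((p.1 * p.2.2.1 : ℕ) : ℝ) / ((p.2.1 * p.2.2.2 : ℕ) : ℝ))| := by
          rw [hS, Finset.sum_filter]
          refine Finset.sum_congr rfl fun p _ => ?_
          unfold NearDiagonal
          congr
      _ ≤ ∑ p ∈ S, 2 * N / k * (1 / ((nearDiagonalIndex k p).1.1 : ℝ)) := by
          refine Finset.sum_le_sum fun p hp => ?_
          exact (hmem p hp).one_div_abs_log_le hk p.2.1.pos p.2.2.2.pos
            ((hmem p hp).mul_le_floor hZ₁)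
      _ = ∑ q ∈ S.image (nearDiagonalIndex k), 2 * N / k * (1 / (q.1.1 : ℝ)) := by
          rw [Finset.sum_image]
          exact (nearDiagonalIndex_injOn hk).mono hmem
      _ ≤ ∑ q ∈ divisorQuadruples k N ×ˢ (Finset.univ : Finset (Bool × Bool)),
            2 * N / k * (1 / (q.1.1 : ℝ)) := by
          refine Finset.sum_le_sum_of_subset_of_nonneg ?_ fun _ _ _ => by positivity
          intro q hq
          obtain ⟨p, hp, rfl⟩ := Finset.mem_image.1 hq
          refine Finset.mem_product.2 ⟨?_, Finset.mem_univ _⟩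
          obtain ⟨l, hl, h⟩ := (hmem p hp).exists_eq_add
          have := (hmem p hp).index_mem hk p.1.pos p.2.1.pos p.2.2.1.pos p.2.2.2.pos hl
            ((hmem p hp).mul_le_floor hZ₁) h
          simpa only [nearDiagonalIndex, h, Nat.add_sub_cancel_left,
            Nat.mul_div_cancel_left _ hk] using this
      _ = 8 * N / k * ∑ q ∈ divisorQuadruples k N, 1 / (q.1 : ℝ) := by
          rw [Finset.sum_product]
          simp only [Finset.sum_const, Finset.card_univ, Fintype.card_prod, Fintype.card_bool,
            nsmul_eq_mul, Finset.mul_sum]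
          refine Finset.sum_congr rfl fun _ _ => ?_
          push_cast
          ring
      _ ≤ 8 * N / k * (6 * N * (∑ x ∈ Finset.Icc 1 (2 * N), (1 : ℝ) / x) ^ 3) := by
          gcongr
          exact sum_divisorQuadruples_inv_le k N
      _ = _ := by ring

lemma sum_Icc_inv_le_one_add_log (M : ℕ) :
    ∑ x ∈ Finset.Icc 1 M, (1 : ℝ) / x ≤ 1 + Real.log M := by
  have h := harmonic_le_one_add_log M
  rw [harmonic_eq_sum_Icc] at h
  push_cast at h
  simpa only [one_div] using h

/-- The part of the off-diagonal sum with `bd < ac ≤ 2bd` and `ac ≡ bd (mod k)` is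
`≪ (Z₁Z₂/k)(log Z₁Z₂)³` with an absolute implied constant. -/
theorem fourth_moment_offdiagonal_near_diagonal :
    ∃ C : ℝ, 0 < C ∧ ∀ (k : ℕ), 0 < k → ∀ (Z₁ Z₂ : ℝ), 2 ≤ Z₁ → 2 ≤ Z₂ →
      Enear k Z₁ Z₂ ≤ C * (Z₁ * Z₂ / k) * Real.log (Z₁ * Z₂) ^ 3 := by
  refine ⟨192 * 3 ^ 3, by norm_num, fun k hk Z₁ Z₂ h₁ h₂ => (Enear_le_floor hk h₁).trans ?_⟩
  set Z := Z₁ * Z₂ with hZ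
  have hZ4 : 4 ≤ Z := by nlinarith
  set N := ⌊2 * √Z⌋₊ with hN
  have hs : 2 ≤ √Z := Real.le_sqrt_of_sq_le (by linarith)
  have hNle : (N : ℝ) ≤ 2 * √Z := Nat.floor_le (by positivity)
  have hN1 : 1 ≤ N := Nat.le_floor (by push_cast; linarith)
  have hN2 : (N : ℝ) ^ 2 ≤ 4 * Z := by
    calc (N : ℝ) ^ 2 ≤ (2 * √Z) ^ 2 := by gcongr
      _ = 4 * Z := by rw [mul_pow, Real.sq_sqrt (by linarith)]; ring
  have hlogZ : 1 ≤ Real.log Z := by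
    rw [Real.le_log_iff_exp_le (by linarith)]
    linarith [Real.exp_one_lt_d9]
  have hH0 : (0 : ℝ) ≤ ∑ x ∈ Finset.Icc 1 (2 * N), (1 : ℝ) / x :=
    Finset.sum_nonneg fun _ _ => by positivity
  have hH : ∑ x ∈ Finset.Icc 1 (2 * N), (1 : ℝ) / x ≤ 3 * Real.log Z := by
    have hNZ : ((2 * N : ℕ) : ℝ) ≤ Z ^ 2 := by
      have hsZ : √Z ≤ Z := by nlinarith [Real.sq_sqrt (by linarith : (0 : ℝ) ≤ Z)]
      push_cast
      nlinarith
    have hpos : (0 : ℝ) < ((2 * N : ℕ) : ℝ) := by exact_mod_cast (by omega : 0 < 2 * N)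
    have hlog := Real.log_le_log hpos hNZ
    rw [Real.log_pow] at hlog
    push_cast at hlog
    have := sum_Icc_inv_le_one_add_log (2 * N)
    push_cast at this
    linarith
  calc _ ≤ 48 * (4 * Z / k) * (3 * Real.log Z) ^ 3 := by gcongr
    _ = _ := by ring
end

section
/- For every integer q ≥ 2 and every real x ≥ 2, Σ_{n ≤ x, gcd(n,q)=1} 1/n = (φ(q)/q)·(log x + O(1 + log ω(q))) + O(2^{ω(q)}·(log x)/x), with absolute implied constants. -/
open Finset in
/-- The sum of `1 / n` over `1 ≤ n ≤ y` with `n` divisible by no member of `P`. -/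
noncomputable def siftedHarmonic (P : Finset ℕ) (y : ℝ) : ℝ :=
  ∑ n ∈ (Icc 1 ⌊y⌋₊).filter (fun n => ∀ p ∈ P, ¬ p ∣ n), (1 : ℝ) / n

open Finset in
theorem abs_siftedHarmonic_empty_sub_le {y : ℝ} (hy : 0 < y) :
    |siftedHarmonic ∅ y - (Real.log y + Real.eulerMascheroniConstant)| ≤ 2 / y := by
  have hγ₁ := Real.one_half_lt_eulerMascheroniConstant
  have hγ₂ := Real.eulerMascheroniConstant_lt_two_thirds
  have hS : siftedHarmonic ∅ y = harmonic ⌊y⌋₊ := by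
    simp [siftedHarmonic, harmonic_eq_sum_Icc]
  rw [hS, abs_le]
  have hy' : 0 < 1 / y := by positivity
  have h2 : 2 / y = 2 * (1 / y) := by ring
  rcases lt_or_ge y 1 with h1 | h1
  · have h0 : ⌊y⌋₊ = 0 := Nat.floor_eq_zero.2 h1
    have hlog : Real.log y ≤ 0 := Real.log_nonpos hy.le h1.le
    have hlog' : Real.log (1 / y) ≤ 1 / y - 1 := Real.log_le_sub_one_of_pos hy'
    rw [one_div, Real.log_inv, ← one_div] at hlog'
    have : 1 ≤ 1 / y := by rw [le_div_iff₀ hy]; linarith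
    rw [h0, harmonic_zero, h2]
    push_cast
    constructor <;> linarith
  · set N := ⌊y⌋₊ with hN
    have hN1 : 1 ≤ N := Nat.one_le_floor_iff _ |>.2 h1
    have hN1' : (1 : ℝ) ≤ N := by exact_mod_cast hN1
    have hNy : (N : ℝ) ≤ y := Nat.floor_le hy.le
    have hyN : y < N + 1 := Nat.lt_floor_add_one y
    have hlow := Real.eulerMascheroniSeq_lt_eulerMascheroniConstant N
    have hupp := Real.eulerMascheroniConstant_lt_eulerMascheroniSeq' N
    rw [Real.eulerMascheroniSeq] at hlow
    rw [Real.eulerMascheroniSeq', if_neg (by omega)] at hupp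
    have ha : Real.log ((N + 1) / y) ≤ (N + 1) / y - 1 :=
      Real.log_le_sub_one_of_pos (by positivity)
    rw [Real.log_div (by positivity) hy.ne'] at ha
    have ha' : (N + 1) / y - 1 ≤ 1 / y := by
      rw [div_sub_one hy.ne']; gcongr; linarith
    have hb : Real.log (y / N) ≤ y / N - 1 := Real.log_le_sub_one_of_pos (by positivity)
    rw [Real.log_div hy.ne' (by positivity)] at hb
    have hb' : y / N - 1 ≤ 2 / y := by
      rw [div_sub_one (by positivity), div_le_div_iff₀ (by positivity) hy]
      nlinarith
    constructor <;> linarith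

open Finset in
theorem siftedHarmonic_insert {P : Finset ℕ} (hP : ∀ r ∈ P, r.Prime) {p : ℕ} (hp : p.Prime)
    (hpP : p ∉ P) (y : ℝ) :
    siftedHarmonic (insert p P) y = siftedHarmonic P y - siftedHarmonic P (y / p) / p := by
  have hdvd : ∑ n ∈ ((Icc 1 ⌊y⌋₊).filter (fun n => ∀ r ∈ P, ¬ r ∣ n)).filter (fun n => p ∣ n),
      (1 : ℝ) / n = siftedHarmonic P (y / p) / p := by
    rw [siftedHarmonic, Nat.floor_div_natCast, sum_div]
    symm
    refine sum_bij (fun m _ => p * m) ?_ ?_ ?_ ?_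
    · intro m hm
      simp only [mem_filter, mem_Icc] at hm ⊢
      obtain ⟨⟨h1, h2⟩, h3⟩ := hm
      refine ⟨⟨⟨Nat.mul_pos hp.pos h1, ?_⟩, ?_⟩, dvd_mul_right _ _⟩
      · rw [mul_comm]; exact (Nat.le_div_iff_mul_le hp.pos).1 h2
      · intro r hr hd
        rcases (hP r hr).dvd_mul.1 hd with h | h
        · exact hpP ((Nat.prime_dvd_prime_iff_eq (hP r hr) hp).1 h ▸ hr)
        · exact h3 r hr h
    · intro a _ b _ h
      exact Nat.eq_of_mul_eq_mul_left hp.pos h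
    · intro n hn
      simp only [mem_filter, mem_Icc] at hn
      obtain ⟨⟨⟨h1, h2⟩, h3⟩, m, rfl⟩ := hn
      refine ⟨m, ?_, rfl⟩
      simp only [mem_filter, mem_Icc]
      refine ⟨⟨Nat.pos_of_mul_pos_left h1, ?_⟩, fun r hr hd => h3 r hr (hd.mul_left p)⟩
      rw [Nat.le_div_iff_mul_le hp.pos, mul_comm]; exact h2
    · intro m _
      push_cast
      rw [div_div, mul_comm]
  have hndvd : siftedHarmonic (insert p P) y =
      ∑ n ∈ ((Icc 1 ⌊y⌋₊).filter (fun n => ∀ r ∈ P, ¬ r ∣ n)).filter (fun n => ¬ p ∣ n),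
        (1 : ℝ) / n := by
    rw [siftedHarmonic, filter_filter]
    congr 1
    ext n
    simp only [mem_filter, mem_insert, forall_eq_or_imp]
    tauto
  rw [hndvd, ← hdvd, siftedHarmonic, eq_sub_iff_add_eq']
  exact sum_filter_add_sum_filter_not _ _ _

theorem abs_siftedHarmonic_sub_le (P : Finset ℕ) (hP : ∀ p ∈ P, p.Prime) {y : ℝ} (hy : 0 < y) :
    |siftedHarmonic P y - (∏ p ∈ P, (1 - (p : ℝ)⁻¹)) * (Real.log y +
      (Real.eulerMascheroniConstant + ∑ p ∈ P, Real.log p / (p - 1)))| ≤ 2 ^ P.card * 2 / y := by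
  induction P using Finset.induction_on generalizing y with
  | empty => simpa using abs_siftedHarmonic_empty_sub_le hy
  | insert p P hpP ih =>
    have hp : p.Prime := hP p (Finset.mem_insert_self _ _)
    have hP' : ∀ r ∈ P, r.Prime := fun r hr => hP r (Finset.mem_insert_of_mem hr)
    have hp1 : (1 : ℝ) < p := by exact_mod_cast hp.one_lt
    have hp0 : (0 : ℝ) < p := by linarith
    have h₁ := ih hP' hy
    have h₂ := ih hP' (div_pos hy hp0)
    rw [siftedHarmonic_insert hP' hp hpP, Finset.prod_insert hpP, Finset.sum_insert hpP,
      Finset.card_insert_of_notMem hpP]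
    rw [Real.log_div hy.ne' hp0.ne'] at h₂
    set A := ∏ p ∈ P, (1 - (p : ℝ)⁻¹)
    set L := ∑ p ∈ P, Real.log p / ((p : ℝ) - 1)
    set γ := Real.eulerMascheroniConstant
    set E₁ := siftedHarmonic P y - A * (Real.log y + (γ + L)) with hE₁
    set E₂ := siftedHarmonic P (y / p) - A * (Real.log y - Real.log p + (γ + L)) with hE₂
    have key : siftedHarmonic P y - siftedHarmonic P (y / p) / p -
        (1 - (p : ℝ)⁻¹) * A * (Real.log y + (γ + (Real.log p / (p - 1) + L))) = E₁ - E₂ / p := by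
      have : (p : ℝ) - 1 ≠ 0 := by linarith
      rw [hE₁, hE₂]
      field_simp
      ring
    rw [key]
    calc |E₁ - E₂ / p| ≤ |E₁| + |E₂ / p| := abs_sub _ _
      _ = |E₁| + |E₂| / p := by rw [abs_div, abs_of_pos hp0]
      _ ≤ 2 ^ P.card * 2 / y + (2 ^ P.card * 2 / (y / p)) / p := by gcongr
      _ = 2 ^ (P.card + 1) * 2 / y := by field_simp; ring

open Nat in
theorem sum_log_div_primesLE_le {k : ℕ} (hk : 0 < k) :
    ∑ p ∈ primesLE k, Real.log p / p ≤ Real.log k + Real.log 4 := by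
  have hk0 : (0 : ℝ) < k := by exact_mod_cast hk
  have hθ : ∑ p ∈ primesLE k, Real.log p ≤ Real.log 4 * k := by
    rw [← Chebyshev.theta_eq_sum_primesLE_log]
    exact Chebyshev.theta_le_log4_mul_x hk0.le
  have hfact : ∑ p ∈ primesLE k, ((k / p : ℕ) : ℝ) * Real.log p ≤ k * Real.log k := by
    have hdvd : ∏ p ∈ primesLE k, p ^ (k / p) ∣ k ! := by
      refine Finset.prod_dvd_of_isRelPrime ?_ ?_
      · intro p hp r hr hne
        exact (Nat.coprime_iff_isRelPrime.1 (Nat.Coprime.pow _ _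
          ((Nat.coprime_primes (Nat.prime_of_mem_primesLE hp)
            (Nat.prime_of_mem_primesLE hr)).2 hne)))
      · intro p hp
        have hp' := Nat.prime_of_mem_primesLE hp
        refine (Nat.Prime.pow_dvd_factorial_iff hp' (Nat.lt_add_of_pos_right two_pos)).2 ?_
        simpa using Finset.single_le_sum (f := fun i => k / p ^ i)
          (fun _ _ => Nat.zero_le _)
          (show 1 ∈ Finset.Ico 1 (Nat.log p k + 2) from Finset.mem_Ico.2 ⟨le_rfl, by omega⟩)
    have hle : ∏ p ∈ primesLE k, p ^ (k / p) ≤ k ^ k :=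
      (Nat.le_of_dvd (Nat.factorial_pos k) hdvd).trans (Nat.factorial_le_pow k)
    have hpos : ∀ p ∈ primesLE k, ((p : ℝ) ^ (k / p)) ≠ 0 := fun p hp =>
      pow_ne_zero _ (by exact_mod_cast (Nat.prime_of_mem_primesLE hp).ne_zero)
    have hle' : ∏ p ∈ primesLE k, (p : ℝ) ^ (k / p) ≤ (k : ℝ) ^ k := by exact_mod_cast hle
    have := Real.log_le_log (Finset.prod_pos fun p hp =>
      lt_of_le_of_ne (by positivity) (hpos p hp).symm) hle'
    rw [Real.log_prod hpos, Real.log_pow] at this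
    simpa only [Real.log_pow] using this
  have hterm : ∀ p ∈ primesLE k,
      k * (Real.log p / p) ≤ ((k / p : ℕ) : ℝ) * Real.log p + Real.log p := by
    intro p hp
    have hlog : 0 ≤ Real.log p := Real.log_natCast_nonneg p
    have : (k : ℝ) / p ≤ (k / p : ℕ) + 1 := by
      rw [← Nat.floor_div_eq_div (K := ℝ)]
      exact (Nat.lt_floor_add_one _).le
    calc k * (Real.log p / p) = (k : ℝ) / p * Real.log p := by ring
      _ ≤ ((k / p : ℕ) + 1) * Real.log p := by gcongr
      _ = _ := by ring
  have hsum := Finset.sum_le_sum hterm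
  rw [← Finset.mul_sum, Finset.sum_add_distrib] at hsum
  refine le_of_mul_le_mul_left ?_ hk0
  linarith

theorem sum_log_div_sub_one_le {P : Finset ℕ} (hP : ∀ p ∈ P, p.Prime) (hne : P.Nonempty) :
    ∑ p ∈ P, Real.log p / (p - 1) ≤ 3 * Real.log P.card + 2 * Real.log 4 + 2 := by
  set k := P.card with hk
  have hk0 : 0 < k := hne.card_pos
  have hk1 : (1 : ℝ) ≤ k := by exact_mod_cast hk0
  rw [← Finset.sum_filter_add_sum_filter_not P (fun p => p ≤ k)]
  have hsmall : ∑ p ∈ P.filter (fun p => p ≤ k), Real.log p / ((p : ℝ) - 1) ≤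
      2 * (Real.log k + Real.log 4) := by
    refine le_trans ?_ (mul_le_mul_of_nonneg_left (sum_log_div_primesLE_le hk0) zero_le_two)
    rw [Finset.mul_sum]
    refine (Finset.sum_le_sum (g := fun p : ℕ => 2 * (Real.log p / p)) ?_).trans
      (Finset.sum_le_sum_of_subset_of_nonneg ?_ ?_)
    · intro p hp
      have hp2 : (2 : ℝ) ≤ p := by exact_mod_cast (hP p (Finset.mem_filter.1 hp).1).two_le
      have hlog : 0 ≤ Real.log p := Real.log_natCast_nonneg p
      rw [← mul_div_assoc, div_le_div_iff₀ (by linarith) (by linarith)]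
      nlinarith
    · intro p hp
      obtain ⟨h1, h2⟩ := Finset.mem_filter.1 hp
      exact Nat.mem_primesLE.2 ⟨h2, hP p h1⟩
    · intro p _ _
      have : 0 ≤ Real.log p := Real.log_natCast_nonneg p
      positivity
  have hlarge : ∑ p ∈ P.filter (fun p => ¬ p ≤ k), Real.log p / ((p : ℝ) - 1) ≤
      Real.log k + 2 := by
    have hlogk : 0 ≤ Real.log k := Real.log_natCast_nonneg k
    have hterm : ∀ p ∈ P.filter (fun p => ¬ p ≤ k),
        Real.log p / ((p : ℝ) - 1) ≤ (Real.log k + 2) / k := by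
      intro p hp
      have hpk : (k : ℝ) + 1 ≤ p := by
        have := (Finset.mem_filter.1 hp).2
        exact_mod_cast Nat.succ_le_of_lt (not_le.1 this)
      have hlog : Real.log (p / k) ≤ p / k - 1 :=
        Real.log_le_sub_one_of_pos (div_pos (by linarith) (by linarith))
      rw [Real.log_div (by linarith) (by linarith), div_sub_one (by linarith),
        le_div_iff₀ (by linarith)] at hlog
      rw [div_le_div_iff₀ (by linarith) (by linarith)]
      nlinarith
    calc _ ≤ ((P.filter (fun p => ¬ p ≤ k)).card : ℝ) * ((Real.log k + 2) / k) := by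
          simpa using Finset.sum_le_card_nsmul _ _ _ hterm
      _ ≤ k * ((Real.log k + 2) / k) := by
          gcongr
          exact Finset.card_filter_le _ _
      _ = _ := by field_simp
  linarith

/-- Lemma 5: for `q ≥ 2` and `x ≥ 2`,
`∑_{n ≤ x, (n,q)=1} 1/n = (φ(q)/q)(log x + O(1 + log ω(q))) + O(2^{ω(q)} (log x)/x)`,
with absolute implied constants. -/
theorem fourth_moment_coprime_harmonic_sum :
    ∃ C : ℝ, 0 < C ∧ ∀ (q : ℕ), 2 ≤ q → ∀ (x : ℝ), 2 ≤ x →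
      ∃ c₁ c₂ : ℝ,
        |c₁| ≤ C * (1 + Real.log q.primeFactors.card) ∧
        |c₂| ≤ C * 2 ^ q.primeFactors.card * Real.log x / x ∧
        ∑ n ∈ (Finset.Icc 1 ⌊x⌋₊).filter (fun n => Nat.gcd n q = 1), (1 : ℝ) / n =
          (q.totient / q : ℝ) * (Real.log x + c₁) + c₂ := by
  refine ⟨10, by norm_num, fun q hq x hx => ?_⟩
  have hq0 : q ≠ 0 := by omega
  have hP : ∀ p ∈ q.primeFactors, p.Prime := fun p hp => Nat.prime_of_mem_primeFactors hp
  have hsum : ∑ n ∈ (Finset.Icc 1 ⌊x⌋₊).filter (fun n => Nat.gcd n q = 1), (1 : ℝ) / n =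
      siftedHarmonic q.primeFactors x := by
    rw [siftedHarmonic]
    congr 1
    refine Finset.filter_congr fun n _ => ⟨fun h p hp hd => ?_, fun h => ?_⟩
    · exact Nat.not_coprime_of_dvd_of_dvd (hP p hp).one_lt hd (Nat.dvd_of_mem_primeFactors hp) h
    · exact Nat.Coprime.symm (Nat.coprime_of_dvd fun p hp h1 h2 =>
        h p (Nat.mem_primeFactors.2 ⟨hp, h1, hq0⟩) h2)
  have htot : (q.totient / q : ℝ) = ∏ p ∈ q.primeFactors, (1 - (p : ℝ)⁻¹) := by
    have := Nat.totient_eq_mul_prod_factors q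
    rw [div_eq_iff (by exact_mod_cast hq0), mul_comm]
    have := congrArg (Rat.cast : ℚ → ℝ) this
    push_cast at this
    exact this
  have hmain := abs_siftedHarmonic_sub_le q.primeFactors hP (y := x) (by linarith)
  rw [← htot, ← hsum] at hmain
  have hL := sum_log_div_sub_one_le hP (Nat.nonempty_primeFactors.2 (by omega))
  have hL0 : 0 ≤ ∑ p ∈ q.primeFactors, Real.log p / ((p : ℝ) - 1) :=
    Finset.sum_nonneg fun p hp => div_nonneg (Real.log_natCast_nonneg p)
      (sub_nonneg.2 (by exact_mod_cast (hP p hp).one_le))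
  have hγ₁ := Real.one_half_lt_eulerMascheroniConstant
  have hγ₂ := Real.eulerMascheroniConstant_lt_two_thirds
  have hlog2 : Real.log 4 = 2 * Real.log 2 := by
    rw [show (4 : ℝ) = 2 ^ 2 by norm_num, Real.log_pow]; norm_num
  have hlog2' := Real.log_two_lt_d9
  have hlogx : 1 / 2 ≤ Real.log x := by
    have := Real.log_le_log two_pos hx
    have := Real.log_two_gt_d9
    linarith
  have hlogk : 0 ≤ Real.log q.primeFactors.card := Real.log_natCast_nonneg _
  refine ⟨_, _, ?_, hmain.trans ?_, (add_sub_cancel _ _).symm⟩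
  · rw [abs_of_nonneg (by linarith)]
    linarith
  · have : (0 : ℝ) < 2 ^ q.primeFactors.card := by positivity
    refine div_le_div_of_nonneg_right ?_ (by linarith)
    nlinarith
end

section
/- For every integer q ≥ 2 and every real x ≥ √q, Σ_{n ≤ x, gcd(n,q)=1} 2^{ω(n)}/n ≪ (φ(q)/q)²·(log x)², with an absolute implied constant. -/
open Finset in
/-- The products of distinct prime factors of `n` are distinct divisors of `n`. -/
theorem sum_powerset_primeFactors_le_sum_divisors {n : ℕ} (hn : n ≠ 0) {f : ℕ → ℝ}
    (hf : ∀ d, 0 ≤ f d) :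
    ∑ t ∈ n.primeFactors.powerset, f (∏ p ∈ t, p) ≤ ∑ d ∈ n.divisors, f d := by
  have hinj : Set.InjOn (fun t : Finset ℕ => ∏ p ∈ t, p) n.primeFactors.powerset := by
    intro s hs t ht hst
    simp only [coe_powerset, Set.mem_preimage, Set.mem_powerset_iff, coe_subset] at hs ht
    have hs' := Nat.primeFactors_prod fun p hp => Nat.prime_of_mem_primeFactors (hs hp)
    have ht' := Nat.primeFactors_prod fun p hp => Nat.prime_of_mem_primeFactors (ht hp)
    rw [← hs', ← ht']
    exact congrArg Nat.primeFactors hst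
  rw [← sum_image (f := f) hinj]
  refine sum_le_sum_of_subset_of_nonneg ?_ fun d _ _ => hf d
  intro d hd
  obtain ⟨t, ht, rfl⟩ := mem_image.1 hd
  exact Nat.mem_divisors.2
    ⟨(prod_dvd_prod_of_subset _ _ _ (mem_powerset.1 ht)).trans (Nat.prod_primeFactors_dvd n), hn⟩

theorem two_pow_card_primeFactors_le_card_divisors {n : ℕ} (hn : n ≠ 0) :
    (2 : ℝ) ^ n.primeFactors.card ≤ n.divisors.card := by
  simpa using sum_powerset_primeFactors_le_sum_divisors hn (f := fun _ => 1) fun _ => zero_le_one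

theorem prod_primeFactors_one_add_inv_le_sum_divisors_inv {n : ℕ} (hn : n ≠ 0) :
    ∏ p ∈ n.primeFactors, (1 + (p : ℝ)⁻¹) ≤ ∑ d ∈ n.divisors, (d : ℝ)⁻¹ := by
  rw [Finset.prod_one_add]
  simpa [Finset.prod_inv_distrib] using
    sum_powerset_primeFactors_le_sum_divisors hn (f := fun d => (d : ℝ)⁻¹) fun d => by positivity

theorem half_lt_prod_Icc_one_sub_inv_sq (N : ℕ) :
    1 / 2 < ∏ k ∈ Finset.Icc 2 (N + 1), (1 - ((k : ℝ) ^ 2)⁻¹) := by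
  have h : ∏ k ∈ Finset.Icc 2 (N + 1), (1 - ((k : ℝ) ^ 2)⁻¹) = (N + 2) / (2 * (N + 1)) := by
    induction N with
    | zero => simp
    | succ N ih =>
      rw [Finset.prod_Icc_succ_top (by omega), ih]
      push_cast
      field_simp
      ring
  rw [h, div_lt_div_iff₀ (by norm_num) (by positivity)]
  linarith

theorem half_le_prod_one_sub_inv_sq {s : Finset ℕ} (hs : ∀ k ∈ s, 2 ≤ k) :
    1 / 2 ≤ ∏ k ∈ s, (1 - ((k : ℝ) ^ 2)⁻¹) := by
  have hsub : s ⊆ Finset.Icc 2 (s.sup id + 1) := fun k hk =>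
    Finset.mem_Icc.2 ⟨hs k hk, (Finset.le_sup (f := id) hk).trans (Nat.le_succ _)⟩
  refine (half_lt_prod_Icc_one_sub_inv_sq _).le.trans
    (Finset.prod_le_prod_of_subset_of_le_one hsub (fun k hk => ?_) fun k _ _ => ?_)
  · have hk : (1 : ℝ) ≤ k := by exact_mod_cast (by have := (Finset.mem_Icc.1 hk).1; omega : 1 ≤ k)
    exact sub_nonneg.2 (inv_le_one_of_one_le₀ (one_le_pow₀ hk))
  · exact sub_le_self _ (by positivity)

theorem one_le_two_mul_totient_div_mul_sum_divisors_inv {q : ℕ} (hq : q ≠ 0) :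
    1 ≤ 2 * (q.totient / q : ℝ) * ∑ d ∈ q.divisors, (d : ℝ)⁻¹ := by
  have hφ : (q.totient / q : ℝ) = ∏ p ∈ q.primeFactors, (1 - (p : ℝ)⁻¹) := by
    have h := congrArg (Rat.cast : ℚ → ℝ) (Nat.totient_eq_mul_prod_factors q)
    push_cast at h
    rw [h, mul_div_cancel_left₀ _ (Nat.cast_ne_zero.2 hq)]
  have hprod : (q.totient / q : ℝ) * ∏ p ∈ q.primeFactors, (1 + (p : ℝ)⁻¹) =
      ∏ p ∈ q.primeFactors, (1 - ((p : ℝ) ^ 2)⁻¹) := by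
    rw [hφ, ← Finset.prod_mul_distrib]
    refine Finset.prod_congr rfl fun p _ => ?_
    rw [← inv_pow]
    ring
  have hhalf := half_le_prod_one_sub_inv_sq (s := q.primeFactors) fun p hp =>
    (Nat.prime_of_mem_primeFactors hp).two_le
  have hmono := mul_le_mul_of_nonneg_left (prod_primeFactors_one_add_inv_le_sum_divisors_inv hq)
    (show (0 : ℝ) ≤ q.totient / q by positivity)
  linarith

/-- The reciprocals of the divisors of `q` exceeding `x ≥ √q` sum to at most `1`. -/
theorem sum_inv_large_divisors_le_one {q : ℕ} (hq : q ≠ 0) {x : ℝ} (hx : Real.sqrt q ≤ x) :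
    ∑ d ∈ q.divisors with ¬ d ≤ ⌊x⌋₊, (d : ℝ)⁻¹ ≤ 1 := by
  have hq0 : (0 : ℝ) < q := by exact_mod_cast Nat.pos_of_ne_zero hq
  have hs : 0 < Real.sqrt q := Real.sqrt_pos.2 hq0
  have hgt : ∀ d ∈ q.divisors.filter (fun d => ¬ d ≤ ⌊x⌋₊), Real.sqrt q < d := fun d hd =>
    hx.trans_lt ((Nat.floor_lt (hs.le.trans hx)).1 (not_le.1 (Finset.mem_filter.1 hd).2))
  have hcard : (q.divisors.filter (fun d => ¬ d ≤ ⌊x⌋₊)).card ≤ ⌊Real.sqrt q⌋₊ := by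
    rw [← Nat.add_sub_cancel (n := ⌊Real.sqrt q⌋₊) (m := 1), ← Nat.card_Icc]
    refine Finset.card_le_card_of_injOn (fun d => q / d) (fun d hd => ?_) fun a ha b hb hab => ?_
    · have hdq := Nat.dvd_of_mem_divisors (Finset.mem_filter.1 hd).1
      have hlt := hgt d hd
      refine Finset.mem_coe.2 (Finset.mem_Icc.2 ⟨Nat.div_pos (Nat.le_of_dvd (by omega) hdq)
        (Nat.pos_of_dvd_of_pos hdq (by omega)), Nat.le_floor ?_⟩)
      rw [Nat.cast_div hdq (hs.trans hlt).ne', div_le_iff₀ (hs.trans hlt)]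
      nlinarith [Real.mul_self_sqrt hq0.le]
    · exact (Nat.div_eq_iff_eq_of_dvd_dvd hq (Nat.dvd_of_mem_divisors (Finset.mem_filter.1 ha).1)
        (Nat.dvd_of_mem_divisors (Finset.mem_filter.1 hb).1)).1 hab
  calc ∑ d ∈ q.divisors with ¬ d ≤ ⌊x⌋₊, (d : ℝ)⁻¹
      ≤ ∑ d ∈ q.divisors with ¬ d ≤ ⌊x⌋₊, (Real.sqrt q)⁻¹ :=
        Finset.sum_le_sum fun d hd => inv_anti₀ hs (hgt d hd).le
    _ = (q.divisors.filter (fun d => ¬ d ≤ ⌊x⌋₊)).card * (Real.sqrt q)⁻¹ := by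
        rw [Finset.sum_const, nsmul_eq_mul]
    _ ≤ Real.sqrt q * (Real.sqrt q)⁻¹ := by
        gcongr
        exact (Nat.cast_le.2 hcard).trans (Nat.floor_le hs.le)
    _ = 1 := mul_inv_cancel₀ hs.ne'

theorem sum_Icc_inv_le_one_add_log_s12 (N : ℕ) :
    ∑ n ∈ Finset.Icc 1 N, (n : ℝ)⁻¹ ≤ 1 + Real.log N := by
  have h := harmonic_le_one_add_log N
  rw [harmonic_eq_sum_Icc] at h
  push_cast at h
  exact h

/-- `(n, d) ↦ n * d` is injective on `n` coprime to `q` and `d ∣ q`. -/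
theorem sum_coprime_inv_mul_sum_divisors_inv_le (q N : ℕ) :
    (∑ n ∈ Finset.Icc 1 N with Nat.gcd n q = 1, (n : ℝ)⁻¹) *
      ∑ d ∈ q.divisors with d ≤ N, (d : ℝ)⁻¹ ≤ ∑ k ∈ Finset.Icc 1 (N * N), (k : ℝ)⁻¹ := by
  rw [Finset.sum_mul_sum, ← Finset.sum_product']
  have hinj : Set.InjOn (fun z : ℕ × ℕ => z.1 * z.2)
      ((Finset.Icc 1 N).filter (fun n => Nat.gcd n q = 1) ×ˢ
        q.divisors.filter (fun d => d ≤ N) : Finset (ℕ × ℕ)) := by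
    have hgcd : ∀ z ∈ (Finset.Icc 1 N).filter (fun n => Nat.gcd n q = 1) ×ˢ
        q.divisors.filter (fun d => d ≤ N), Nat.gcd (z.1 * z.2) q = z.2 ∧ 0 < z.2 := by
      intro z hz
      simp only [Finset.mem_product, Finset.mem_filter, Finset.mem_Icc, Nat.mem_divisors] at hz
      exact ⟨by rw [Nat.Coprime.gcd_mul_left_cancel _ hz.1.2, Nat.gcd_eq_left hz.2.1.1],
        Nat.pos_of_dvd_of_pos hz.2.1.1 (Nat.pos_of_ne_zero hz.2.1.2)⟩
    intro z hz w hw hzw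
    obtain ⟨hz1, hz2⟩ := hgcd z hz
    obtain ⟨hw1, -⟩ := hgcd w hw
    simp only at hzw
    have h2 : z.2 = w.2 := by rw [← hz1, hzw, hw1]
    rw [← h2] at hzw
    exact Prod.ext (Nat.eq_of_mul_eq_mul_right hz2 hzw) h2
  calc _ = ∑ z ∈ (Finset.Icc 1 N).filter (fun n => Nat.gcd n q = 1) ×ˢ
        q.divisors.filter (fun d => d ≤ N), ((z.1 * z.2 : ℕ) : ℝ)⁻¹ :=
        Finset.sum_congr rfl fun z _ => by rw [Nat.cast_mul, mul_inv]
    _ = ∑ k ∈ ((Finset.Icc 1 N).filter (fun n => Nat.gcd n q = 1) ×ˢ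
        q.divisors.filter (fun d => d ≤ N)).image (fun z : ℕ × ℕ => z.1 * z.2), (k : ℝ)⁻¹ :=
        (Finset.sum_image (f := fun k : ℕ => (k : ℝ)⁻¹) hinj).symm
    _ ≤ _ := by
        refine Finset.sum_le_sum_of_subset_of_nonneg (fun k hk => ?_) fun k _ _ => by positivity
        obtain ⟨z, hz, rfl⟩ := Finset.mem_image.1 hk
        simp only [Finset.mem_product, Finset.mem_filter, Finset.mem_Icc, Nat.mem_divisors] at hz
        exact Finset.mem_Icc.2 ⟨Nat.mul_pos hz.1.1.1
          (Nat.pos_of_dvd_of_pos hz.2.1.1 (Nat.pos_of_ne_zero hz.2.1.2)),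
          Nat.mul_le_mul hz.1.1.2 hz.2.2⟩

theorem sum_coprime_inv_le {q : ℕ} (hq : 2 ≤ q) {x : ℝ} (hx : Real.sqrt q ≤ x) :
    ∑ n ∈ Finset.Icc 1 ⌊x⌋₊ with Nat.gcd n q = 1, (n : ℝ)⁻¹ ≤
      18 * (q.totient / q : ℝ) * Real.log x := by
  have hq0 : q ≠ 0 := by omega
  have hx2 : Real.sqrt 2 ≤ x := (Real.sqrt_le_sqrt (by exact_mod_cast hq)).trans hx
  have hx1 : 1 ≤ x := (Real.one_le_sqrt.2 (by norm_num)).trans hx2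
  have hN : 1 ≤ ⌊x⌋₊ := Nat.le_floor (by simpa using hx1)
  have hlogN : Real.log ⌊x⌋₊ ≤ Real.log x :=
    Real.log_le_log (by exact_mod_cast hN) (Nat.floor_le (by linarith))
  have hlog : 1 ≤ 3 * Real.log x := by
    have h := Real.log_le_log (by positivity) hx2
    rw [Real.log_sqrt (by norm_num)] at h
    linarith [Real.log_two_gt_d9]
  set S := ∑ n ∈ Finset.Icc 1 ⌊x⌋₊ with Nat.gcd n q = 1, (n : ℝ)⁻¹
  have hS0 : 0 ≤ S := Finset.sum_nonneg fun n _ => by positivity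
  have hSle : S ≤ 1 + Real.log x := by
    refine le_trans ?_ ((sum_Icc_inv_le_one_add_log_s12 ⌊x⌋₊).trans (by linarith))
    exact Finset.sum_le_sum_of_subset_of_nonneg (Finset.filter_subset _ _)
      fun n _ _ => by positivity
  have hsmall : S * ∑ d ∈ q.divisors with d ≤ ⌊x⌋₊, (d : ℝ)⁻¹ ≤ 1 + 2 * Real.log x := by
    refine (sum_coprime_inv_mul_sum_divisors_inv_le q ⌊x⌋₊).trans
      ((sum_Icc_inv_le_one_add_log_s12 _).trans ?_)
    have hN0 : ((⌊x⌋₊ : ℕ) : ℝ) ≠ 0 := by exact_mod_cast (by omega : ⌊x⌋₊ ≠ 0)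
    rw [Nat.cast_mul, Real.log_mul hN0 hN0]
    linarith
  have hlarge := mul_le_mul_of_nonneg_left (sum_inv_large_divisors_le_one hq0 hx) hS0
  have hall : S * ∑ d ∈ q.divisors, (d : ℝ)⁻¹ ≤ 9 * Real.log x := by
    rw [← Finset.sum_filter_add_sum_filter_not q.divisors (fun d => d ≤ ⌊x⌋₊), mul_add]
    linarith
  have hφ0 : (0 : ℝ) ≤ 2 * (q.totient / q : ℝ) := by positivity
  calc S ≤ S * (2 * (q.totient / q : ℝ) * ∑ d ∈ q.divisors, (d : ℝ)⁻¹) :=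
        le_mul_of_one_le_right hS0 (one_le_two_mul_totient_div_mul_sum_divisors_inv hq0)
    _ = 2 * (q.totient / q : ℝ) * (S * ∑ d ∈ q.divisors, (d : ℝ)⁻¹) := by ring
    _ ≤ 2 * (q.totient / q : ℝ) * (9 * Real.log x) := mul_le_mul_of_nonneg_left hall hφ0
    _ = 18 * (q.totient / q : ℝ) * Real.log x := by ring

theorem sum_coprime_two_pow_card_primeFactors_div_le_sq (q N : ℕ) :
    ∑ n ∈ Finset.Icc 1 N with Nat.gcd n q = 1, (2 : ℝ) ^ n.primeFactors.card / n ≤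
      (∑ n ∈ Finset.Icc 1 N with Nat.gcd n q = 1, (n : ℝ)⁻¹) ^ 2 := by
  set F := (Finset.Icc 1 N).filter (fun n => Nat.gcd n q = 1) with hF
  have hmem : ∀ n, n ∈ F ↔ (1 ≤ n ∧ n ≤ N) ∧ Nat.gcd n q = 1 := fun n => by simp [hF]
  rw [sq, Finset.sum_mul_sum, ← Finset.sum_product']
  refine le_trans (Finset.sum_le_sum fun n hn => ?_)
    (Finset.sum_fiberwise_le_sum_of_sum_fiber_nonneg (t := F) (g := fun z : ℕ × ℕ => z.1 * z.2)
      fun n _ => Finset.sum_nonneg fun z _ => by positivity)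
  obtain ⟨⟨hn1, hnN⟩, hnq⟩ := (hmem n).1 hn
  have hfactor : ∀ d, d ∣ n → d ∈ F := fun d hd => (hmem d).2
    ⟨⟨Nat.pos_of_dvd_of_pos hd hn1, (Nat.le_of_dvd hn1 hd).trans hnN⟩,
      Nat.Coprime.coprime_dvd_left hd hnq⟩
  have hfiber : (F ×ˢ F).filter (fun z : ℕ × ℕ => z.1 * z.2 = n) = n.divisorsAntidiagonal := by
    ext z
    simp only [Finset.mem_filter, Finset.mem_product, Nat.mem_divisorsAntidiagonal]
    exact ⟨fun h => ⟨h.2, by omega⟩, fun h => ⟨⟨hfactor _ (h.1 ▸ dvd_mul_right _ _),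
      hfactor _ (h.1 ▸ dvd_mul_left _ _)⟩, h.1⟩⟩
  rw [hfiber]
  calc (2 : ℝ) ^ n.primeFactors.card / n ≤ n.divisors.card / n := by
        gcongr
        exact two_pow_card_primeFactors_le_card_divisors (by omega)
    _ = ∑ z ∈ n.divisorsAntidiagonal, (n : ℝ)⁻¹ := by
        rw [Finset.sum_const, nsmul_eq_mul, ← Nat.map_div_right_divisors, Finset.card_map,
          div_eq_mul_inv]
    _ = _ := Finset.sum_congr rfl fun z hz => by
        rw [← (Nat.mem_divisorsAntidiagonal.1 hz).1, Nat.cast_mul, mul_inv]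

/-- Lemma 6 (first part): for `q ≥ 2` and `x ≥ √q`,
`∑_{n ≤ x, (n,q)=1} 2^{ω(n)}/n ≪ (φ(q)/q)² (log x)²` with an absolute implied constant. -/
theorem fourth_moment_coprime_divisor_sum_bound :
    ∃ C : ℝ, 0 < C ∧ ∀ (q : ℕ), 2 ≤ q → ∀ (x : ℝ), Real.sqrt q ≤ x →
      ∑ n ∈ (Finset.Icc 1 ⌊x⌋₊).filter (fun n => Nat.gcd n q = 1),
          (2 : ℝ) ^ n.primeFactors.card / n ≤
        C * (q.totient / q : ℝ) ^ 2 * Real.log x ^ 2 := by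
  refine ⟨324, by norm_num, fun q hq x hx => ?_⟩
  have h := pow_le_pow_left₀ (Finset.sum_nonneg fun n _ => by positivity)
    (sum_coprime_inv_le hq hx) 2
  calc _ ≤ _ := sum_coprime_two_pow_card_primeFactors_div_le_sq q ⌊x⌋₊
    _ ≤ _ := h
    _ = _ := by ring
end

section
/- For every integer q ≥ 2 and every real x ≥ √q, Σ_{n ≤ x, gcd(n,q)=1} (2^{ω(n)}/n)·(log(x/n))² = (1 + O((1 + log ω(q))/log q)) · ((log x)^4/(12·ζ(2))) · Π_{p | q} (1 − 1/p)/(1 + 1/p), with an absolute implied constant. -/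
open ArithmeticFunction in
theorem exists_abs_sum_vonMangoldt_div_sub_log_le :
    ∃ C : ℝ, 0 ≤ C ∧ ∀ N : ℕ, 1 ≤ N →
      |∑ d ∈ Finset.Ioc 0 N, vonMangoldt d / d - Real.log N| ≤ C := by
  refine ⟨Real.log 4 + 4, by positivity, fun N hN => ?_⟩
  have hN0 : (0 : ℝ) < N := by exact_mod_cast hN
  set S := ∑ d ∈ Finset.Ioc 0 N, vonMangoldt d / d with hS
  have hfact : Real.log (N.factorial) =
      ∑ d ∈ Finset.Ioc 0 N, vonMangoldt d * ((N / d : ℕ) : ℝ) := by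
    rw [← sum_Ioc_mul_zeta_eq_sum, vonMangoldt_mul_zeta]
    rw [← Finset.prod_Ico_id_eq_factorial, Nat.cast_prod, Real.log_prod]
    · rfl
    · intro i hi
      simp only [Finset.mem_Ico] at hi
      exact_mod_cast (by omega : i ≠ 0)
  have hpsi : ∑ d ∈ Finset.Ioc 0 N, vonMangoldt d ≤ (Real.log 4 + 4) * N := by
    have := Chebyshev.psi_le_const_mul_self (x := (N : ℝ)) hN0.le
    rwa [Chebyshev.psi, Nat.floor_natCast] at this
  have hlow : N * S - (Real.log 4 + 4) * N ≤ Real.log (N.factorial) := by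
    calc N * S - (Real.log 4 + 4) * N
        ≤ N * S - ∑ d ∈ Finset.Ioc 0 N, vonMangoldt d := by linarith
      _ = ∑ d ∈ Finset.Ioc 0 N, vonMangoldt d * ((N : ℝ) / d - 1) := by
          rw [hS, Finset.mul_sum, ← Finset.sum_sub_distrib]
          exact Finset.sum_congr rfl fun d _ => by ring
      _ ≤ _ := by
          rw [hfact]
          refine Finset.sum_le_sum fun d _ => mul_le_mul_of_nonneg_left ?_ vonMangoldt_nonneg
          have := Nat.lt_floor_add_one ((N : ℝ) / d)
          rw [Nat.floor_div_eq_div] at this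
          linarith
  have hup : Real.log (N.factorial) ≤ N * S := by
    rw [hfact, hS, Finset.mul_sum]
    refine Finset.sum_le_sum fun d _ => ?_
    calc vonMangoldt d * ((N / d : ℕ) : ℝ) ≤ vonMangoldt d * ((N : ℝ) / d) :=
          mul_le_mul_of_nonneg_left Nat.cast_div_le vonMangoldt_nonneg
      _ = _ := by ring
  have hf0 : (0 : ℝ) < N.factorial := by exact_mod_cast N.factorial_pos
  have h1 : Real.log (N.factorial) ≤ N * Real.log N := by
    rw [← Real.log_pow]
    exact Real.log_le_log hf0 (by exact_mod_cast N.factorial_le_pow)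
  have h2 : N * Real.log N - N ≤ Real.log (N.factorial) := by
    have h := Real.pow_div_factorial_le_exp (N : ℝ) hN0.le N
    have h' := Real.log_le_log (by positivity) h
    rw [Real.log_exp, Real.log_div (by positivity) hf0.ne', Real.log_pow] at h'
    linarith
  have h4 : 0 < Real.log 4 := by positivity
  rw [abs_le]
  constructor
  · have : N * (Real.log N - 1) ≤ N * S := by linarith
    have := le_of_mul_le_mul_left this hN0
    linarith
  · have : N * S ≤ N * (Real.log N + (Real.log 4 + 4)) := by linarith
    have := le_of_mul_le_mul_left this hN0
    linarith

theorem hasDerivWithinAt_Ici_max_sub_zero (a x : ℝ) :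
    HasDerivWithinAt (fun v : ℝ => max (v - a) 0) (if a ≤ x then 1 else 0) (Set.Ici x) x := by
  split_ifs with h
  · refine ((hasDerivAt_id x).sub_const a).hasDerivWithinAt.congr_of_mem ?_ Set.self_mem_Ici
    intro v hv
    simp only [Set.mem_Ici] at hv
    exact max_eq_left (by linarith)
  · refine (HasDerivAt.congr_of_eventuallyEq (hasDerivAt_const x (0 : ℝ)) ?_).hasDerivWithinAt
    filter_upwards [Iio_mem_nhds (not_le.mp h)] with v hv
    exact max_eq_right (by simp only [Set.mem_Iio] at hv; linarith)

open ArithmeticFunction in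
theorem exists_abs_sum_vonMangoldt_div_mul_max_sub_le :
    ∃ C : ℝ, 0 ≤ C ∧ ∀ (u : ℝ) (N : ℕ), Real.exp u < N + 1 →
      |∑ d ∈ Finset.Ioc 0 N, vonMangoldt d / d * max (u - Real.log d) 0 - max u 0 ^ 2 / 2|
        ≤ C * max u 0 := by
  obtain ⟨C, hC, hM⟩ := exists_abs_sum_vonMangoldt_div_sub_log_le
  refine ⟨C + 1, by linarith, fun u N huN => ?_⟩
  rcases le_or_gt u 0 with hu | hu
  · rw [max_eq_right hu, Finset.sum_eq_zero]
    · simp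
    · intro d _
      rw [max_eq_right (by linarith [Real.log_natCast_nonneg d]), mul_zero]
  rw [max_eq_left hu.le]
  have key := image_norm_le_of_norm_deriv_right_le_deriv_boundary (a := 0) (b := u)
    (f := fun v => ∑ d ∈ Finset.Ioc 0 N, vonMangoldt d / d * max (v - Real.log d) 0 - v ^ 2 / 2)
    (f' := fun v => ∑ d ∈ Finset.Ioc 0 N,
      vonMangoldt d / d * (if Real.log d ≤ v then 1 else 0) - v)
    (B := fun v => (C + 1) * v) (B' := fun _ => C + 1) (by fun_prop) ?_ ?_ ?_ ?_
    (Set.right_mem_Icc.mpr hu.le)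
  · simpa using key
  · intro v _
    refine HasDerivWithinAt.sub (HasDerivWithinAt.fun_sum fun d _ =>
      (hasDerivWithinAt_Ici_max_sub_zero _ v).const_mul _) ?_
    have := ((hasDerivAt_pow 2 v).div_const 2).hasDerivWithinAt (s := Set.Ici v)
    simpa using this
  · simp only [mul_zero]
    rw [Finset.sum_eq_zero]
    · simp
    · intro d _
      rw [max_eq_right (by linarith [Real.log_natCast_nonneg d]), mul_zero]
  · intro v
    simpa using (hasDerivAt_id v).const_mul (C + 1)
  · intro v hv
    have h1 : 1 ≤ Real.exp v := Real.one_le_exp hv.1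
    have hfl : 1 ≤ ⌊Real.exp v⌋₊ := Nat.one_le_floor_iff _ |>.mpr h1
    have hsum : ∑ d ∈ Finset.Ioc 0 N, vonMangoldt d / d * (if Real.log d ≤ v then (1 : ℝ) else 0)
        = ∑ d ∈ Finset.Ioc 0 ⌊Real.exp v⌋₊, vonMangoldt d / d := by
      simp_rw [mul_ite, mul_one, mul_zero]
      rw [← Finset.sum_filter]
      refine Finset.sum_congr ?_ fun _ _ => rfl
      ext d
      simp only [Finset.mem_filter, Finset.mem_Ioc, Nat.le_floor_iff (Real.exp_pos v).le]
      constructor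
      · rintro ⟨⟨hd, -⟩, h⟩
        exact ⟨hd, (Real.log_le_iff_le_exp (by exact_mod_cast hd)).mp h⟩
      · rintro ⟨hd, h⟩
        refine ⟨⟨hd, ?_⟩, (Real.log_le_iff_le_exp (by exact_mod_cast hd)).mpr h⟩
        have : (d : ℝ) < N + 1 := h.trans_lt ((Real.exp_lt_exp.mpr hv.2).trans huN)
        exact Nat.lt_succ_iff.mp (by exact_mod_cast this)
    rw [hsum, Real.norm_eq_abs]
    have hfl0 : (0 : ℝ) < ⌊Real.exp v⌋₊ := by exact_mod_cast hfl
    have ha : Real.log ⌊Real.exp v⌋₊ ≤ v :=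
      (Real.log_le_iff_le_exp hfl0).mpr (Nat.floor_le (Real.exp_pos v).le)
    have hb : v - 1 ≤ Real.log ⌊Real.exp v⌋₊ := by
      rw [Real.le_log_iff_exp_le hfl0, Real.exp_sub, div_le_iff₀ (Real.exp_pos 1)]
      have h3 := Nat.lt_floor_add_one (Real.exp v)
      have h4 : (1 : ℝ) ≤ ⌊Real.exp v⌋₊ := by exact_mod_cast hfl
      nlinarith [Real.add_one_le_exp (1 : ℝ)]
    have := abs_le.mp (hM _ hfl)
    rw [abs_le]
    constructor <;> linarith [this.1, this.2]

open ArithmeticFunction in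
theorem exists_sum_vonMangoldt_div_not_prime_le :
    ∃ B : ℝ, 0 ≤ B ∧ ∀ N : ℕ,
      ∑ d ∈ Finset.Ioc 0 N, (if d.Prime then 0 else vonMangoldt d / d) ≤ B := by
  have hs := vonMangoldt.summable_residueClass_non_primes_div (q := 1) 0
  have h0 : ∀ n : ℕ, 0 ≤ (if n.Prime then 0 else vonMangoldt.residueClass (0 : ZMod 1) n) / n := by
    intro n
    have := vonMangoldt.residueClass_nonneg (0 : ZMod 1) n
    split_ifs <;> positivity
  refine ⟨_, tsum_nonneg (L := .unconditional ℕ) h0, fun N => ?_⟩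
  refine le_trans (Finset.sum_le_sum fun d _ => ?_) (hs.sum_le_tsum (Finset.Ioc 0 N) fun n _ => h0 n)
  have : vonMangoldt.residueClass (0 : ZMod 1) d = vonMangoldt d :=
    Set.indicator_of_mem (show d ∈ {n : ℕ | (n : ZMod 1) = 0} from Subsingleton.elim _ _) _
  rw [this]
  split_ifs <;> simp

open ArithmeticFunction in
theorem exists_sum_vonMangoldt_div_sq_le :
    ∃ B : ℝ, 0 ≤ B ∧ ∀ N : ℕ,
      ∑ d ∈ Finset.Ioc 0 N, vonMangoldt d / (d : ℝ) ^ 2 ≤ B := by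
  have h0 : ∀ n : ℕ, 0 ≤ vonMangoldt n / (n : ℝ) ^ 2 := fun n => by
    have := vonMangoldt_nonneg (n := n)
    positivity
  have hs : Summable fun n : ℕ => vonMangoldt n / (n : ℝ) ^ 2 := by
    refine Summable.of_nonneg_of_le h0 (fun n => ?_)
      ((Real.summable_nat_rpow_inv.mpr (by norm_num : (1 : ℝ) < 3 / 2)).mul_left 2)
    rcases n.eq_zero_or_pos with rfl | hn
    · simp
    have hn' : (0 : ℝ) < n := by exact_mod_cast hn
    have h1 := Real.log_le_rpow_div hn'.le (by norm_num : (0 : ℝ) < 1 / 2)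
    have h2 : (n : ℝ) ^ (2 : ℕ) = (n : ℝ) ^ (1 / 2 : ℝ) * (n : ℝ) ^ (3 / 2 : ℝ) := by
      rw [← Real.rpow_add hn']
      norm_num
    rw [div_le_iff₀ (by positivity), h2]
    calc vonMangoldt n ≤ Real.log n := vonMangoldt_le_log
      _ ≤ (n : ℝ) ^ (1 / 2 : ℝ) / (1 / 2) := h1
      _ = _ := by field_simp
  exact ⟨_, tsum_nonneg h0, fun N => hs.sum_le_tsum _ fun n _ => h0 n⟩

theorem one_le_card_primeFactors {q : ℕ} (hq : 2 ≤ q) : 1 ≤ q.primeFactors.card :=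
  Finset.card_pos.mpr (Nat.nonempty_primeFactors.mpr hq)

open ArithmeticFunction in
theorem exists_sum_primeFactors_log_div_le :
    ∃ C : ℝ, 0 ≤ C ∧ ∀ q : ℕ, 2 ≤ q →
      ∑ p ∈ q.primeFactors, Real.log p / p ≤ C * (1 + Real.log q.primeFactors.card) := by
  obtain ⟨C, hC, hM⟩ := exists_abs_sum_vonMangoldt_div_sub_log_le
  refine ⟨C + 2, by linarith, fun q hq => ?_⟩
  set w := q.primeFactors.card with hw
  have hw1 : 1 ≤ w := one_le_card_primeFactors hq
  have hwr : (1 : ℝ) ≤ w := by exact_mod_cast hw1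
  have hlw : 0 ≤ Real.log w := Real.log_nonneg hwr
  rw [← Finset.sum_filter_add_sum_filter_not _ (· ≤ w)]
  have h1 : ∑ p ∈ q.primeFactors with p ≤ w, Real.log p / p ≤ Real.log w + C := by
    calc ∑ p ∈ q.primeFactors with p ≤ w, Real.log p / p
        = ∑ p ∈ q.primeFactors with p ≤ w, vonMangoldt p / p := by
          refine Finset.sum_congr rfl fun p hp => ?_
          rw [vonMangoldt_apply_prime]
          exact Nat.prime_of_mem_primeFactors (Finset.mem_filter.mp hp).1
      _ ≤ ∑ p ∈ Finset.Ioc 0 w, vonMangoldt p / p := by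
          refine Finset.sum_le_sum_of_subset_of_nonneg ?_ fun n _ _ => ?_
          · intro p hp
            simp only [Finset.mem_filter] at hp
            exact Finset.mem_Ioc.mpr ⟨(Nat.prime_of_mem_primeFactors hp.1).pos, hp.2⟩
          · have := vonMangoldt_nonneg (n := n)
            positivity
      _ ≤ _ := by linarith [(abs_le.mp (hM w hw1)).2]
  have h2 : ∑ p ∈ q.primeFactors with ¬ p ≤ w, Real.log p / p ≤ 1 + Real.log w := by
    calc ∑ p ∈ q.primeFactors with ¬ p ≤ w, Real.log p / p
        ≤ ∑ p ∈ q.primeFactors with ¬ p ≤ w, (1 + Real.log w) / w := by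
          refine Finset.sum_le_sum fun p hp => ?_
          have hpw : (w : ℝ) < p := by
            exact_mod_cast not_le.mp (Finset.mem_filter.mp hp).2
          have hw0 : (0 : ℝ) < w := by linarith
          have hp0 : (0 : ℝ) < p := by linarith
          have e1 : Real.log p = Real.log (p / w) + Real.log w := by
            rw [Real.log_div hp0.ne' hw0.ne']; ring
          have e2 : Real.log (p / w) ≤ p / w :=
            (Real.log_le_sub_one_of_pos (by positivity)).trans (by linarith)
          have e3 : Real.log w / p ≤ Real.log w / w := by gcongr
          calc Real.log p / p = Real.log (p / w) / p + Real.log w / p := by rw [e1]; ring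
            _ ≤ (p / w) / p + Real.log w / w := by gcongr
            _ = (1 + Real.log w) / w := by field_simp
      _ ≤ ∑ p ∈ q.primeFactors, (1 + Real.log w) / w :=
          Finset.sum_le_sum_of_subset_of_nonneg (Finset.filter_subset _ _)
            fun _ _ _ => by positivity
      _ = 1 + Real.log w := by
          rw [Finset.sum_const, ← hw, nsmul_eq_mul]
          field_simp
  nlinarith

/-- The function `n ↦ 2 ^ ω(n)` restricted to the integers coprime to `q`. -/
noncomputable def coprimeTwoPowOmega (q n : ℕ) : ℝ :=
  if n.gcd q = 1 then 2 ^ n.primeFactors.card else 0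

theorem coprimeTwoPowOmega_nonneg (q n : ℕ) : 0 ≤ coprimeTwoPowOmega q n := by
  unfold coprimeTwoPowOmega
  split_ifs <;> positivity

theorem coprimeTwoPowOmega_mul_le {q d m : ℕ} (hd : IsPrimePow d) (hm : m ≠ 0) :
    coprimeTwoPowOmega q (d * m) ≤ 2 * coprimeTwoPowOmega q m := by
  unfold coprimeTwoPowOmega
  by_cases h : (d * m).gcd q = 1
  · have hmq : m.gcd q = 1 := Nat.Coprime.coprime_mul_left h
    rw [if_pos h, if_pos hmq, ← pow_succ']
    refine pow_le_pow_right₀ one_le_two ?_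
    rw [Nat.primeFactors_mul hd.ne_zero hm]
    obtain ⟨p, k, hp, hk, rfl⟩ := (isPrimePow_nat_iff d).mp hd
    rw [Nat.primeFactors_prime_pow hk.ne' hp]
    refine (Finset.card_union_le _ _).trans ?_
    rw [Finset.card_singleton, add_comm]
  · rw [if_neg h]
    split_ifs <;> positivity

theorem coprimeTwoPowOmega_prime_mul {q p m : ℕ} (hp : p.Prime) (hm : m ≠ 0) (hpq : ¬ p ∣ q)
    (hpm : ¬ p ∣ m) : coprimeTwoPowOmega q (p * m) = 2 * coprimeTwoPowOmega q m := by
  unfold coprimeTwoPowOmega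
  have h : (p * m).gcd q = 1 ↔ m.gcd q = 1 := by
    have := (Nat.Prime.coprime_iff_not_dvd hp).mpr hpq
    exact ⟨fun h => Nat.Coprime.coprime_mul_left h, fun h => Nat.Coprime.mul_left this h⟩
  simp only [h]
  split_ifs
  · rw [← pow_succ', Nat.primeFactors_mul hp.ne_zero hm, hp.primeFactors,
      Finset.card_union_of_disjoint, Finset.card_singleton, add_comm]
    simpa using fun _ => fun h => (hpm h).elim
  · simp

open ArithmeticFunction in
theorem sum_mul_log_eq_sum_sum_vonMangoldt (F : ℕ → ℝ) (N : ℕ) (hF : ∀ n, N < n → F n = 0) :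
    ∑ n ∈ Finset.Ioc 0 N, F n * Real.log n =
      ∑ d ∈ Finset.Ioc 0 N, ∑ m ∈ Finset.Ioc 0 N, vonMangoldt d * F (d * m) := by
  have h1 : ∀ n ∈ Finset.Ioc 0 N, F n * Real.log n =
      ∑ x ∈ Finset.Ioc 0 N ×ˢ Finset.Ioc 0 N,
        if x.1 * x.2 = n then vonMangoldt x.1 * F (x.1 * x.2) else 0 := by
    intro n hn
    rw [Finset.mem_Ioc] at hn
    rw [← Finset.sum_filter, ← Nat.divisorsAntidiagonal_eq_prod_filter_of_le hn.1.ne' hn.2,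
      ← vonMangoldt_sum, Finset.mul_sum, Nat.sum_divisorsAntidiagonal
        (fun i j => vonMangoldt i * F (i * j))]
    refine Finset.sum_congr rfl fun d hd => ?_
    rw [Nat.mul_div_cancel' (Nat.dvd_of_mem_divisors hd), mul_comm]
  rw [Finset.sum_congr rfl h1, Finset.sum_comm, Finset.sum_product]
  refine Finset.sum_congr rfl fun d hd => Finset.sum_congr rfl fun m hm => ?_
  rw [Finset.mem_Ioc] at hd hm
  rw [Finset.sum_ite_eq]
  split_ifs with h
  · rfl
  · rw [hF, mul_zero]
    rw [Finset.mem_Ioc] at h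
    exact not_le.mp fun hle => h ⟨Nat.mul_pos hd.1 hm.1, hle⟩

theorem max_sub_log_mul_le {d m : ℕ} (hd : d ≠ 0) (hm : m ≠ 0) (u : ℝ) :
    max (u - Real.log ((d * m : ℕ) : ℝ)) 0 ≤ max (u - Real.log m) 0 := by
  have h : Real.log m ≤ Real.log ((d * m : ℕ) : ℝ) := by
    refine Real.log_le_log (by positivity) ?_
    exact_mod_cast Nat.le_mul_of_pos_left m (Nat.pos_of_ne_zero hd)
  exact max_le_max_right 0 (by linarith)

theorem sum_dvd_coprimeTwoPowOmega_le {q p N : ℕ} (hp : p.Prime) (u : ℝ) :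
    ∑ m ∈ Finset.Ioc 0 N, (if p ∣ m then
        coprimeTwoPowOmega q m / m * max (u - Real.log m) 0 else 0) ≤
      2 / p * ∑ m ∈ Finset.Ioc 0 N, coprimeTwoPowOmega q m / m * max (u - Real.log m) 0 := by
  have h0 : ∀ m : ℕ, 0 ≤ coprimeTwoPowOmega q m / m * max (u - Real.log m) 0 := fun m =>
    mul_nonneg (div_nonneg (coprimeTwoPowOmega_nonneg q m) m.cast_nonneg) (le_max_right _ _)
  rw [← Finset.sum_filter]
  calc _ ≤ ∑ m ∈ (Finset.Ioc 0 N).image (p * ·),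
        coprimeTwoPowOmega q m / m * max (u - Real.log m) 0 := by
        refine Finset.sum_le_sum_of_subset_of_nonneg ?_ fun m _ _ => h0 m
        intro m hm
        rw [Finset.mem_filter, Finset.mem_Ioc] at hm
        obtain ⟨⟨hm0, hmN⟩, k, rfl⟩ := hm
        refine Finset.mem_image.mpr ⟨k, Finset.mem_Ioc.mpr ⟨Nat.pos_of_mul_pos_left hm0, ?_⟩, rfl⟩
        exact (Nat.le_mul_of_pos_left k hp.pos).trans hmN
    _ = ∑ k ∈ Finset.Ioc 0 N, coprimeTwoPowOmega q (p * k) / (p * k : ℕ) *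
          max (u - Real.log ((p * k : ℕ) : ℝ)) 0 :=
        Finset.sum_image fun a _ b _ h => Nat.eq_of_mul_eq_mul_left hp.pos h
    _ ≤ _ := by
        rw [Finset.mul_sum]
        refine Finset.sum_le_sum fun k hk => ?_
        have hk0 : k ≠ 0 := (Finset.mem_Ioc.mp hk).1.ne'
        have hp0 : (0 : ℝ) < p := by exact_mod_cast hp.pos
        have hk0' : (0 : ℝ) < k := by exact_mod_cast Nat.pos_of_ne_zero hk0
        calc _ ≤ (2 * coprimeTwoPowOmega q k) / (p * k : ℕ) * max (u - Real.log k) 0 := by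
              refine mul_le_mul ?_ (max_sub_log_mul_le hp.ne_zero hk0 u) (le_max_right _ _) ?_
              · exact div_le_div_of_nonneg_right
                  (coprimeTwoPowOmega_mul_le hp.isPrimePow hk0) (Nat.cast_nonneg _)
              · have := coprimeTwoPowOmega_nonneg q k
                positivity
          _ = _ := by
              push_cast
              field_simp

open ArithmeticFunction in
theorem vonMangoldt_mul_defect_le {q d m : ℕ} (hd : d ≠ 0) (hm : m ≠ 0) (u : ℝ) :
    0 ≤ vonMangoldt d * (2 * coprimeTwoPowOmega q m - coprimeTwoPowOmega q (d * m)) /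
        (d * m : ℕ) * max (u - Real.log ((d * m : ℕ) : ℝ)) 0 ∧
    vonMangoldt d * (2 * coprimeTwoPowOmega q m - coprimeTwoPowOmega q (d * m)) /
        (d * m : ℕ) * max (u - Real.log ((d * m : ℕ) : ℝ)) 0 ≤
      2 * (((if d.Prime then 0 else vonMangoldt d / d) +
        (if d.Prime ∧ d ∣ q then vonMangoldt d / d else 0)) *
        (coprimeTwoPowOmega q m / m * max (u - Real.log m) 0)) +
      2 * ((if d.Prime then vonMangoldt d / d else 0) *
        (if d ∣ m then coprimeTwoPowOmega q m / m * max (u - Real.log m) 0 else 0)) := by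
  have hL := vonMangoldt_nonneg (n := d)
  have hf := coprimeTwoPowOmega_nonneg q m
  have hf' := coprimeTwoPowOmega_nonneg q (d * m)
  have hr := max_sub_log_mul_le hd hm u
  have hr0 : 0 ≤ max (u - Real.log ((d * m : ℕ) : ℝ)) 0 := le_max_right _ _
  have hr1 : 0 ≤ max (u - Real.log m) 0 := le_max_right _ _
  have hd0 : (0 : ℝ) < d := by exact_mod_cast Nat.pos_of_ne_zero hd
  have hm0 : (0 : ℝ) < m := by exact_mod_cast Nat.pos_of_ne_zero hm
  have hnum : 0 ≤ vonMangoldt d * (2 * coprimeTwoPowOmega q m - coprimeTwoPowOmega q (d * m)) := by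
    by_cases h : IsPrimePow d
    · exact mul_nonneg hL (by linarith [coprimeTwoPowOmega_mul_le (q := q) h hm])
    · rw [vonMangoldt_eq_zero_iff.mpr h, zero_mul]
  refine ⟨by positivity, ?_⟩
  have hmain : vonMangoldt d * (2 * coprimeTwoPowOmega q m - coprimeTwoPowOmega q (d * m)) /
        (d * m : ℕ) * max (u - Real.log ((d * m : ℕ) : ℝ)) 0 ≤
      2 * (vonMangoldt d / d * (coprimeTwoPowOmega q m / m * max (u - Real.log m) 0)) := by
    calc _ ≤ vonMangoldt d * (2 * coprimeTwoPowOmega q m) / (d * m : ℕ) *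
            max (u - Real.log m) 0 := by
          refine mul_le_mul ?_ hr hr0 (by positivity)
          refine div_le_div_of_nonneg_right ?_ (Nat.cast_nonneg _)
          exact mul_le_mul_of_nonneg_left (by linarith) hL
      _ = _ := by
          push_cast
          field_simp
  by_cases hp : d.Prime
  · by_cases hq : d ∣ q
    · simp only [hp, hq, and_self, if_true, zero_add]
      refine hmain.trans (le_add_of_nonneg_right ?_)
      split_ifs <;> positivity
    · by_cases hdm : d ∣ m
      · simpa only [hp, hq, hdm, and_false, if_true, if_false, zero_add, add_zero, zero_mul,
          mul_zero] using hmain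
      · rw [coprimeTwoPowOmega_prime_mul hp hm hq hdm]
        simp [hq, hdm, hp]
  · simpa [hp] using hmain

open ArithmeticFunction in
/-- The differential inequality behind the asymptotics of the logarithmically weighted means of
`coprimeTwoPowOmega q`. -/
theorem exists_abs_mul_sum_sub_two_mul_sum_le :
    ∃ K : ℝ, 1 ≤ K ∧ ∀ q : ℕ, 2 ≤ q → ∀ (u : ℝ) (N : ℕ), Real.exp u < N + 1 →
      |u * ∑ n ∈ Finset.Ioc 0 N, coprimeTwoPowOmega q n / n * max (u - Real.log n) 0 -
        2 * ∑ n ∈ Finset.Ioc 0 N, coprimeTwoPowOmega q n / n * max (u - Real.log n) 0 ^ 2| ≤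
      K * (1 + Real.log q.primeFactors.card) *
        ∑ n ∈ Finset.Ioc 0 N, coprimeTwoPowOmega q n / n * max (u - Real.log n) 0 := by
  obtain ⟨C, hC, hM⟩ := exists_abs_sum_vonMangoldt_div_mul_max_sub_le
  obtain ⟨B, hB, hnp⟩ := exists_sum_vonMangoldt_div_not_prime_le
  obtain ⟨B', hB', hsq⟩ := exists_sum_vonMangoldt_div_sq_le
  obtain ⟨A, hA, hdiv⟩ := exists_sum_primeFactors_log_div_le
  refine ⟨1 + 2 * C + 2 * B + 4 * B' + 2 * A, by linarith, fun q hq u N huN => ?_⟩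
  set f := coprimeTwoPowOmega q with hf
  set L := 1 + Real.log q.primeFactors.card with hL
  have hL1 : 1 ≤ L := by
    have : (1 : ℝ) ≤ q.primeFactors.card := by exact_mod_cast one_le_card_primeFactors hq
    linarith [Real.log_nonneg this]
  set G1 := ∑ n ∈ Finset.Ioc 0 N, f n / n * max (u - Real.log n) 0 with hG1
  set G2 := ∑ n ∈ Finset.Ioc 0 N, f n / n * max (u - Real.log n) 0 ^ 2 with hG2
  have hf0 : ∀ n, 0 ≤ f n := coprimeTwoPowOmega_nonneg q
  have h0 : ∀ m : ℕ, 0 ≤ f m / m * max (u - Real.log m) 0 := fun m =>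
    mul_nonneg (div_nonneg (hf0 m) m.cast_nonneg) (le_max_right _ _)
  have hG1' : 0 ≤ G1 := Finset.sum_nonneg fun m _ => h0 m
  have hvan : ∀ n : ℕ, N < n → max (u - Real.log n) 0 = 0 := by
    intro n hn
    refine max_eq_right (sub_nonpos.mpr ?_)
    have hn1 : (N : ℝ) + 1 ≤ n := by exact_mod_cast hn
    rw [Real.le_log_iff_exp_le (by linarith [Real.exp_pos u])]
    linarith
  have hT := sum_mul_log_eq_sum_sum_vonMangoldt
    (fun n => f n / n * max (u - Real.log n) 0) N (fun n hn => by simp [hvan n hn])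
  have hT' : ∑ n ∈ Finset.Ioc 0 N, f n / n * max (u - Real.log n) 0 * Real.log n
      = u * G1 - G2 := by
    rw [hG1, hG2, Finset.mul_sum, ← Finset.sum_sub_distrib]
    refine Finset.sum_congr rfl fun n _ => ?_
    rcases le_total (u - Real.log n) 0 with h | h
    · rw [max_eq_right h]; ring
    · rw [max_eq_left h]; ring
  rw [hT'] at hT
  set M := ∑ d ∈ Finset.Ioc 0 N, ∑ m ∈ Finset.Ioc 0 N,
    vonMangoldt d * (2 * f m) / (d * m : ℕ) * max (u - Real.log ((d * m : ℕ) : ℝ)) 0 with hMdef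
  have hMG : |M - G2| ≤ 2 * C * G1 := by
    have : M - G2 = ∑ m ∈ Finset.Ioc 0 N, 2 * (f m / m) *
        (∑ d ∈ Finset.Ioc 0 N, vonMangoldt d / d * max (u - Real.log m - Real.log d) 0 -
          max (u - Real.log m) 0 ^ 2 / 2) := by
      rw [hMdef, Finset.sum_comm, hG2, ← Finset.sum_sub_distrib]
      refine Finset.sum_congr rfl fun m hm => ?_
      rw [mul_sub, Finset.mul_sum]
      congr 1
      · refine Finset.sum_congr rfl fun d hd => ?_
        have hd0 : (d : ℝ) ≠ 0 := by exact_mod_cast (Finset.mem_Ioc.mp hd).1.ne'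
        have hm0 : (m : ℝ) ≠ 0 := by exact_mod_cast (Finset.mem_Ioc.mp hm).1.ne'
        rw [Nat.cast_mul, Real.log_mul hd0 hm0,
          show u - (Real.log d + Real.log m) = u - Real.log m - Real.log d by ring]
        field_simp
      · ring
    rw [this, hG1, Finset.mul_sum]
    refine (Finset.abs_sum_le_sum_abs _ _).trans (Finset.sum_le_sum fun m hm => ?_)
    have hfm : 0 ≤ f m / m := div_nonneg (hf0 m) m.cast_nonneg
    rw [abs_mul, abs_of_nonneg (by positivity)]
    have hexp : Real.exp (u - Real.log m) < N + 1 :=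
      (Real.exp_le_exp.mpr (by linarith [Real.log_natCast_nonneg m])).trans_lt huN
    calc _ ≤ 2 * (f m / m) * (C * max (u - Real.log m) 0) :=
          mul_le_mul_of_nonneg_left (hM _ N hexp) (by positivity)
      _ = _ := by ring
  have hE : M - (u * G1 - G2) = ∑ d ∈ Finset.Ioc 0 N, ∑ m ∈ Finset.Ioc 0 N,
      vonMangoldt d * (2 * f m - f (d * m)) / (d * m : ℕ) *
        max (u - Real.log ((d * m : ℕ) : ℝ)) 0 := by
    rw [hT, hMdef, ← Finset.sum_sub_distrib]
    refine Finset.sum_congr rfl fun d _ => ?_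
    rw [← Finset.sum_sub_distrib]
    refine Finset.sum_congr rfl fun m _ => ?_
    ring
  have hE0 : 0 ≤ M - (u * G1 - G2) := by
    rw [hE]
    refine Finset.sum_nonneg fun d hd => Finset.sum_nonneg fun m hm => ?_
    exact (vonMangoldt_mul_defect_le (Finset.mem_Ioc.mp hd).1.ne'
      (Finset.mem_Ioc.mp hm).1.ne' u).1
  have hdq : ∑ d ∈ Finset.Ioc 0 N, (if d.Prime ∧ d ∣ q then vonMangoldt d / d else 0) ≤ A * L := by
    refine le_trans ?_ (hdiv q hq)
    rw [← Finset.sum_filter]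
    calc _ = ∑ d ∈ Finset.Ioc 0 N with d.Prime ∧ d ∣ q, Real.log d / d := by
          refine Finset.sum_congr rfl fun d hd => ?_
          rw [vonMangoldt_apply_prime (Finset.mem_filter.mp hd).2.1]
      _ ≤ _ := by
          refine Finset.sum_le_sum_of_subset_of_nonneg (fun d hd => ?_) fun n _ _ =>
            div_nonneg (Real.log_natCast_nonneg n) n.cast_nonneg
          have := (Finset.mem_filter.mp hd).2
          exact Nat.mem_primeFactors.mpr ⟨this.1, this.2, by omega⟩
  have hE1 : M - (u * G1 - G2) ≤ 2 * ((B + A * L) * G1) + 4 * B' * G1 := by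
    rw [hE]
    calc _ ≤ ∑ d ∈ Finset.Ioc 0 N, ∑ m ∈ Finset.Ioc 0 N,
          (2 * (((if d.Prime then 0 else vonMangoldt d / d) +
            (if d.Prime ∧ d ∣ q then vonMangoldt d / d else 0)) *
            (f m / m * max (u - Real.log m) 0)) +
          2 * ((if d.Prime then vonMangoldt d / d else 0) *
            (if d ∣ m then f m / m * max (u - Real.log m) 0 else 0))) := by
          refine Finset.sum_le_sum fun d hd => Finset.sum_le_sum fun m hm => ?_
          exact (vonMangoldt_mul_defect_le (Finset.mem_Ioc.mp hd).1.ne'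
            (Finset.mem_Ioc.mp hm).1.ne' u).2
      _ = ∑ d ∈ Finset.Ioc 0 N,
          (2 * (((if d.Prime then 0 else vonMangoldt d / d) +
            (if d.Prime ∧ d ∣ q then vonMangoldt d / d else 0)) * G1) +
          2 * ((if d.Prime then vonMangoldt d / d else 0) * ∑ m ∈ Finset.Ioc 0 N,
            (if d ∣ m then f m / m * max (u - Real.log m) 0 else 0))) := by
          simp only [Finset.sum_add_distrib, Finset.mul_sum, hG1]
      _ ≤ ∑ d ∈ Finset.Ioc 0 N,
          (2 * (((if d.Prime then 0 else vonMangoldt d / d) +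
            (if d.Prime ∧ d ∣ q then vonMangoldt d / d else 0)) * G1) +
          4 * (vonMangoldt d / (d : ℝ) ^ 2) * G1) := by
          refine Finset.sum_le_sum fun d hd => add_le_add_right ?_ _
          have hv := vonMangoldt_nonneg (n := d)
          split_ifs with hp
          · calc _ ≤ 2 * (vonMangoldt d / d * (2 / d * G1)) := by
                  have := sum_dvd_coprimeTwoPowOmega_le (q := q) (N := N) hp u
                  gcongr
              _ = _ := by ring
          · rw [zero_mul, mul_zero]
            positivity
      _ = 2 * ((∑ d ∈ Finset.Ioc 0 N, (if d.Prime then 0 else vonMangoldt d / d) +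
            ∑ d ∈ Finset.Ioc 0 N, (if d.Prime ∧ d ∣ q then vonMangoldt d / d else 0)) * G1) +
          4 * (∑ d ∈ Finset.Ioc 0 N, vonMangoldt d / (d : ℝ) ^ 2) * G1 := by
          simp only [Finset.sum_add_distrib, Finset.mul_sum, Finset.sum_mul, add_mul, mul_add]
      _ ≤ _ := by
          have e1 := hnp N
          have e2 := hsq N
          gcongr
  have hbound : u * G1 - 2 * G2 = (M - G2) - (M - (u * G1 - G2)) := by ring
  have hM2 := abs_le.mp hMG
  have hLG : G1 ≤ L * G1 := le_mul_of_one_le_left hG1' hL1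
  have p1 : C * G1 ≤ C * (L * G1) := by gcongr
  have p2 : B * G1 ≤ B * (L * G1) := by gcongr
  have p3 : B' * G1 ≤ B' * (L * G1) := by gcongr
  have q1 : 0 ≤ B * (L * G1) := by positivity
  have q2 : 0 ≤ B' * (L * G1) := by positivity
  have q3 : 0 ≤ A * (L * G1) := by positivity
  have q4 : 0 ≤ L * G1 := by positivity
  rw [hbound, abs_le]
  constructor <;> nlinarith [hM2.1, hM2.2]

open Filter Topology in
/-- If `D` is the derivative of `g` and `u D = 4 g + O(κ D)`, then `g` is asymptotic to a
multiple of `u ^ 4`, with relative error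
`O(κ / u)`. -/
theorem exists_tendsto_div_pow_four_of_hasDerivAt {g D : ℝ → ℝ} {κ : ℝ} (hκ : 0 < κ)
    (hg : ∀ u, 0 < u → HasDerivAt g (D u) u) (hD : ∀ u, 0 < u → 0 ≤ D u)
    (hpos : ∀ u, 0 < u → 0 < g u) (h : ∀ u, 0 < u → |u * D u - 4 * g u| ≤ κ * D u) :
    ∃ c : ℝ, 0 < c ∧ Tendsto (fun u => g u / u ^ 4) atTop (𝓝 c) ∧
      ∀ u, 2 * κ ≤ u → |g u - c * u ^ 4| ≤ 8 * Real.exp 4 * (κ / u) * (c * u ^ 4) := by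
  have hder : ∀ u, 2 * κ ≤ u → |D u / g u - 4 / u| ≤ 8 * κ / u ^ 2 := by
    intro u hu
    have hu0 : 0 < u := by linarith
    have hgu := hpos u hu0
    have hDu := hD u hu0
    have h1 := h u hu0
    have h2 := (abs_le.mp h1).2
    have h3 : u * D u ≤ 8 * g u := by nlinarith
    have h4 : D u / g u - 4 / u = (u * D u - 4 * g u) / (u * g u) := by
      field_simp
    rw [h4, abs_div, abs_of_pos (mul_pos hu0 hgu), div_le_div_iff₀ (by positivity) (by positivity)]
    calc |u * D u - 4 * g u| * u ^ 2 ≤ κ * D u * u ^ 2 := by gcongr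
      _ = κ * u * (u * D u) := by ring
      _ ≤ κ * u * (8 * g u) := by gcongr
      _ = _ := by ring
  set ρ : ℝ → ℝ := fun u => Real.log (g u) - 4 * Real.log u with hρ
  have hρ' : ∀ u, 0 < u → HasDerivAt ρ (D u / g u - 4 / u) u := by
    intro u hu
    have := ((hg u hu).log (hpos u hu).ne').fun_sub ((Real.hasDerivAt_log hu.ne').const_mul 4)
    simpa [div_eq_mul_inv] using this
  have hinv : ∀ u, 0 < u → HasDerivAt (fun u => 8 * κ / u) (-(8 * κ / u ^ 2)) u := by
    intro u hu
    have := (hasDerivAt_inv hu.ne').const_mul (8 * κ)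
    simpa [div_eq_mul_inv] using this
  have hmono : MonotoneOn (fun u => ρ u - 8 * κ / u) (Set.Ici (2 * κ)) := by
    refine monotoneOn_of_hasDerivWithinAt_nonneg (convex_Ici _)
      (f' := fun u => (D u / g u - 4 / u) - -(8 * κ / u ^ 2)) ?_ ?_ ?_
    · intro u hu
      have hu0 : 0 < u := by linarith [Set.mem_Ici.mp hu]
      exact ((hρ' u hu0).sub (hinv u hu0)).continuousAt.continuousWithinAt
    · intro u hu
      rw [interior_Ici] at hu
      have hu0 : 0 < u := by linarith [Set.mem_Ioi.mp hu]
      exact ((hρ' u hu0).sub (hinv u hu0)).hasDerivWithinAt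
    · intro u hu
      rw [interior_Ici] at hu
      linarith [(abs_le.mp (hder u (le_of_lt hu))).1]
  have hanti : AntitoneOn (fun u => ρ u + 8 * κ / u) (Set.Ici (2 * κ)) := by
    refine antitoneOn_of_hasDerivWithinAt_nonpos (convex_Ici _)
      (f' := fun u => (D u / g u - 4 / u) + -(8 * κ / u ^ 2)) ?_ ?_ ?_
    · intro u hu
      have hu0 : 0 < u := by linarith [Set.mem_Ici.mp hu]
      exact ((hρ' u hu0).add (hinv u hu0)).continuousAt.continuousWithinAt
    · intro u hu
      rw [interior_Ici] at hu
      have hu0 : 0 < u := by linarith [Set.mem_Ioi.mp hu]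
      exact ((hρ' u hu0).add (hinv u hu0)).hasDerivWithinAt
    · intro u hu
      rw [interior_Ici] at hu
      linarith [(abs_le.mp (hder u (le_of_lt hu))).2]
  have hmono' : Monotone fun u => ρ (max u (2 * κ)) - 8 * κ / max u (2 * κ) := fun a b hab =>
    hmono (Set.mem_Ici.mpr (le_max_right a _)) (Set.mem_Ici.mpr (le_max_right b _))
      (max_le_max_right _ hab)
  have hbdd : BddAbove (Set.range fun u => ρ (max u (2 * κ)) - 8 * κ / max u (2 * κ)) := by
    refine ⟨ρ (2 * κ) + 8 * κ / (2 * κ), ?_⟩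
    rintro _ ⟨u, rfl⟩
    have h1 := hanti Set.self_mem_Ici (le_max_right u (2 * κ) : max u (2 * κ) ∈ Set.Ici (2 * κ))
      (le_max_right u (2 * κ))
    have h2 : 0 < max u (2 * κ) := lt_max_of_lt_right (by linarith)
    have h3 : 0 ≤ 8 * κ / max u (2 * κ) := by positivity
    simp only at h1 ⊢
    linarith
  set l := ⨆ u, ρ (max u (2 * κ)) - 8 * κ / max u (2 * κ)
  have hlim : Tendsto (fun u => ρ u - 8 * κ / u) atTop (𝓝 l) := by
    refine (tendsto_atTop_ciSup hmono' hbdd).congr' ?_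
    filter_upwards [eventually_ge_atTop (2 * κ)] with u hu
    rw [max_eq_left hu]
  have hinv0 : Tendsto (fun u : ℝ => 8 * κ / u) atTop (𝓝 0) := tendsto_const_nhds.div_atTop tendsto_id
  have hlimρ : Tendsto ρ atTop (𝓝 l) := by
    simpa using hlim.add hinv0
  have hlow : ∀ u, 2 * κ ≤ u → ρ u - 8 * κ / u ≤ l := by
    intro u hu
    refine ge_of_tendsto hlim ?_
    filter_upwards [eventually_ge_atTop u] with v hv
    exact hmono hu (hu.trans hv) hv
  have hup : ∀ u, 2 * κ ≤ u → l ≤ ρ u + 8 * κ / u := by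
    intro u hu
    refine le_of_tendsto (by simpa using hlimρ.add hinv0) ?_
    filter_upwards [eventually_ge_atTop u] with v hv
    exact hanti hu (hu.trans hv) hv
  have hexp : ∀ u, 0 < u → g u = Real.exp (ρ u) * u ^ 4 := by
    intro u hu
    rw [hρ, Real.exp_sub, Real.exp_log (hpos u hu), mul_comm 4, Real.exp_mul, Real.exp_log hu]
    norm_cast
    field_simp
  refine ⟨Real.exp l, Real.exp_pos l, ?_, fun u hu => ?_⟩
  · refine ((Real.continuous_exp.tendsto l).comp hlimρ).congr' ?_
    filter_upwards [eventually_gt_atTop 0] with u hu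
    rw [hexp u hu]
    simp only [Function.comp]
    field_simp
  · have hu0 : 0 < u := by linarith
    set θ := ρ u - l with hθ
    set ε := 8 * κ / u with hε
    have hε0 : 0 < ε := by positivity
    have hε4 : ε ≤ 4 := by
      rw [hε, div_le_iff₀ hu0]
      linarith
    have hθ1 : θ ≤ ε := by linarith [hlow u hu]
    have hθ2 : -ε ≤ θ := by linarith [hup u hu]
    have hE : |Real.exp θ - 1| ≤ Real.exp 4 * ε := by
      have h4 : 1 ≤ Real.exp 4 := Real.one_le_exp (by norm_num)
      rw [abs_le]
      constructor
      · nlinarith [Real.add_one_le_exp θ]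
      · have h1 := Real.add_one_le_exp (-ε)
        have h2 : Real.exp ε - 1 ≤ Real.exp ε * ε := by
          have h3 : Real.exp ε * Real.exp (-ε) = 1 := by rw [← Real.exp_add]; simp
          nlinarith [Real.exp_pos ε]
        have h3 : Real.exp ε * ε ≤ Real.exp 4 * ε := by gcongr
        linarith [Real.exp_le_exp.mpr hθ1]
    have : g u - Real.exp l * u ^ 4 = (Real.exp θ - 1) * (Real.exp l * u ^ 4) := by
      have e : Real.exp (ρ u) = Real.exp θ * Real.exp l := by
        rw [← Real.exp_add, hθ, sub_add_cancel]
      rw [hexp u hu0, e]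
      ring
    rw [this, abs_mul, abs_of_pos (by positivity : 0 < Real.exp l * u ^ 4)]
    calc _ ≤ Real.exp 4 * ε * (Real.exp l * u ^ 4) := by gcongr
      _ = _ := by rw [hε]; ring

theorem hasDerivAt_max_sub_zero_sq (a x : ℝ) :
    HasDerivAt (fun v : ℝ => max (v - a) 0 ^ 2) (2 * max (x - a) 0) x := by
  rcases lt_trichotomy x a with h | h | h
  · rw [max_eq_right (by linarith), mul_zero]
    refine (hasDerivAt_const x (0 : ℝ)).congr_of_eventuallyEq ?_
    filter_upwards [Iio_mem_nhds h] with v hv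
    rw [max_eq_right (by linarith [Set.mem_Iio.mp hv])]
    simp
  · subst h
    rw [sub_self, max_self, mul_zero, hasDerivAt_iff_isLittleO]
    have h1 : (fun v : ℝ => (v - x) ^ 2) =o[nhds x] fun v => v - x := by
      have := (hasDerivAt_iff_isLittleO.mp
        (((hasDerivAt_id x).sub_const x).pow 2))
      simpa using this
    refine Asymptotics.IsBigO.trans_isLittleO (Asymptotics.IsBigO.of_bound 1 ?_) h1
    refine Filter.Eventually.of_forall fun v => ?_
    simp only [sub_self, max_self, smul_zero, sub_zero, one_mul, norm_pow, ne_eq,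
      OfNat.ofNat_ne_zero, not_false_eq_true, zero_pow]
    refine pow_le_pow_left₀ (norm_nonneg _) ?_ 2
    rw [Real.norm_eq_abs, Real.norm_eq_abs, abs_of_nonneg (le_max_right _ _)]
    exact max_le (le_abs_self _) (abs_nonneg _)
  · rw [max_eq_left (by linarith)]
    have h1 : HasDerivAt (fun v : ℝ => (v - a) ^ 2) (2 * (x - a)) x := by
      simpa using ((hasDerivAt_id x).sub_const a).fun_pow 2
    refine h1.congr_of_eventuallyEq ?_
    filter_upwards [Ioi_mem_nhds h] with v hv
    rw [max_eq_left (by linarith [Set.mem_Ioi.mp hv])]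

/-- The sum of `coprimeTwoPowOmega q n / n * (u - log n) ^ 2` over `n ≤ exp u`. -/
noncomputable def logSqMean (q : ℕ) (u : ℝ) : ℝ :=
  ∑' n : ℕ, coprimeTwoPowOmega q n / n * max (u - Real.log n) 0 ^ 2

theorem logSqMean_eq_sum (q : ℕ) {u : ℝ} {N : ℕ} (h : Real.exp u < N + 1) :
    logSqMean q u =
      ∑ n ∈ Finset.Ioc 0 N, coprimeTwoPowOmega q n / n * max (u - Real.log n) 0 ^ 2 := by
  refine tsum_eq_sum fun n hn => ?_
  rcases n.eq_zero_or_pos with rfl | hn0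
  · simp
  · have hNn : N < n := by
      by_contra hle
      exact hn (Finset.mem_Ioc.mpr ⟨hn0, not_lt.mp hle⟩)
    have hn1 : (N : ℝ) + 1 ≤ n := by exact_mod_cast hNn
    have : u ≤ Real.log n := by
      rw [Real.le_log_iff_exp_le (by exact_mod_cast hn0)]
      linarith
    rw [max_eq_right (by linarith)]
    simp

theorem hasDerivAt_logSqMean (q : ℕ) {u : ℝ} {N : ℕ} (h : Real.exp u < N + 1) :
    HasDerivAt (logSqMean q) (2 * ∑ n ∈ Finset.Ioc 0 N,
      coprimeTwoPowOmega q n / n * max (u - Real.log n) 0) u := by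
  have h1 : HasDerivAt (fun v => ∑ n ∈ Finset.Ioc 0 N,
      coprimeTwoPowOmega q n / n * max (v - Real.log n) 0 ^ 2) (∑ n ∈ Finset.Ioc 0 N,
      coprimeTwoPowOmega q n / n * (2 * max (u - Real.log n) 0)) u :=
    HasDerivAt.fun_sum fun n _ => (hasDerivAt_max_sub_zero_sq _ u).const_mul _
  have h2 : (∑ n ∈ Finset.Ioc 0 N, coprimeTwoPowOmega q n / n * (2 * max (u - Real.log n) 0)) =
      2 * ∑ n ∈ Finset.Ioc 0 N, coprimeTwoPowOmega q n / n * max (u - Real.log n) 0 := by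
    rw [Finset.mul_sum]
    exact Finset.sum_congr rfl fun n _ => by ring
  rw [← h2]
  refine h1.congr_of_eventuallyEq ?_
  filter_upwards [(isOpen_lt Real.continuous_exp continuous_const).mem_nhds h] with v hv
  exact logSqMean_eq_sum q hv

theorem continuous_logSqMean (q : ℕ) : Continuous (logSqMean q) :=
  continuous_iff_continuousAt.mpr fun u =>
    (hasDerivAt_logSqMean q (Nat.lt_floor_add_one (Real.exp u))).continuousAt

theorem logSqMean_nonneg (q : ℕ) (u : ℝ) : 0 ≤ logSqMean q u :=
  tsum_nonneg fun n => mul_nonneg (div_nonneg (coprimeTwoPowOmega_nonneg q n) n.cast_nonneg)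
    (sq_nonneg _)

theorem logSqMean_pos (q : ℕ) {u : ℝ} (hu : 0 < u) : 0 < logSqMean q u := by
  rw [logSqMean_eq_sum q (Nat.lt_floor_add_one (Real.exp u))]
  refine Finset.sum_pos' (fun n _ => mul_nonneg (div_nonneg (coprimeTwoPowOmega_nonneg q n)
    n.cast_nonneg) (sq_nonneg _)) ⟨1, ?_, ?_⟩
  · rw [Finset.mem_Ioc]
    exact ⟨one_pos, Nat.le_floor (by simpa using hu.le)⟩
  · simp [coprimeTwoPowOmega, hu]

theorem logSqMean_mono (q : ℕ) : Monotone (logSqMean q) := by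
  intro a b hab
  have hb := Nat.lt_floor_add_one (Real.exp b)
  rw [logSqMean_eq_sum q hb, logSqMean_eq_sum q ((Real.exp_le_exp.mpr hab).trans_lt hb)]
  refine Finset.sum_le_sum fun n _ => ?_
  have := div_nonneg (coprimeTwoPowOmega_nonneg q n) (Nat.cast_nonneg (α := ℝ) n)
  gcongr

open MeasureTheory Filter Topology

theorem integrableOn_and_integral_max_sub_sq_mul_exp_neg {a t : ℝ} (ha : 0 ≤ a) (ht : 0 < t) :
    IntegrableOn (fun v => max (t * v - a) 0 ^ 2 * Real.exp (-v)) (Set.Ioi 0) ∧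
      ∫ v in Set.Ioi 0, max (t * v - a) 0 ^ 2 * Real.exp (-v) =
        2 * t ^ 2 * Real.exp (-(a / t)) := by
  set Q : ℝ → ℝ := fun v =>
    -((t * v - a) ^ 2 + 2 * t * (t * v - a) + 2 * t ^ 2) * Real.exp (-v) with hQ
  have hQd : ∀ v ∈ Set.Ici (a / t), HasDerivAt Q ((t * v - a) ^ 2 * Real.exp (-v)) v := by
    intro v _
    have h1 : HasDerivAt (fun v => t * v - a) t v := by
      simpa using ((hasDerivAt_id v).const_mul t).sub_const a
    have h2 := (((h1.fun_pow 2).fun_add (h1.const_mul (2 * t))).add_const (2 * t ^ 2)).fun_neg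
    have h3 : HasDerivAt (fun v : ℝ => Real.exp (-v)) (-Real.exp (-v)) v := by
      simpa using (hasDerivAt_neg v).exp
    refine (h2.fun_mul h3).congr_deriv ?_
    push_cast
    ring
  have hQlim : Tendsto Q atTop (𝓝 0) := by
    have e0 := Real.tendsto_pow_mul_exp_neg_atTop_nhds_zero 0
    have e1 := Real.tendsto_pow_mul_exp_neg_atTop_nhds_zero 1
    have e2 := Real.tendsto_pow_mul_exp_neg_atTop_nhds_zero 2
    have := ((e2.const_mul (-t ^ 2)).add (e1.const_mul (2 * t * a - 2 * t ^ 2))).add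
      (e0.const_mul (-a ^ 2 + 2 * t * a - 2 * t ^ 2))
    simp only [mul_zero, add_zero] at this
    refine this.congr fun v => ?_
    rw [hQ]
    ring
  have hpos : ∀ v ∈ Set.Ioi (a / t), 0 ≤ (t * v - a) ^ 2 * Real.exp (-v) := fun v _ => by
    positivity
  have hQint := integrableOn_Ioi_deriv_of_nonneg' hQd hpos hQlim
  have hval := integral_Ioi_of_hasDerivAt_of_nonneg' hQd hpos hQlim
  have hcongr : Set.EqOn (fun v => (t * v - a) ^ 2 * Real.exp (-v))
      (fun v => max (t * v - a) 0 ^ 2 * Real.exp (-v)) (Set.Ioi (a / t)) := by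
    intro v hv
    have : a < t * v := by
      rw [Set.mem_Ioi, div_lt_iff₀ ht] at hv
      linarith
    simp only
    rw [max_eq_left (by linarith)]
  have hzero : ∀ v ∈ Set.Ioc 0 (a / t), max (t * v - a) 0 ^ 2 * Real.exp (-v) = 0 := by
    intro v hv
    have : t * v ≤ a := by
      have := hv.2
      rw [le_div_iff₀ ht] at this
      linarith
    rw [max_eq_right (by linarith)]
    simp
  have hat : 0 ≤ a / t := by positivity
  have hsplit := Set.Ioc_union_Ioi_eq_Ioi hat
  have hQint1 : IntegrableOn (fun v => max (t * v - a) 0 ^ 2 * Real.exp (-v)) (Set.Ioc 0 (a / t)) :=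
    (integrableOn_zero).congr_fun (fun v hv => (hzero v hv).symm) measurableSet_Ioc
  have hQint2 := hQint.congr_fun hcongr measurableSet_Ioi
  refine ⟨hsplit ▸ hQint1.union hQint2, ?_⟩
  rw [← hsplit, setIntegral_union Set.Ioc_disjoint_Ioi_same measurableSet_Ioi hQint1 hQint2,
    setIntegral_eq_zero_of_forall_eq_zero hzero, ← setIntegral_congr_fun measurableSet_Ioi hcongr,
    hval, hQ]
  simp only
  rw [mul_div_cancel₀ _ ht.ne']
  ring

theorem integral_logSqMean_mul_exp_neg (q : ℕ) {t : ℝ} (ht : 0 < t)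
    (hs : Summable fun n : ℕ => coprimeTwoPowOmega q n / (n : ℝ) ^ (1 + 1 / t)) :
    ∫ v in Set.Ioi 0, logSqMean q (t * v) * Real.exp (-v) =
      2 * t ^ 2 * ∑' n : ℕ, coprimeTwoPowOmega q n / (n : ℝ) ^ (1 + 1 / t) := by
  have hI := fun n : ℕ =>
    integrableOn_and_integral_max_sub_sq_mul_exp_neg (Real.log_natCast_nonneg n) ht
  set F : ℕ → ℝ → ℝ := fun n v =>
    coprimeTwoPowOmega q n / n * (max (t * v - Real.log n) 0 ^ 2 * Real.exp (-v)) with hF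
  have hFint : ∀ n, IntegrableOn (F n) (Set.Ioi 0) := fun n => (hI n).1.const_mul _
  have hFnn : ∀ n v, 0 ≤ F n v := fun n v =>
    mul_nonneg (div_nonneg (coprimeTwoPowOmega_nonneg q n) n.cast_nonneg) (by positivity)
  have hFval : ∀ n, ∫ v in Set.Ioi 0, F n v =
      2 * t ^ 2 * (coprimeTwoPowOmega q n / (n : ℝ) ^ (1 + 1 / t)) := by
    intro n
    rw [hF]
    simp only
    rw [integral_const_mul, (hI n).2]
    rcases n.eq_zero_or_pos with rfl | hn
    · simp only [Nat.cast_zero, Real.zero_rpow (by positivity : 1 + 1 / t ≠ 0), div_zero, zero_mul,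
        mul_zero]
    · have hn' : (0 : ℝ) < n := by exact_mod_cast hn
      have h1 : (n : ℝ) ^ (1 + 1 / t) = n * (Real.exp (-(Real.log n / t)))⁻¹ := by
        rw [Real.rpow_add hn', Real.rpow_one, ← Real.exp_neg, neg_neg, Real.rpow_def_of_pos hn']
        ring_nf
      rw [h1]
      have := (Real.exp_pos (-(Real.log n / t))).ne'
      field_simp
  have hsum : Summable fun n => ∫ v in Set.Ioi 0, ‖F n v‖ := by
    refine (hs.mul_left (2 * t ^ 2)).congr fun n => ?_
    rw [← hFval]
    exact integral_congr_ae (Eventually.of_forall fun v => (Real.norm_of_nonneg (hFnn n v)).symm)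
  have hmain := hasSum_integral_of_summable_integral_norm hFint hsum
  simp only [hFval] at hmain
  rw [← tsum_mul_left, hmain.tsum_eq]
  refine integral_congr_ae (Eventually.of_forall fun v => ?_)
  simp only [logSqMean, hF]
  rw [← tsum_mul_right]
  exact tsum_congr fun n => by ring

theorem tendsto_integral_div_pow_four {g : ℝ → ℝ} (hg : Continuous g) (hmono : Monotone g)
    (hnn : ∀ u, 0 ≤ g u) {c : ℝ} (hlim : Tendsto (fun u => g u / u ^ 4) atTop (𝓝 c)) :
    Tendsto (fun t => (∫ v in Set.Ioi 0, g (t * v) * Real.exp (-v)) / t ^ 4) atTop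
      (𝓝 (24 * c)) := by
  obtain ⟨M, hM0, hM⟩ : ∃ M, 0 ≤ M ∧ ∀ u, g u ≤ M * (1 + u ^ 4) := by
    obtain ⟨U, hU⟩ := eventually_atTop.mp (hlim.eventually (eventually_le_nhds (lt_add_one c)))
    have hU1 : 0 < max U 1 := lt_max_of_lt_right one_pos
    have h1 := hU (max U 1) (le_max_left _ _)
    have hc : 0 ≤ c + 1 := le_trans (div_nonneg (hnn _) (by positivity)) h1
    refine ⟨g (max U 1) + (c + 1), add_nonneg (hnn _) hc, fun u => ?_⟩
    have hg0 := hnn (max U 1)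
    have hu4 : 0 ≤ u ^ 4 := by positivity
    rcases le_total u (max U 1) with h | h
    · have := hmono h
      nlinarith [mul_nonneg hg0 hu4, mul_nonneg hc hu4]
    · have h2 := hU u ((le_max_left _ _).trans h)
      rw [div_le_iff₀ (pow_pos (hU1.trans_le h) 4)] at h2
      nlinarith [mul_nonneg hg0 hu4]
  have hgamma : ∀ k : ℕ, IntegrableOn (fun v : ℝ => v ^ k * Real.exp (-v)) (Set.Ioi 0) ∧
      ∫ v in Set.Ioi (0 : ℝ), v ^ k * Real.exp (-v) = k.factorial := by
    intro k
    have hk : (0 : ℝ) < k + 1 := by positivity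
    have h1 := Real.GammaIntegral_convergent hk
    have h2 := Real.Gamma_eq_integral hk
    rw [Real.Gamma_nat_eq_factorial] at h2
    simp only [add_sub_cancel_right, Real.rpow_natCast] at h1 h2
    refine ⟨h1.congr_fun (fun v _ => mul_comm _ _) measurableSet_Ioi, ?_⟩
    rw [h2]
    exact integral_congr_ae (Eventually.of_forall fun v => mul_comm _ _)
  have hval : ∫ v in Set.Ioi (0 : ℝ), c * (v ^ 4 * Real.exp (-v)) = 24 * c := by
    rw [integral_const_mul, (hgamma 4).2]
    norm_num [Nat.factorial]
    ring
  rw [← hval]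
  simp_rw [← integral_div]
  refine tendsto_integral_filter_of_dominated_convergence
    (fun v => M * (v ^ 0 * Real.exp (-v)) + M * (v ^ 4 * Real.exp (-v))) ?_ ?_ ?_ ?_
  · refine Eventually.of_forall fun t => Continuous.aestronglyMeasurable ?_
    fun_prop
  · filter_upwards [eventually_ge_atTop 1] with t ht
    refine Eventually.of_forall fun v => ?_
    have ht4 : 1 ≤ t ^ 4 := one_le_pow₀ ht
    rw [Real.norm_of_nonneg (div_nonneg (mul_nonneg (hnn _) (Real.exp_pos _).le) (by positivity)),
      div_le_iff₀ (by positivity)]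
    calc g (t * v) * Real.exp (-v) ≤ M * (1 + (t * v) ^ 4) * Real.exp (-v) := by
          gcongr
          exact hM _
      _ ≤ M * (t ^ 4 + (t * v) ^ 4) * Real.exp (-v) := by gcongr
      _ = _ := by ring
  · exact ((hgamma 0).1.const_mul M).add ((hgamma 4).1.const_mul M)
  · refine (ae_restrict_iff' measurableSet_Ioi).mpr (Eventually.of_forall fun v hv => ?_)
    have hv0 : 0 < v := hv
    have h1 : Tendsto (fun t => t * v) atTop atTop := tendsto_id.atTop_mul_const hv0
    refine ((hlim.comp h1).mul_const (v ^ 4 * Real.exp (-v))).congr' ?_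
    filter_upwards [eventually_gt_atTop 0] with t ht
    simp only [Function.comp]
    field_simp

open scoped ArithmeticFunction.zeta in
open ArithmeticFunction in
theorem summable_coprimeTwoPowOmega_div_rpow (q : ℕ) {s : ℝ} (hs : 1 < s) :
    Summable fun n : ℕ => coprimeTwoPowOmega q n / (n : ℝ) ^ s := by
  have hz : LSeriesSummable (fun n => ((ζ : ArithmeticFunction ℂ) n)) (s : ℂ) := by
    have := LSeriesSummable_zeta_iff.mpr (show 1 < (s : ℂ).re by simpa using hs)
    exact (LSeriesSummable_congr _ fun {n} hn => by simp).mp this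
  have h := (ArithmeticFunction.LSeriesSummable_mul hz hz).norm
  refine h.of_nonneg_of_le (fun n => div_nonneg (coprimeTwoPowOmega_nonneg q n) (by positivity))
    fun n => ?_
  rw [LSeries.norm_term_eq]
  split_ifs with hn
  · rw [hn, Nat.cast_zero, Real.zero_rpow (by linarith), div_zero]
  · rw [Complex.ofReal_re]
    gcongr
    have h1 : ((ζ : ArithmeticFunction ℂ) * (ζ : ArithmeticFunction ℂ)) n =
        (n.divisors.card : ℂ) := by
      rw [coe_zeta_mul_apply]
      rw [Finset.sum_congr rfl fun d hd => by
        rw [natCoe_apply, zeta_apply_ne (Nat.pos_of_mem_divisors hd).ne', Nat.cast_one]]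
      simp
    rw [h1, Complex.norm_natCast, Nat.card_divisors hn]
    unfold coprimeTwoPowOmega
    split_ifs
    · push_cast
      rw [← Finset.prod_const]
      refine Finset.prod_le_prod (fun _ _ => by norm_num) fun p hp => ?_
      have := (Nat.prime_of_mem_primeFactors hp).factorization_pos_of_dvd hn
        (Nat.dvd_of_mem_primeFactors hp)
      have : (1 : ℝ) ≤ n.factorization p := by exact_mod_cast this
      linarith
    · positivity

theorem coprimeTwoPowOmega_mul_of_coprime (q : ℕ) {m n : ℕ} (h : m.Coprime n) :
    coprimeTwoPowOmega q (m * n) = coprimeTwoPowOmega q m * coprimeTwoPowOmega q n := by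
  unfold coprimeTwoPowOmega
  rw [h.primeFactors_mul, Finset.card_union_of_disjoint h.disjoint_primeFactors, pow_add]
  have : (m * n).gcd q = 1 ↔ m.gcd q = 1 ∧ n.gcd q = 1 := Nat.coprime_mul_iff_left
  simp only [this, ite_and]
  split_ifs <;> simp

theorem coprimeTwoPowOmega_prime_pow (q : ℕ) {p : ℕ} (hp : p.Prime) (e : ℕ) :
    coprimeTwoPowOmega q (p ^ e) =
      if e = 0 then 1 else if p ∣ q then 0 else 2 := by
  rcases eq_or_ne e 0 with rfl | he
  · simp [coprimeTwoPowOmega]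
  · have : (p ^ e).gcd q = 1 ↔ ¬ p ∣ q := by
      rw [← hp.coprime_iff_not_dvd]
      exact Nat.coprime_pow_left_iff (Nat.pos_of_ne_zero he) p q
    simp only [coprimeTwoPowOmega, this, he, if_false, Nat.primeFactors_prime_pow he hp]
    split_ifs <;> simp_all

theorem natCast_rpow_neg_mem_Ioo {p : ℕ} (hp : p.Prime) {s : ℝ} (hs : 0 < s) :
    (p : ℝ) ^ (-s) ∈ Set.Ioo (0 : ℝ) 1 := by
  have h1 : (1 : ℝ) < p := by exact_mod_cast hp.one_lt
  exact ⟨by positivity, Real.rpow_lt_one_of_one_lt_of_neg h1 (by linarith)⟩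

theorem tsum_coprimeTwoPowOmega_prime_pow (q : ℕ) {p : ℕ} (hp : p.Prime) {s : ℝ} (hs : 0 < s) :
    ∑' e : ℕ, coprimeTwoPowOmega q (p ^ e) / ((p ^ e : ℕ) : ℝ) ^ s =
      if p ∣ q then 1 else (1 + (p : ℝ) ^ (-s)) / (1 - (p : ℝ) ^ (-s)) := by
  obtain ⟨h0, h1⟩ := natCast_rpow_neg_mem_Ioo hp hs
  set a := (p : ℝ) ^ (-s) with ha
  set b : ℝ := if p ∣ q then 0 else 2 with hb
  have hgeo := ((hasSum_geometric_of_lt_one h0.le h1).mul_left b).add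
    (hasSum_ite_eq 0 (1 - b))
  have hterm : ∀ e : ℕ, coprimeTwoPowOmega q (p ^ e) / ((p ^ e : ℕ) : ℝ) ^ s =
      b * a ^ e + if e = 0 then 1 - b else 0 := by
    intro e
    have : ((p ^ e : ℕ) : ℝ) ^ s = (a ^ e)⁻¹ := by
      rw [Nat.cast_pow, ha, Real.rpow_neg p.cast_nonneg, inv_pow, inv_inv, ← Real.rpow_natCast,
        ← Real.rpow_natCast, ← Real.rpow_mul p.cast_nonneg, ← Real.rpow_mul p.cast_nonneg, mul_comm]
    rw [this, coprimeTwoPowOmega_prime_pow q hp, div_inv_eq_mul]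
    rw [hb]
    split_ifs with he <;> simp [he, mul_comm]
  simp only [hterm]
  rw [hgeo.tsum_eq, hb]
  have : 1 - a ≠ 0 := by linarith
  split_ifs
  · ring
  · field_simp
    ring

theorem hasProd_inv_one_sub_rpow_neg {s : ℝ} (hs : 1 < s) :
    HasProd (Set.mulIndicator {p | Nat.Prime p} fun p : ℕ => (1 - (p : ℝ) ^ (-s))⁻¹)
      (∑' n : ℕ, 1 / (n : ℝ) ^ s) := by
  have h := EulerProduct.eulerProduct_hasProd_mulIndicator (R := ℝ)
    (f := fun n : ℕ => 1 / (n : ℝ) ^ s) (by simp)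
    (fun {m n} _ => by
      rw [Nat.cast_mul, Real.mul_rpow m.cast_nonneg n.cast_nonneg]
      ring)
    (by
      refine (Real.summable_one_div_nat_rpow.mpr hs).congr fun n => ?_
      exact (Real.norm_of_nonneg (by positivity)).symm)
    (by simp [Real.zero_rpow (by linarith : s ≠ 0)])
  refine h.congr_fun (congrFun (Set.mulIndicator_congr fun p hp => ?_))
  obtain ⟨h0, h1⟩ := natCast_rpow_neg_mem_Ioo (p := p) hp (by linarith : 0 < s)
  rw [← (hasSum_geometric_of_lt_one h0.le h1).tsum_eq]
  refine tsum_congr fun e => ?_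
  rw [one_div, Nat.cast_pow, Real.rpow_neg p.cast_nonneg, inv_pow, ← Real.rpow_natCast,
    ← Real.rpow_natCast, ← Real.rpow_mul p.cast_nonneg, ← Real.rpow_mul p.cast_nonneg, mul_comm]

theorem tsum_coprimeTwoPowOmega_mul {q : ℕ} (hq : q ≠ 0) {s : ℝ} (hs : 1 < s) :
    (∑' n : ℕ, coprimeTwoPowOmega q n / (n : ℝ) ^ s) * (∑' n : ℕ, 1 / (n : ℝ) ^ (2 * s)) *
      ∏ p ∈ q.primeFactors, (1 + (p : ℝ) ^ (-s)) / (1 - (p : ℝ) ^ (-s)) =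
    (∑' n : ℕ, 1 / (n : ℝ) ^ s) ^ 2 := by
  have h1 := EulerProduct.eulerProduct_hasProd_mulIndicator (R := ℝ)
    (f := fun n : ℕ => coprimeTwoPowOmega q n / (n : ℝ) ^ s) (by simp [coprimeTwoPowOmega])
    (fun {m n} h => by
      rw [Nat.cast_mul, Real.mul_rpow m.cast_nonneg n.cast_nonneg,
        coprimeTwoPowOmega_mul_of_coprime q h]
      ring)
    (by
      refine (summable_coprimeTwoPowOmega_div_rpow q hs).congr fun n => ?_
      exact (Real.norm_of_nonneg
        (div_nonneg (coprimeTwoPowOmega_nonneg q n) (by positivity))).symm)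
    (by simp [Real.zero_rpow (by linarith : s ≠ 0)])
  have h2 := hasProd_inv_one_sub_rpow_neg (by linarith : 1 < 2 * s)
  have h3 : HasProd (fun p : ℕ => if p ∈ q.primeFactors then
      (1 + (p : ℝ) ^ (-s)) / (1 - (p : ℝ) ^ (-s)) else 1)
      (∏ p ∈ q.primeFactors, (1 + (p : ℝ) ^ (-s)) / (1 - (p : ℝ) ^ (-s))) := by
    rw [← Finset.prod_congr rfl fun p hp => if_pos hp]
    exact hasProd_prod_of_ne_finset_one fun p hp => if_neg hp
  have h4 := (hasProd_inv_one_sub_rpow_neg hs).mul (hasProd_inv_one_sub_rpow_neg hs)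
  rw [← sq] at h4
  refine ((h1.mul h2).mul h3).unique (h4.congr_fun fun p => ?_)
  by_cases hp : p.Prime
  · have hps : p ∈ {p | Nat.Prime p} := hp
    rw [Set.mulIndicator_of_mem hps, Set.mulIndicator_of_mem hps, Set.mulIndicator_of_mem hps,
      tsum_coprimeTwoPowOmega_prime_pow q hp (by linarith)]
    obtain ⟨ha0, ha1⟩ := natCast_rpow_neg_mem_Ioo hp (by linarith : 0 < s)
    have e : (p : ℝ) ^ (-(2 * s)) = ((p : ℝ) ^ (-s)) ^ 2 := by
      rw [← Real.rpow_natCast, ← Real.rpow_mul p.cast_nonneg]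
      norm_num
      ring_nf
    rw [e]
    set a := (p : ℝ) ^ (-s)
    have n1 : 1 - a ≠ 0 := by linarith
    have n2 : 1 + a ≠ 0 := by linarith
    have n3 : 1 - a ^ 2 = (1 - a) * (1 + a) := by ring
    have hmem : p ∈ q.primeFactors ↔ p ∣ q := by simp [hp, hq]
    simp only [hmem, n3]
    split_ifs <;> field_simp
  · have hmem : p ∉ q.primeFactors := fun h => hp (Nat.prime_of_mem_primeFactors h)
    have hps : p ∉ {p | Nat.Prime p} := hp
    rw [if_neg hmem, Set.mulIndicator_of_notMem hps, Set.mulIndicator_of_notMem hps,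
      Set.mulIndicator_of_notMem hps, mul_one]

open Filter Topology in
theorem tendsto_tsum_one_div_nat_rpow_two_mul :
    Tendsto (fun s : ℝ => ∑' n : ℕ, 1 / (n : ℝ) ^ (2 * s)) (𝓝[>] 1) (𝓝 (Real.pi ^ 2 / 6)) := by
  rw [← hasSum_zeta_two.tsum_eq]
  refine tendsto_tsum_of_dominated_convergence (bound := fun n : ℕ => 1 / (n : ℝ) ^ 2)
    hasSum_zeta_two.summable (fun n => ?_) ?_
  · refine tendsto_nhdsWithin_of_tendsto_nhds ?_
    rcases n.eq_zero_or_pos with rfl | hn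
    · refine (tendsto_const_nhds (x := (0 : ℝ))).congr' ?_ |>.trans (by simp)
      filter_upwards [eventually_gt_nhds (zero_lt_one' ℝ)] with s hs
      rw [Nat.cast_zero, Real.zero_rpow (by positivity), div_zero]
    · have hn' : (n : ℝ) ≠ 0 := by positivity
      have h : ContinuousAt (fun s : ℝ => 1 / (n : ℝ) ^ (2 * s)) 1 :=
        continuousAt_const.div
          ((Real.continuousAt_const_rpow hn').comp (continuous_const.mul continuous_id).continuousAt)
          (by positivity)
      have h' := h.tendsto
      simpa using h'
  · filter_upwards [self_mem_nhdsWithin] with s hs n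
    have hs : 1 < s := hs
    rw [Real.norm_of_nonneg (by positivity)]
    rcases n.eq_zero_or_pos with rfl | hn
    · rw [Nat.cast_zero, Real.zero_rpow (by positivity), div_zero]
      simp
    · have hn' : (1 : ℝ) ≤ n := by exact_mod_cast hn
      gcongr
      rw [← Real.rpow_natCast]
      exact Real.rpow_le_rpow_of_exponent_le hn' (by push_cast; linarith)

open Filter Topology in
theorem tendsto_sub_one_sq_mul_tsum_coprimeTwoPowOmega {q : ℕ} (hq : q ≠ 0) :
    Tendsto (fun s : ℝ => (s - 1) ^ 2 * ∑' n : ℕ, coprimeTwoPowOmega q n / (n : ℝ) ^ s) (𝓝[>] 1)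
      (𝓝 ((∏ p ∈ q.primeFactors, (1 - 1 / (p : ℝ)) / (1 + 1 / (p : ℝ))) /
        (Real.pi ^ 2 / 6))) := by
  have h1 := tendsto_sub_mul_tsum_nat_rpow.pow 2
  have h2 := tendsto_tsum_one_div_nat_rpow_two_mul
  have h3 : Tendsto (fun s : ℝ => ∏ p ∈ q.primeFactors,
      (1 - (p : ℝ) ^ (-s)) / (1 + (p : ℝ) ^ (-s))) (𝓝[>] 1)
      (𝓝 (∏ p ∈ q.primeFactors, (1 - 1 / (p : ℝ)) / (1 + 1 / (p : ℝ)))) := by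
    refine tendsto_nhdsWithin_of_tendsto_nhds (tendsto_finsetProd _ fun p hp => ?_)
    have hp0 : (0 : ℝ) < p := by exact_mod_cast (Nat.prime_of_mem_primeFactors hp).pos
    have h : Tendsto (fun s : ℝ => (p : ℝ) ^ (-s)) (𝓝 1) (𝓝 (1 / (p : ℝ))) := by
      have : ContinuousAt (fun s : ℝ => (p : ℝ) ^ (-s)) 1 :=
        (Real.continuousAt_const_rpow hp0.ne').comp continuous_neg.continuousAt
      simpa [Real.rpow_neg hp0.le] using this.tendsto
    exact (h.const_sub 1).div (h.const_add 1) (by positivity)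
  have h4 := (h1.mul h3).div h2 (by positivity)
  rw [one_pow, one_mul] at h4
  refine h4.congr' ?_
  filter_upwards [self_mem_nhdsWithin] with s hs
  have hs : 1 < s := hs
  have hmul := tsum_coprimeTwoPowOmega_mul hq hs
  have hZ : 0 < ∑' n : ℕ, 1 / (n : ℝ) ^ (2 * s) := by
    refine (Real.summable_one_div_nat_rpow.mpr (by linarith)).tsum_pos (fun n => by positivity) 1 ?_
    simp
  have hinv : (∏ p ∈ q.primeFactors, (1 + (p : ℝ) ^ (-s)) / (1 - (p : ℝ) ^ (-s))) *
      ∏ p ∈ q.primeFactors, (1 - (p : ℝ) ^ (-s)) / (1 + (p : ℝ) ^ (-s)) = 1 := by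
    rw [← Finset.prod_mul_distrib]
    refine Finset.prod_eq_one fun p hp => ?_
    obtain ⟨ha0, ha1⟩ := natCast_rpow_neg_mem_Ioo (Nat.prime_of_mem_primeFactors hp)
      (by linarith : 0 < s)
    have n1 : 1 - (p : ℝ) ^ (-s) ≠ 0 := by linarith
    have n2 : 1 + (p : ℝ) ^ (-s) ≠ 0 := by linarith
    field_simp
  simp only [Pi.div_apply]
  rw [div_eq_iff hZ.ne', mul_pow, ← hmul]
  linear_combination ((s - 1) ^ 2 * (∑' n : ℕ, coprimeTwoPowOmega q n / (n : ℝ) ^ s) *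
    ∑' n : ℕ, 1 / (n : ℝ) ^ (2 * s)) * hinv

theorem sum_filter_gcd_eq_logSqMean (q : ℕ) {x : ℝ} (hx : 0 < x) :
    (∑ n ∈ (Finset.Icc 1 ⌊x⌋₊).filter (fun n => Nat.gcd n q = 1),
      (2 : ℝ) ^ n.primeFactors.card / n * Real.log (x / n) ^ 2) = logSqMean q (Real.log x) := by
  have hN : Real.exp (Real.log x) < (⌊x⌋₊ : ℝ) + 1 := by
    rw [Real.exp_log hx]
    exact Nat.lt_floor_add_one x
  have hI : Finset.Icc 1 ⌊x⌋₊ = Finset.Ioc 0 ⌊x⌋₊ := by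
    ext n
    simp only [Finset.mem_Icc, Finset.mem_Ioc]
    omega
  rw [logSqMean_eq_sum q hN, Finset.sum_filter, hI]
  refine Finset.sum_congr rfl fun n hn => ?_
  rw [Finset.mem_Ioc] at hn
  have hn0 : (0 : ℝ) < n := by exact_mod_cast hn.1
  have hnx : (n : ℝ) ≤ x := (Nat.le_floor_iff hx.le).mp hn.2
  rw [Real.log_div hx.ne' hn0.ne', max_eq_left (sub_nonneg.mpr (Real.log_le_log hn0 hnx)),
    coprimeTwoPowOmega]
  split_ifs <;> simp

theorem logSqMean_leading_coeff_eq {q : ℕ} (hq : q ≠ 0) {c : ℝ}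
    (hlim : Tendsto (fun u => logSqMean q u / u ^ 4) atTop (𝓝 c)) :
    c = (∏ p ∈ q.primeFactors, (1 - 1 / (p : ℝ)) / (1 + 1 / (p : ℝ))) /
      (12 * (Real.pi ^ 2 / 6)) := by
  have h1 := tendsto_integral_div_pow_four (continuous_logSqMean q) (logSqMean_mono q)
    (logSqMean_nonneg q) hlim
  have hs : Tendsto (fun t : ℝ => 1 + 1 / t) atTop (𝓝[>] 1) := by
    refine tendsto_nhdsWithin_iff.mpr ⟨?_, ?_⟩
    · simpa using tendsto_inv_atTop_zero.const_add (1 : ℝ)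
    · filter_upwards [eventually_gt_atTop 0] with t ht
      have : 0 < 1 / t := by positivity
      exact Set.mem_Ioi.mpr (by linarith)
  have h2 := ((tendsto_sub_one_sq_mul_tsum_coprimeTwoPowOmega hq).comp hs).const_mul 2
  have h3 := tendsto_nhds_unique (h1.congr' ?_) h2
  · rw [eq_div_iff (by positivity)]
    field_simp at h3 ⊢
    linarith
  · filter_upwards [eventually_gt_atTop 0] with t ht
    have ht' : 0 < 1 / t := by positivity
    rw [integral_logSqMean_mul_exp_neg q ht
      (summable_coprimeTwoPowOmega_div_rpow q (by linarith))]
    simp only [Function.comp]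
    field_simp
    ring

theorem exists_abs_logSqMean_sub_le :
    ∃ K : ℝ, 1 ≤ K ∧ ∀ q : ℕ, 2 ≤ q → ∃ c : ℝ, 0 < c ∧
      c = (∏ p ∈ q.primeFactors, (1 - 1 / (p : ℝ)) / (1 + 1 / (p : ℝ))) /
        (12 * (Real.pi ^ 2 / 6)) ∧
      ∀ u, 2 * (K * (1 + Real.log q.primeFactors.card)) ≤ u →
        |logSqMean q u - c * u ^ 4| ≤
          8 * Real.exp 4 * (K * (1 + Real.log q.primeFactors.card) / u) * (c * u ^ 4) := by
  obtain ⟨K, hK, h⟩ := exists_abs_mul_sum_sub_two_mul_sum_le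
  refine ⟨K, hK, fun q hq => ?_⟩
  have hω : (1 : ℝ) ≤ q.primeFactors.card := by exact_mod_cast one_le_card_primeFactors hq
  have hL := Real.log_nonneg hω
  obtain ⟨c, hc, hlim, hbound⟩ := exists_tendsto_div_pow_four_of_hasDerivAt
    (κ := K * (1 + Real.log q.primeFactors.card)) (by positivity)
    (fun u _ => hasDerivAt_logSqMean q (Nat.lt_floor_add_one (Real.exp u)))
    (fun u _ => mul_nonneg zero_le_two (Finset.sum_nonneg fun n _ => mul_nonneg
      (div_nonneg (coprimeTwoPowOmega_nonneg q n) n.cast_nonneg) (le_max_right _ _)))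
    (fun u hu => logSqMean_pos q hu) (fun u _ => by
      have hN := Nat.lt_floor_add_one (Real.exp u)
      have := h q hq u _ hN
      rw [logSqMean_eq_sum q hN]
      rw [abs_le] at this ⊢
      constructor <;> linarith [this.1, this.2])
  exact ⟨c, hc, logSqMean_leading_coeff_eq (by omega) hlim, hbound⟩

theorem one_add_log_card_primeFactors_le {q : ℕ} (hq : 2 ≤ q) :
    1 + Real.log q.primeFactors.card ≤ 2 * Real.log q := by
  have hω : (0 : ℝ) < q.primeFactors.card := by exact_mod_cast one_le_card_primeFactors hq
  have h1 := Real.log_le_sub_one_of_pos hω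
  have h2 : 2 ^ q.primeFactors.card ≤ q := by
    refine le_trans ?_ (Nat.le_of_dvd (by omega) (Nat.prod_primeFactors_dvd q))
    exact Finset.pow_card_le_prod _ _ _ fun p hp => (Nat.prime_of_mem_primeFactors hp).two_le
  have h3 : (q.primeFactors.card : ℝ) * Real.log 2 ≤ Real.log q := by
    rw [← Real.log_pow]
    exact Real.log_le_log (by positivity) (by exact_mod_cast h2)
  nlinarith [Real.log_two_gt_d9]

/-- Lemma 6 (second part): for `q ≥ 2` and `x ≥ √q`,
`∑_{n ≤ x, (n,q)=1} (2^{ω(n)}/n) (log(x/n))²`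
`= (1 + O((1 + log ω(q))/log q)) ((log x)⁴/(12 ζ(2))) ∏_{p|q} (1−1/p)/(1+1/p)`,
with an absolute implied constant (here `ζ(2) = π²/6`). -/
theorem fourth_moment_coprime_divisor_sum_asymptotic :
    ∃ C : ℝ, 0 < C ∧ ∀ (q : ℕ), 2 ≤ q → ∀ (x : ℝ), Real.sqrt q ≤ x →
      |(∑ n ∈ (Finset.Icc 1 ⌊x⌋₊).filter (fun n => Nat.gcd n q = 1),
            (2 : ℝ) ^ n.primeFactors.card / n * Real.log (x / n) ^ 2) -
          Real.log x ^ 4 / (12 * (Real.pi ^ 2 / 6)) *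
            ∏ p ∈ q.primeFactors, (1 - 1 / (p : ℝ)) / (1 + 1 / (p : ℝ))| ≤
        C * ((1 + Real.log q.primeFactors.card) / Real.log q) *
          (Real.log x ^ 4 / (12 * (Real.pi ^ 2 / 6)) *
            ∏ p ∈ q.primeFactors, (1 - 1 / (p : ℝ)) / (1 + 1 / (p : ℝ))) := by
  obtain ⟨K, hK, h⟩ := exists_abs_logSqMean_sub_le
  set B := 8 * Real.exp 4 with hB
  have hB0 : 0 < B := by positivity
  refine ⟨2 * B * K + (1 + B / 2) * 2048 * K ^ 4 + 4 * K, by positivity, fun q hq x hx => ?_⟩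
  obtain ⟨c, hc, hceq, hbound⟩ := h q hq
  have hq1 : (1 : ℝ) < q := by exact_mod_cast hq
  have hx0 : 0 < x := (Real.sqrt_pos.mpr (by linarith)).trans_le hx
  have hℓu : Real.log q ≤ 2 * Real.log x := by
    have := Real.log_le_log (Real.sqrt_pos.mpr (by linarith)) hx
    rw [Real.log_sqrt (by linarith)] at this
    linarith
  have hmain : Real.log x ^ 4 / (12 * (Real.pi ^ 2 / 6)) *
      ∏ p ∈ q.primeFactors, (1 - 1 / (p : ℝ)) / (1 + 1 / (p : ℝ)) = c * Real.log x ^ 4 := by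
    rw [hceq]
    ring
  have hL1 : 1 ≤ 1 + Real.log q.primeFactors.card :=
    le_add_of_nonneg_right (Real.log_natCast_nonneg _)
  have hLℓ := one_add_log_card_primeFactors_le hq
  rw [sum_filter_gcd_eq_logSqMean q hx0, hmain]
  set L := 1 + Real.log q.primeFactors.card
  set u := Real.log x
  have hℓ : 0 < Real.log q := Real.log_pos hq1
  set ℓ := Real.log q
  have hu : 0 < u := by linarith
  have hM : 0 < c * u ^ 4 := by positivity
  have hR : 0 < L / ℓ := by positivity
  rcases le_or_gt (2 * (K * L)) u with hcase | hcase
  · refine (hbound u hcase).trans ?_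
    have h1 : K * L / u ≤ 2 * K * (L / ℓ) := by
      rw [mul_div_assoc', div_le_div_iff₀ hu hℓ]
      have : 0 < K * L := by positivity
      nlinarith
    calc B * (K * L / u) * (c * u ^ 4) ≤ B * (2 * K * (L / ℓ)) * (c * u ^ 4) := by gcongr
      _ = 2 * B * K * (L / ℓ) * (c * u ^ 4) := by ring
      _ ≤ _ := by
        gcongr
        have : 0 < (1 + B / 2) * 2048 * K ^ 4 := by positivity
        linarith
  · have hg0 := logSqMean_nonneg q u
    have hκ : 0 < K * L := by positivity
    have h1 : logSqMean q u ≤ (1 + B / 2) * (c * (2 * (K * L)) ^ 4) := by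
      have e : K * L / (2 * (K * L)) = 1 / 2 := by field_simp
      have := hbound _ le_rfl
      rw [e] at this
      linarith [(abs_le.mp this).2, logSqMean_mono q hcase.le]
    have h2 : L ^ 4 ≤ 128 * (L / ℓ) * u ^ 4 := by
      have h3 : L ^ 3 ≤ (2 * ℓ) ^ 3 := by gcongr
      have h4 : ℓ ^ 4 ≤ (2 * u) ^ 4 := by gcongr
      rw [mul_div_assoc', div_mul_eq_mul_div, le_div_iff₀ hℓ]
      calc L ^ 4 * ℓ = L * ℓ * L ^ 3 := by ring
        _ ≤ L * ℓ * (2 * ℓ) ^ 3 := by gcongr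
        _ = 8 * L * ℓ ^ 4 := by ring
        _ ≤ 8 * L * (2 * u) ^ 4 := by gcongr
        _ = _ := by ring
    have h5 : logSqMean q u ≤ (1 + B / 2) * 2048 * K ^ 4 * (L / ℓ) * (c * u ^ 4) := by
      refine h1.trans ?_
      calc (1 + B / 2) * (c * (2 * (K * L)) ^ 4) = (1 + B / 2) * 16 * K ^ 4 * c * L ^ 4 := by ring
        _ ≤ (1 + B / 2) * 16 * K ^ 4 * c * (128 * (L / ℓ) * u ^ 4) := by gcongr
        _ = _ := by ring
    have h6 : c * u ^ 4 ≤ 4 * K * (L / ℓ) * (c * u ^ 4) := by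
      refine le_mul_of_one_le_left hM.le ?_
      rw [mul_div_assoc', le_div_iff₀ hℓ]
      linarith
    have h7 : 0 ≤ 2 * B * K * (L / ℓ) * (c * u ^ 4) := by positivity
    rw [abs_le]
    constructor <;> linarith
end
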